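/- Let n ≥ 4 be an integer. There exist a real constant D ≥ 0, δ > 0 and K > 0 such that for all real B ≥ 1: |#M(B) − D·B^{(n−1)/2}| ≤ K·B^{(n−1)/2−δ}, where M(B) is the set of tuples (x_0,…,x_n,y_0,…,y_n) of nonzero integers such that every y_i is squarefree, Σ_{i=0}^n x_i² y_i³ = 0, gcd(x_0y_0, x_1y_1, …, x_ny_n) = 1, and max_{0≤i≤n} |x_i² y_i³| ≤ B. -/

import Mathlib

namespace SquarefulHyperplane

open Finset

/-- The divisor bound `d(n) ≪ n ^ ε`. -/
theorem card_divisors_le_rpow {ε : ℝ} (hε : 0 < ε) :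
    ∃ C : ℝ, 1 ≤ C ∧ ∀ n : ℕ, n ≠ 0 → (#n.divisors : ℝ) ≤ C * (n : ℝ) ^ ε := by
  have hlog : 0 < Real.log 2 := Real.log_pos (by norm_num)
  set K : ℝ := 1 + 1 / (ε * Real.log 2) with hK
  have hK1 : 1 ≤ K := by rw [hK]; have : 0 < 1 / (ε * Real.log 2) := by positivity
                         linarith
  set P : ℕ := ⌈(2 : ℝ) ^ (1 / ε)⌉₊ with hP
  have hbern : ∀ a : ℕ, ((a : ℝ) + 1) ≤ K * (2 : ℝ) ^ (ε * a) := by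
    intro a
    have h1 : ε * a * Real.log 2 + 1 ≤ (2 : ℝ) ^ (ε * a) := by
      rw [Real.rpow_def_of_pos (by norm_num), mul_comm (Real.log 2)]
      exact Real.add_one_le_exp _
    calc (a : ℝ) + 1 ≤ K * (ε * a * Real.log 2 + 1) := by
          have : K * (ε * a * Real.log 2 + 1) = ε * a * Real.log 2 + a + 1
              + 1 / (ε * Real.log 2) := by
            rw [hK]; field_simp; ring
          rw [this]
          have h2 : 0 ≤ ε * a * Real.log 2 := by positivity
          have h3 : 0 < 1 / (ε * Real.log 2) := by positivity
          linarith
      _ ≤ _ := by gcongr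
  refine ⟨K ^ P, one_le_pow₀ hK1, fun n hn => ?_⟩
  have hn_eq : (n : ℝ) ^ ε = ∏ p ∈ n.primeFactors, ((p : ℝ) ^ (ε * n.factorization p)) := by
    conv_lhs => rw [← Nat.prod_factorization_pow_eq_self hn]
    rw [Finsupp.prod, Nat.support_factorization, Nat.cast_prod, ← Real.finsetProd_rpow]
    · refine prod_congr rfl fun p _ => ?_
      rw [Nat.cast_pow, ← Real.rpow_natCast, ← Real.rpow_mul (Nat.cast_nonneg p), mul_comm]
    · intro p _; positivity
  have hKprod : ∏ p ∈ n.primeFactors, (if p < P then K else 1) ≤ K ^ P := by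
    rw [← prod_filter, prod_const]
    refine pow_le_pow_right₀ hK1 ?_
    calc #{p ∈ n.primeFactors | p < P} ≤ #(range P) :=
          card_le_card fun p hp => by simpa using (mem_filter.mp hp).2
      _ = P := card_range P
  rw [Nat.card_divisors hn, hn_eq, Nat.cast_prod]
  refine le_trans ?_ (mul_le_mul_of_nonneg_right hKprod
    (prod_nonneg fun p _ => Real.rpow_nonneg (Nat.cast_nonneg p) _))
  rw [← prod_mul_distrib]
  refine prod_le_prod (fun p _ => Nat.cast_nonneg _) fun p hp => ?_
  have hp2 : (2 : ℝ) ≤ p := by exact_mod_cast (Nat.prime_of_mem_primeFactors hp).two_le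
  push_cast
  split_ifs with hpP
  · refine (hbern _).trans ?_
    gcongr
  · rw [one_mul]
    have h2 : (2 : ℝ) ^ (1 / ε) ≤ p := (Nat.le_ceil _).trans (by exact_mod_cast not_lt.mp hpP)
    calc ((n.factorization p : ℝ) + 1) ≤ (2 : ℝ) ^ (n.factorization p) := by
          exact_mod_cast Nat.lt_two_pow_self
      _ = ((2 : ℝ) ^ (1 / ε)) ^ (ε * n.factorization p) := by
          rw [← Real.rpow_mul (by norm_num), ← mul_assoc, one_div_mul_cancel hε.ne', one_mul,
            Real.rpow_natCast]
      _ ≤ _ := by gcongr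

/-- `Δ` bounds the number of integer divisors of every nonzero integer of size at most `M`. -/
def DivisorBound (M : ℕ) (Δ : ℝ) : Prop :=
  1 ≤ Δ ∧ ∀ m : ℤ, m ≠ 0 → m.natAbs ≤ M → (#m.divisors : ℝ) ≤ Δ

theorem card_int_divisors (m : ℤ) : #m.divisors = 2 * #m.natAbs.divisors := by
  rw [Int.divisors, card_disjUnion, card_map, card_map, two_mul]

theorem exists_divisorBound {ε : ℝ} (hε : 0 < ε) :
    ∃ C : ℝ, 1 ≤ C ∧ ∀ M : ℕ, M ≠ 0 → DivisorBound M (C * (M : ℝ) ^ ε) := by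
  obtain ⟨C, hC, h⟩ := card_divisors_le_rpow hε
  refine ⟨2 * C, by linarith, fun M hM => ⟨?_, fun m hm hmM => ?_⟩⟩
  · have : 1 ≤ (M : ℝ) ^ ε :=
      Real.one_le_rpow (by exact_mod_cast Nat.one_le_iff_ne_zero.mpr hM) hε.le
    nlinarith
  · rw [card_int_divisors]
    push_cast
    have := h m.natAbs (by simpa using hm)
    have h2 : (m.natAbs : ℝ) ^ ε ≤ (M : ℝ) ^ ε := by gcongr
    nlinarith

/-- The additive character `t ↦ exp (2 π i t)`. -/
noncomputable def e (t : ℝ) : ℂ := Complex.exp (2 * Real.pi * t * Complex.I)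

theorem e_add (s t : ℝ) : e (s + t) = e s * e t := by
  simp only [e, ← Complex.exp_add]
  push_cast
  ring_nf

@[simp] theorem e_zero : e 0 = 1 := by simp [e]

@[simp] theorem norm_e (t : ℝ) : ‖e t‖ = 1 := by
  have : (2 * Real.pi * t * Complex.I : ℂ) = ((2 * Real.pi * t : ℝ) : ℂ) * Complex.I := by
    push_cast; ring
  rw [e, this, Complex.norm_exp_ofReal_mul_I]

theorem conj_e (t : ℝ) : (starRingEnd ℂ) (e t) = e (-t) := by
  simp [e, ← Complex.exp_conj, Complex.conj_ofReal, Complex.conj_ofNat]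

theorem e_nat_mul (n : ℕ) (t : ℝ) : e (n * t) = e t ^ n := by
  rw [e, e, ← Complex.exp_nat_mul]
  push_cast
  ring_nf

theorem e_eq_one_iff {t : ℝ} : e t = 1 ↔ ∃ n : ℤ, t = n := by
  rw [e, Complex.exp_eq_one_iff]
  refine exists_congr fun n => ?_
  have h : (2 * Real.pi * Complex.I : ℂ) ≠ 0 := Complex.two_pi_I_ne_zero
  rw [show (2 * Real.pi * t * Complex.I : ℂ) = t * (2 * Real.pi * Complex.I) by ring,
    mul_left_inj' h]
  norm_cast

@[simp] theorem e_int (n : ℤ) : e n = 1 := e_eq_one_iff.mpr ⟨n, rfl⟩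

theorem continuous_e : Continuous e := by unfold e; fun_prop

theorem sum_e_mul_div {N : ℕ} (hN : N ≠ 0) (m : ℤ) :
    ∑ k ∈ range N, e (m * (k / N)) = if (N : ℤ) ∣ m then (N : ℂ) else 0 := by
  have hN' : (N : ℝ) ≠ 0 := Nat.cast_ne_zero.mpr hN
  have hterm : ∀ k ∈ range N, e (m * (k / N)) = e (m / N) ^ k := fun k _ => by
    rw [← e_nat_mul]; congr 1; field_simp
  rw [sum_congr rfl hterm]
  split_ifs with h
  · obtain ⟨c, rfl⟩ := h
    have : e (((N * c : ℤ) : ℝ) / N) = 1 := by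
      rw [← e_int c]; congr 1; push_cast; field_simp
    simp only [this, one_pow, sum_const, card_range, nsmul_eq_mul, mul_one]
  · have hne : e (m / N) ≠ 1 := fun h1 => h <| by
      obtain ⟨n, hn⟩ := e_eq_one_iff.mp h1
      refine ⟨n, ?_⟩
      rw [div_eq_iff hN'] at hn
      have : (m : ℝ) = ((N * n : ℤ) : ℝ) := by rw [hn]; push_cast; ring
      exact_mod_cast this
    have hpow : e (m / N) ^ N = 1 := by
      rw [← e_nat_mul, ← e_int m]; congr 1; field_simp
    rw [geom_sum_eq hne, hpow, sub_self, zero_div]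

theorem integral_e_mul (c : ℝ) (m : ℤ) :
    ∫ α in c..(c + 1), e (m * α) = if m = 0 then 1 else 0 := by
  split_ifs with h
  · simp [h]
  · have hm : (2 * Real.pi * m * Complex.I : ℂ) ≠ 0 := by
      have : (m : ℂ) ≠ 0 := by exact_mod_cast h
      simp [Real.pi_ne_zero, this]
    have : ∀ α : ℝ, e (m * α) = Complex.exp ((2 * Real.pi * m * Complex.I) * α) := fun α => by
      rw [e]; push_cast; ring_nf
    simp_rw [this]
    rw [integral_exp_mul_complex hm]
    have h2 : Complex.exp (2 * Real.pi * m * Complex.I * ((c + 1 : ℝ) : ℂ)) =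
        Complex.exp (2 * Real.pi * m * Complex.I * (c : ℂ)) := by
      rw [Complex.exp_eq_exp_iff_exists_int]
      exact ⟨m, by push_cast; ring⟩
    rw [h2, sub_self, zero_div]

section ExpSum

variable {ι κ : Type*}

/-- The exponential sum attached to a finite family of integers. -/
noncomputable def expSum (s : Finset ι) (z : ι → ℤ) (α : ℝ) : ℂ := ∑ i ∈ s, e (z i * α)

theorem continuous_expSum (s : Finset ι) (z : ι → ℤ) : Continuous (expSum s z) :=
  continuous_finsetSum _ fun i _ => continuous_e.comp (by fun_prop)

theorem norm_expSum_le (s : Finset ι) (z : ι → ℤ) (α : ℝ) : ‖expSum s z α‖ ≤ #s := by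
  refine (norm_sum_le _ _).trans ?_
  simp

theorem expSum_mul (s : Finset ι) (t : Finset κ) (z : ι → ℤ) (w : κ → ℤ) (α : ℝ) :
    expSum s z α * expSum t w α = expSum (s ×ˢ t) (fun p => z p.1 + w p.2) α := by
  simp only [expSum, sum_mul_sum, sum_product]
  refine sum_congr rfl fun i _ => sum_congr rfl fun j _ => ?_
  rw [← e_add]; push_cast; ring_nf

theorem conj_expSum (s : Finset ι) (z : ι → ℤ) (α : ℝ) :
    (starRingEnd ℂ) (expSum s z α) = expSum s (fun i => -z i) α := by
  simp only [expSum, map_sum, conj_e]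
  refine sum_congr rfl fun i _ => ?_
  push_cast; ring_nf

theorem norm_expSum_sq (s : Finset ι) (z : ι → ℤ) (α : ℝ) :
    ((‖expSum s z α‖ ^ 2 : ℝ) : ℂ) = expSum (s ×ˢ s) (fun p => z p.1 - z p.2) α := by
  rw [← Complex.normSq_eq_norm_sq, ← Complex.mul_conj, conj_expSum, expSum_mul]
  rfl

theorem norm_expSum_pow_four (s : Finset ι) (z : ι → ℤ) (α : ℝ) :
    ((‖expSum s z α‖ ^ 4 : ℝ) : ℂ) = expSum ((s ×ˢ s) ×ˢ (s ×ˢ s))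
      (fun p => (z p.1.1 - z p.1.2) + (z p.2.1 - z p.2.2)) α := by
  rw [← expSum_mul _ _ (fun p : ι × ι => z p.1 - z p.2) (fun p : ι × ι => z p.1 - z p.2),
    ← norm_expSum_sq, ← Complex.ofReal_mul]
  congr 1; ring

theorem prod_expSum [Fintype κ] [DecidableEq κ] (s : κ → Finset ι) (z : κ → ι → ℤ) (α : ℝ) :
    ∏ i, expSum (s i) (z i) α =
      expSum (Fintype.piFinset s) (fun p => ∑ i, z i (p i)) α := by
  simp only [expSum, prod_univ_sum]
  refine sum_congr rfl fun p _ => ?_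
  have : ∀ t : Finset κ, ∏ i ∈ t, e (z i (p i) * α) = e (((∑ i ∈ t, z i (p i) : ℤ) : ℝ) * α) := by
    intro t
    induction t using Finset.induction_on with
    | empty => simp
    | insert a t ha ih => rw [prod_insert ha, sum_insert ha, ih, ← e_add]; push_cast; ring_nf
  exact this univ

theorem sum_expSum (s : Finset ι) (z : ι → ℤ) {N : ℕ} (hN : N ≠ 0) :
    ∑ k ∈ range N, expSum s z (k / N) = N * #{i ∈ s | (N : ℤ) ∣ z i} := by
  simp only [expSum]
  rw [sum_comm, sum_congr rfl fun i _ => sum_e_mul_div hN (z i), ← sum_filter, sum_const,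
    nsmul_eq_mul, mul_comm]

theorem integral_expSum (s : Finset ι) (z : ι → ℤ) (c : ℝ) :
    ∫ α in c..(c + 1), expSum s z α = #{i ∈ s | z i = 0} := by
  simp only [expSum]
  rw [intervalIntegral.integral_finsetSum fun i _ =>
    (show Continuous fun α : ℝ => e (z i * α) from
      continuous_e.comp (by fun_prop)).intervalIntegrable _ _]
  simp_rw [integral_e_mul]
  rw [← sum_filter, sum_const, nsmul_eq_mul, mul_one]

/-- The number of solutions of `z₁ - z₂ + z₃ - z₄ ≡ 0 mod N` with all `zᵢ` in a finite family. -/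
def energy (s : Finset ι) (z : ι → ℤ) (N : ℕ) : ℕ :=
  #{p ∈ (s ×ˢ s) ×ˢ (s ×ˢ s) | (N : ℤ) ∣ (z p.1.1 - z p.1.2) + (z p.2.1 - z p.2.2)}

theorem sum_norm_expSum_pow_four (s : Finset ι) (z : ι → ℤ) {N : ℕ} (hN : N ≠ 0) :
    ∑ k ∈ range N, ‖expSum s z (k / N)‖ ^ 4 = N * energy s z N := by
  have h := sum_expSum ((s ×ˢ s) ×ˢ (s ×ˢ s))
    (fun p => (z p.1.1 - z p.1.2) + (z p.2.1 - z p.2.2)) hN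
  simp only [← norm_expSum_pow_four] at h
  exact_mod_cast h

theorem integral_norm_expSum_pow_four (s : Finset ι) (z : ι → ℤ) (c : ℝ) :
    ∫ α in c..(c + 1), ‖expSum s z α‖ ^ 4 = energy s z 0 := by
  have h := integral_expSum ((s ×ˢ s) ×ˢ (s ×ˢ s))
    (fun p => (z p.1.1 - z p.1.2) + (z p.2.1 - z p.2.2)) c
  simp only [← norm_expSum_pow_four] at h
  rw [intervalIntegral.integral_ofReal] at h
  simp only [energy, Nat.cast_zero, zero_dvd_iff]
  exact_mod_cast h

theorem sum_norm_expSum_four_two (s : Finset ι) (z : ι → ℤ) (t : Finset κ) (w : κ → ℤ) {N : ℕ}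
    (hN : N ≠ 0) :
    ∑ k ∈ range N, ‖expSum s z (k / N)‖ ^ 4 * ‖expSum t w (k / N)‖ ^ 2 =
      N * #{p ∈ ((s ×ˢ s) ×ˢ (s ×ˢ s)) ×ˢ (t ×ˢ t) | (N : ℤ) ∣
        ((z p.1.1.1 - z p.1.1.2) + (z p.1.2.1 - z p.1.2.2)) + (w p.2.1 - w p.2.2)} := by
  have h := sum_expSum (((s ×ˢ s) ×ˢ (s ×ˢ s)) ×ˢ (t ×ˢ t))
    (fun p => ((z p.1.1.1 - z p.1.1.2) + (z p.1.2.1 - z p.1.2.2)) + (w p.2.1 - w p.2.2)) hN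
  simp only [← expSum_mul ((s ×ˢ s) ×ˢ (s ×ˢ s)) (t ×ˢ t)
    (fun p => (z p.1.1 - z p.1.2) + (z p.2.1 - z p.2.2)) (fun p => w p.1 - w p.2),
    ← norm_expSum_pow_four, ← norm_expSum_sq] at h
  exact_mod_cast h

theorem card_three_le_sum (s : Finset ι) (z : ι → ℤ) {N : ℕ} (hN : N ≠ 0) :
    (N : ℝ) * #{p ∈ (s ×ˢ s) ×ˢ s | (N : ℤ) ∣ (z p.1.1 - z p.1.2) + z p.2} ≤
      ∑ k ∈ range N, ‖expSum s z (k / N)‖ ^ 3 := by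
  have h := sum_expSum ((s ×ˢ s) ×ˢ s) (fun p => (z p.1.1 - z p.1.2) + z p.2) hN
  simp only [← expSum_mul (s ×ˢ s) s (fun p => z p.1 - z p.2) z, ← norm_expSum_sq] at h
  have h2 := congrArg norm h
  rw [norm_mul, Complex.norm_natCast, Complex.norm_natCast] at h2
  rw [← h2]
  refine (norm_sum_le _ _).trans (sum_le_sum fun k _ => ?_)
  rw [norm_mul, Complex.norm_real, Real.norm_of_nonneg (by positivity)]
  exact le_of_eq (by ring)

theorem card_piFinset_le_sum [Fintype κ] [DecidableEq κ] (s : κ → Finset ι) (z : κ → ι → ℤ)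
    {N : ℕ} (hN : N ≠ 0) :
    (N : ℝ) * #{p ∈ Fintype.piFinset s | ∑ i, z i (p i) = 0} ≤
      ∑ k ∈ range N, ∏ i, ‖expSum (s i) (z i) (k / N)‖ := by
  have h := sum_expSum (Fintype.piFinset s) (fun p => ∑ i, z i (p i)) hN
  have h2 := congrArg norm h
  rw [norm_mul, Complex.norm_natCast, Complex.norm_natCast] at h2
  calc (N : ℝ) * #{p ∈ Fintype.piFinset s | ∑ i, z i (p i) = 0}
      ≤ N * #{p ∈ Fintype.piFinset s | (N : ℤ) ∣ ∑ i, z i (p i)} := by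
        gcongr with p _
        intro h; rw [h]; exact dvd_zero _
    _ = _ := h2.symm
    _ ≤ _ := by
        refine (norm_sum_le _ _).trans (sum_le_sum fun k _ => ?_)
        rw [← prod_expSum, norm_prod]

theorem energy_zero_le (s : Finset ι) (z : ι → ℤ) (N : ℕ) : energy s z 0 ≤ energy s z N := by
  refine card_le_card fun p hp => ?_
  simp only [mem_filter, Nat.cast_zero, zero_dvd_iff] at hp ⊢
  exact ⟨hp.1, hp.2 ▸ dvd_zero _⟩

end ExpSum

/-- The nonzero integers of absolute value at most `X`. -/
noncomputable def nonzeroBox (X : ℕ) : Finset ℤ := (Icc (-X : ℤ) X).erase 0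

/-- The integers with absolute value in `[Y, 2 Y)`. -/
noncomputable def dyadicShell (Y : ℕ) : Finset ℤ :=
  {y ∈ Icc (-(2 * Y : ℤ)) (2 * Y) | (Y : ℤ) ≤ |y| ∧ |y| < 2 * Y}

theorem mem_nonzeroBox {X : ℕ} {x : ℤ} : x ∈ nonzeroBox X ↔ x ≠ 0 ∧ |x| ≤ X := by
  simp [nonzeroBox, abs_le]

theorem mem_dyadicShell {Y : ℕ} {y : ℤ} : y ∈ dyadicShell Y ↔ (Y : ℤ) ≤ |y| ∧ |y| < 2 * Y := by
  simp only [dyadicShell, mem_filter, mem_Icc, and_iff_right_iff_imp]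
  intro h
  exact abs_le.mp h.2.le

theorem card_nonzeroBox (X : ℕ) : #(nonzeroBox X) = 2 * X := by
  rw [nonzeroBox, card_erase_of_mem (by simp), Int.card_Icc]
  omega

theorem card_dyadicShell_le (Y : ℕ) : #(dyadicShell Y) ≤ 2 * Y := by
  have : dyadicShell Y ⊆ Ico (Y : ℤ) (2 * Y) ∪ Ioc (-(2 * Y : ℤ)) (-Y) := fun y hy => by
    rw [mem_dyadicShell] at hy
    simp only [mem_union, mem_Ico, mem_Ioc]
    rcases abs_cases y with h | h <;> omega
  refine (card_le_card this).trans ((card_union_le _ _).trans ?_)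
  rw [Int.card_Ico, Int.card_Ioc]
  omega

theorem ne_zero_of_mem_dyadicShell {Y : ℕ} (hY : 1 ≤ Y) {y : ℤ} (hy : y ∈ dyadicShell Y) :
    y ≠ 0 := by
  rintro rfl
  have := (mem_dyadicShell.mp hy).1
  simp at this; omega

theorem DivisorBound.nonneg {M : ℕ} {Δ : ℝ} (h : DivisorBound M Δ) : 0 ≤ Δ := by linarith [h.1]

/-- The equation `u² - v² = h` has few solutions. -/
theorem card_sq_sub_sq_le {M : ℕ} {Δ : ℝ} (hΔ : DivisorBound M Δ) (s : Finset (ℤ × ℤ)) {h : ℤ}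
    (h0 : h ≠ 0) (hM : h.natAbs ≤ M) : (#{p ∈ s | p.1 ^ 2 - p.2 ^ 2 = h} : ℝ) ≤ Δ := by
  refine le_trans ?_ (hΔ.2 h h0 hM)
  norm_cast
  refine card_le_card_of_injOn (fun p => p.1 - p.2) ?_ ?_
  · intro p hp
    have hp := (mem_filter.mp (mem_coe.mp hp)).2
    simp only [mem_coe, Int.mem_divisors_iff_natAbs_mem_divisors_natAbs, Nat.mem_divisors]
    exact ⟨Int.natAbs_dvd_natAbs.mpr ⟨p.1 + p.2, by rw [← hp]; ring⟩, by simpa using h0⟩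
  · intro p hp r hr hpr
    have hp := (mem_filter.mp (mem_coe.mp hp)).2
    have hr := (mem_filter.mp (mem_coe.mp hr)).2
    simp only at hpr
    have hne : p.1 - p.2 ≠ 0 := fun h1 => h0 <| by
      rw [← hp, show p.1 ^ 2 - p.2 ^ 2 = (p.1 - p.2) * (p.1 + p.2) by ring, h1, zero_mul]
    have : p.1 + p.2 = r.1 + r.2 := by
      apply mul_left_cancel₀ hne
      nth_rewrite 2 [hpr]
      linarith
    ext <;> linarith

/-- The equation `x² y³ = m` has few solutions. -/
theorem card_sq_mul_cube_le {M : ℕ} {Δ : ℝ} (hΔ : DivisorBound M Δ) (s : Finset (ℤ × ℤ)) {m : ℤ}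
    (h0 : m ≠ 0) (hM : m.natAbs ≤ M) : (#{p ∈ s | p.1 ^ 2 * p.2 ^ 3 = m} : ℝ) ≤ Δ ^ 2 := by
  have h := hΔ.2 m h0 hM
  have h1 : #{p ∈ s | p.1 ^ 2 * p.2 ^ 3 = m} ≤ #(m.divisors ×ˢ m.divisors) := by
    refine card_le_card fun p hp => ?_
    have hp := (mem_filter.mp hp).2
    simp only [mem_product, Int.mem_divisors_iff_natAbs_mem_divisors_natAbs, Nat.mem_divisors,
      Int.natAbs_dvd_natAbs]
    have hm : m.natAbs ≠ 0 := by simpa using h0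
    exact ⟨⟨⟨p.1 * p.2 ^ 3, by rw [← hp]; ring⟩, hm⟩, ⟨⟨p.1 ^ 2 * p.2 ^ 2, by rw [← hp]; ring⟩, hm⟩⟩
  calc (#{p ∈ s | p.1 ^ 2 * p.2 ^ 3 = m} : ℝ) ≤ (#(m.divisors ×ˢ m.divisors) : ℝ) := by
        exact_mod_cast h1
    _ = (#m.divisors : ℝ) ^ 2 := by rw [card_product]; push_cast; ring
    _ ≤ Δ ^ 2 := by gcongr

theorem card_sq_eq_sq_le (X : ℕ) :
    #{p ∈ nonzeroBox X ×ˢ nonzeroBox X | p.1 ^ 2 - p.2 ^ 2 = 0} ≤ 4 * X := by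
  have : ({p ∈ nonzeroBox X ×ˢ nonzeroBox X | p.1 ^ 2 - p.2 ^ 2 = 0} : Finset (ℤ × ℤ)) ⊆
      (nonzeroBox X).image (fun x => (x, x)) ∪ (nonzeroBox X).image (fun x => (x, -x)) := by
    rintro ⟨u, v⟩ hp
    simp only [mem_filter, mem_product, sub_eq_zero] at hp
    simp only [mem_union, mem_image, Prod.mk.injEq]
    rcases sq_eq_sq_iff_eq_or_eq_neg.mp hp.2 with h | h
    · exact Or.inl ⟨u, hp.1.1, rfl, h⟩
    · exact Or.inr ⟨u, hp.1.1, rfl, by rw [h]; ring⟩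
  refine (card_le_card this).trans ((card_union_le _ _).trans ?_)
  have h1 := card_image_le (s := nonzeroBox X) (f := fun x => (x, x))
  have h2 := card_image_le (s := nonzeroBox X) (f := fun x => (x, -x))
  rw [card_nonzeroBox] at h1 h2
  omega

theorem card_dvd_add_le (Z q : ℕ) (hq : 1 ≤ q) (c : ℤ) :
    (#{h ∈ Icc (-Z : ℤ) Z | (q : ℤ) ∣ h + c} : ℝ) ≤ (2 * Z + 1) / q + 1 := by
  have hq' : (0 : ℤ) < q := by exact_mod_cast hq
  have h1 := Int.Ioc_filter_modEq_card (-Z - 1 : ℤ) Z hq' (-c)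
  have h2 : ({h ∈ Icc (-Z : ℤ) Z | (q : ℤ) ∣ h + c} : Finset ℤ) =
      {x ∈ Ioc (-Z - 1 : ℤ) Z | x ≡ -c [ZMOD q]} := by
    ext h
    simp only [mem_filter, mem_Icc, mem_Ioc, Int.modEq_iff_dvd]
    rw [show -c - h = -(h + c) by ring, dvd_neg]
    refine and_congr_left fun _ => ?_
    omega
  have hqR : (0 : ℝ) < q := by exact_mod_cast hq
  have h3 : ((#{h ∈ Icc (-Z : ℤ) Z | (q : ℤ) ∣ h + c} : ℤ) : ℝ) ≤ (2 * Z + 1) / q + 1 := by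
    rw [h2, h1]
    push_cast
    refine max_le ?_ (by positivity)
    have f1 := Int.floor_le (((Z : ℚ) - (-c)) / q)
    have f2 := Int.lt_floor_add_one (((-Z - 1 : ℚ) - (-c)) / q)
    have f1' : ((⌊(((Z : ℚ) - (-c)) / q)⌋ : ℚ) : ℝ) ≤ ((((Z : ℚ) - (-c)) / q : ℚ) : ℝ) := by
      exact_mod_cast f1
    have f2' : ((((-Z - 1 : ℚ) - (-c)) / q : ℚ) : ℝ) <
        ((⌊(((-Z - 1 : ℚ) - (-c)) / q)⌋ + 1 : ℚ) : ℝ) := by exact_mod_cast f2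
    push_cast at f1' f2' ⊢
    have : ((Z : ℝ) - -c) / q - ((-Z - 1 : ℝ) - -c) / q = (2 * Z + 1) / q := by
      field_simp; ring
    linarith
  exact_mod_cast h3

theorem natAbs_sq_sub_sq_le {X : ℕ} {p : ℤ × ℤ} (hp : p ∈ nonzeroBox X ×ˢ nonzeroBox X) :
    |p.1 ^ 2 - p.2 ^ 2| ≤ (X ^ 2 : ℕ) := by
  simp only [mem_product, mem_nonzeroBox] at hp
  have h1 := sq_le_sq' (by linarith [(abs_le.mp hp.1.2).1, (abs_le.mp hp.1.2).2]) (abs_le.mp hp.1.2).2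
  have h2 := sq_le_sq' (by linarith [(abs_le.mp hp.2.2).1, (abs_le.mp hp.2.2).2]) (abs_le.mp hp.2.2).2
  have h3 := sq_nonneg p.1
  have h4 := sq_nonneg p.2
  push_cast
  rw [abs_le]; constructor <;> linarith

theorem card_sq_sub_sq_add_dvd_le {X q M : ℕ} {Δ : ℝ} (hq : 1 ≤ q) (hΔ : DivisorBound M Δ)
    (hM : X ^ 2 ≤ M) (c : ℤ) :
    (#{p ∈ nonzeroBox X ×ˢ nonzeroBox X | (q : ℤ) ∣ p.1 ^ 2 - p.2 ^ 2 + c} : ℝ) ≤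
      ((2 * X ^ 2 + 1) / q + 1) * Δ + if (q : ℤ) ∣ c then (4 * X : ℝ) else 0 := by
  set P := nonzeroBox X ×ˢ nonzeroBox X with hP
  set H := ({h ∈ Icc (-(X ^ 2 : ℕ) : ℤ) (X ^ 2 : ℕ) | (q : ℤ) ∣ h + c} : Finset ℤ) with hH
  have hcard : (#{p ∈ P | (q : ℤ) ∣ p.1 ^ 2 - p.2 ^ 2 + c} : ℝ) =
      ∑ h ∈ H, (#{p ∈ P | p.1 ^ 2 - p.2 ^ 2 = h} : ℝ) := by
    have := card_eq_sum_card_fiberwise (s := {p ∈ P | (q : ℤ) ∣ p.1 ^ 2 - p.2 ^ 2 + c})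
      (t := H) (f := fun p => p.1 ^ 2 - p.2 ^ 2) (fun p hp => by
        have hp := mem_filter.mp (mem_coe.mp hp)
        rw [mem_coe, hH, mem_filter, mem_Icc, ← abs_le]
        exact ⟨natAbs_sq_sub_sq_le hp.1, hp.2⟩)
    rw [this]
    push_cast
    refine sum_congr rfl fun h hh => ?_
    rw [filter_filter]
    congr 2
    refine filter_congr fun p _ => ⟨fun h => h.2, fun hp => ⟨?_, hp⟩⟩
    rw [hp]; exact (mem_filter.mp hh).2
  have hterm : ∀ h ∈ H, (#{p ∈ P | p.1 ^ 2 - p.2 ^ 2 = h} : ℝ) ≤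
      Δ + if h = 0 then (4 * X : ℝ) else 0 := by
    intro h hh
    split_ifs with h0
    · have := card_sq_eq_sq_le X
      have h2 : (#{p ∈ P | p.1 ^ 2 - p.2 ^ 2 = h} : ℝ) ≤ 4 * X := by
        rw [h0]; exact_mod_cast this
      linarith [hΔ.nonneg]
    · rw [add_zero]
      refine card_sq_sub_sq_le hΔ _ h0 ?_
      have := mem_Icc.mp (mem_filter.mp hh).1
      omega
  rw [hcard]
  refine (sum_le_sum hterm).trans ?_
  rw [sum_add_distrib, sum_const, nsmul_eq_mul]
  gcongr ?_ * Δ + ?_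
  · exact hΔ.nonneg
  · have := card_dvd_add_le (X ^ 2) q hq c
    push_cast at this ⊢
    exact this
  · rw [sum_ite_eq']
    split_ifs with h1 h2 h2
    · exact le_rfl
    · exact absurd (by simpa using (mem_filter.mp h1).2) h2
    · positivity
    · exact le_rfl

theorem energy_eq_sum {ι : Type*} (s : Finset ι) (z : ι → ℤ) (N : ℕ) :
    energy s z N = ∑ c ∈ s ×ˢ s, #{p ∈ s ×ˢ s | (N : ℤ) ∣ (z p.1 - z p.2) + (z c.1 - z c.2)} := by
  rw [energy, card_filter, sum_product_right]
  refine sum_congr rfl fun c _ => ?_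
  rw [card_filter]

theorem energy_sq_le {X q M : ℕ} {Δ : ℝ} (hX : 1 ≤ X) (hq : 1 ≤ q) (hΔ : DivisorBound M Δ)
    (hM : X ^ 2 ≤ M) :
    (energy (nonzeroBox X) (fun x => x ^ 2) q : ℝ) ≤ 24 * Δ * (X ^ 2 + X ^ 4 / q) := by
  have hX' : (1 : ℝ) ≤ X := by exact_mod_cast hX
  have hq' : (0 : ℝ) < q := by exact_mod_cast hq
  have h1Δ := hΔ.1
  have key := fun c => card_sq_sub_sq_add_dvd_le hq hΔ hM c
  have h0 := key 0
  simp only [add_zero, dvd_zero, if_true] at h0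
  rw [energy_eq_sum]
  push_cast
  refine (sum_le_sum fun c _ => key _).trans ?_
  rw [sum_add_distrib, sum_const, ← sum_filter, sum_const, card_product, card_nonzeroBox,
    nsmul_eq_mul, nsmul_eq_mul]
  push_cast
  set R := (#{p ∈ nonzeroBox X ×ˢ nonzeroBox X | (q : ℤ) ∣ p.1 ^ 2 - p.2 ^ 2} : ℝ)
  set u : ℝ := (q : ℝ)⁻¹
  have hu : 0 < u := by positivity
  have hA : ((2 * X ^ 2 + 1) / q + 1) * Δ ≤ (3 * X ^ 2 * u + 1) * Δ := by
    rw [div_eq_mul_inv]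
    gcongr
    nlinarith
  rw [div_eq_mul_inv (_ ^ 4 : ℝ)]
  have e1 : R * (4 * X) ≤ ((3 * X ^ 2 * u + 1) * Δ + 4 * X) * (4 * X) := by
    gcongr; linarith
  have e2 : 2 * (X : ℝ) * (2 * X) * (((2 * X ^ 2 + 1) / q + 1) * Δ) ≤
      2 * (X : ℝ) * (2 * X) * ((3 * X ^ 2 * u + 1) * Δ) := by gcongr
  have x2 : (X : ℝ) ≤ X ^ 2 := by nlinarith
  have x3 : (X : ℝ) ^ 3 ≤ X ^ 4 := by nlinarith [pow_pos (by linarith : (0 : ℝ) < X) 3]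
  have e3 : (X : ℝ) ^ 3 * (u * Δ) ≤ X ^ 4 * (u * Δ) := by gcongr
  have e4 : (X : ℝ) * Δ ≤ X ^ 2 * Δ := by gcongr
  have e5 : (X : ℝ) ^ 2 * 1 ≤ X ^ 2 * Δ := by gcongr
  nlinarith

/-- The range of `(x, y)` with `0 < |x| ≤ X` and `Y ≤ |y| < 2 Y`. -/
noncomputable def dyadicRect (X Y : ℕ) : Finset (ℤ × ℤ) := nonzeroBox X ×ˢ dyadicShell Y

/-- The squareful value `x² y³`. -/
def sqCube (p : ℤ × ℤ) : ℤ := p.1 ^ 2 * p.2 ^ 3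

theorem card_dyadicRect_le (X Y : ℕ) : #(dyadicRect X Y) ≤ 4 * X * Y := by
  rw [dyadicRect, card_product, card_nonzeroBox]
  have := card_dyadicShell_le Y
  nlinarith

theorem sqCube_ne_zero {X Y : ℕ} (hY : 1 ≤ Y) {p : ℤ × ℤ} (hp : p ∈ dyadicRect X Y) :
    sqCube p ≠ 0 := by
  rw [dyadicRect, mem_product] at hp
  exact mul_ne_zero (pow_ne_zero _ (mem_nonzeroBox.mp hp.1).1)
    (pow_ne_zero _ (ne_zero_of_mem_dyadicShell hY hp.2))

theorem abs_sqCube_le {X Y : ℕ} {p : ℤ × ℤ} (hp : p ∈ dyadicRect X Y) :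
    |sqCube p| ≤ (8 * X ^ 2 * Y ^ 3 : ℕ) := by
  rw [dyadicRect, mem_product, mem_nonzeroBox, mem_dyadicShell] at hp
  rw [sqCube, abs_mul, abs_pow, abs_pow]
  calc |p.1| ^ 2 * |p.2| ^ 3 ≤ (X : ℤ) ^ 2 * (2 * Y : ℤ) ^ 3 := by
        gcongr
        · exact hp.1.2
        · exact hp.2.2.le
    _ = _ := by push_cast; ring

theorem expSum_dyadicRect (X Y : ℕ) (α : ℝ) :
    expSum (dyadicRect X Y) sqCube α =
      ∑ y ∈ dyadicShell Y, expSum (nonzeroBox X) (fun x => x ^ 2 * y ^ 3) α := by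
  simp only [expSum, dyadicRect, sqCube, sum_product_right]

theorem energy_mul_right {ι : Type*} (s : Finset ι) (z : ι → ℤ) (n : ℕ) (hn : n ≠ 0) (y : ℤ) :
    energy s (fun i => z i * y ^ 3) (n ^ 3) = energy s z ((n / n.gcd y.natAbs) ^ 3) := by
  refine congrArg card (filter_congr fun p _ => ?_)
  set m := z p.1.1 - z p.1.2 + (z p.2.1 - z p.2.2)
  have h1 : z p.1.1 * y ^ 3 - z p.1.2 * y ^ 3 + (z p.2.1 * y ^ 3 - z p.2.2 * y ^ 3) = m * y ^ 3 := by
    simp only [m]; ring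
  rw [h1, Int.natCast_dvd, Int.natCast_dvd, Int.natAbs_mul, Int.natAbs_pow]
  set k := y.natAbs
  set g := n.gcd k with hg
  have hg0 : 0 < g := Nat.gcd_pos_of_pos_left _ (Nat.pos_of_ne_zero hn)
  obtain ⟨a, ha⟩ : g ∣ n := Nat.gcd_dvd_left _ _
  obtain ⟨b, hb⟩ : g ∣ k := Nat.gcd_dvd_right _ _
  have hcop : Nat.Coprime a b := by
    have := Nat.coprime_div_gcd_div_gcd (m := n) (n := k) hg0
    rwa [← hg, Nat.div_eq_of_eq_mul_right hg0 ha, Nat.div_eq_of_eq_mul_right hg0 hb] at this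
  rw [Nat.div_eq_of_eq_mul_right hg0 ha]
  nth_rewrite 1 [ha]
  rw [hb, mul_pow, mul_pow, mul_left_comm, Nat.mul_dvd_mul_iff_left (by positivity)]
  exact (Nat.Coprime.pow 3 3 hcop).dvd_mul_right

theorem sum_gcd_le {n Y M : ℕ} {Δ : ℝ} (hn : n ≠ 0) (hY : 1 ≤ Y) (hnM : n ≤ M)
    (hΔ : DivisorBound M Δ) :
    ∑ y ∈ dyadicShell Y, (n.gcd y.natAbs : ℝ) ≤ 4 * Y * Δ := by
  have h1 : ∀ y ∈ dyadicShell Y, (n.gcd y.natAbs : ℝ) ≤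
      ∑ d ∈ n.divisors, if d ∣ y.natAbs then (d : ℝ) else 0 := fun y _ => by
    have hmem : n.gcd y.natAbs ∈ n.divisors := Nat.mem_divisors.mpr ⟨Nat.gcd_dvd_left _ _, hn⟩
    refine le_trans ?_ (single_le_sum (fun d _ => by positivity) hmem)
    rw [if_pos (Nat.gcd_dvd_right _ _)]
  have h2 : ∀ d ∈ n.divisors, (∑ y ∈ dyadicShell Y, if d ∣ y.natAbs then (d : ℝ) else 0) ≤
      4 * Y := fun d hd => by
    have hd0 : 0 < d := Nat.pos_of_mem_divisors hd
    rw [← sum_filter, sum_const, nsmul_eq_mul]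
    have : #{y ∈ dyadicShell Y | d ∣ y.natAbs} ≤ 2 * (2 * Y / d) := by
      rw [← card_nonzeroBox]
      refine card_le_card_of_injOn (fun y => y / d) ?_ ?_
      · intro y hy
        have hy := mem_filter.mp (mem_coe.mp hy)
        obtain ⟨c, rfl⟩ := Int.natCast_dvd.mpr hy.2
        have hne := ne_zero_of_mem_dyadicShell hY hy.1
        have hlt := (mem_dyadicShell.mp hy.1).2
        have hd' : (d : ℤ) ≠ 0 := by omega
        simp only [mem_coe, mem_nonzeroBox, Int.mul_ediv_cancel_left _ hd']
        refine ⟨right_ne_zero_of_mul hne, ?_⟩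
        rw [abs_mul, Nat.abs_cast] at hlt
        have : c.natAbs ≤ 2 * Y / d := by
          rw [Nat.le_div_iff_mul_le hd0]
          zify; rw [mul_comm]; exact hlt.le
        zify at this; exact_mod_cast this
      · intro y hy y' hy' h
        have hy := mem_filter.mp (mem_coe.mp hy)
        have hy' := mem_filter.mp (mem_coe.mp hy')
        exact (Int.ediv_left_inj (Int.natCast_dvd.mpr hy.2) (Int.natCast_dvd.mpr hy'.2)).mp h
    have h3 : #{y ∈ dyadicShell Y | d ∣ y.natAbs} * d ≤ 4 * Y := by
      calc _ ≤ 2 * (2 * Y / d) * d := Nat.mul_le_mul_right _ this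
        _ = 2 * (2 * Y / d * d) := by ring
        _ ≤ 2 * (2 * Y) := Nat.mul_le_mul_left _ (Nat.div_mul_le_self _ _)
        _ = 4 * Y := by ring
    exact_mod_cast h3
  refine (sum_le_sum h1).trans ?_
  rw [sum_comm]
  refine (sum_le_sum h2).trans ?_
  rw [sum_const, nsmul_eq_mul, mul_comm]
  gcongr
  have := hΔ.2 n (by exact_mod_cast hn) (by simpa using hnM)
  rw [card_int_divisors] at this
  push_cast at this
  simp only [Int.natAbs_natCast] at this
  linarith [Nat.cast_nonneg (α := ℝ) (#n.divisors)]

/-- Weighted power mean inequality. -/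
theorem sum_pow_four_le {ι : Type*} (s : Finset ι) (a g : ι → ℝ) (hg : ∀ i ∈ s, 0 < g i) :
    (∑ i ∈ s, a i) ^ 4 ≤ (∑ i ∈ s, g i) ^ 3 * ∑ i ∈ s, a i ^ 4 / g i ^ 3 := by
  have h1 : (∑ i ∈ s, a i) ^ 2 ≤ (∑ i ∈ s, g i) * ∑ i ∈ s, a i ^ 2 / g i :=
    sum_sq_le_sum_mul_sum_of_sq_le_mul s (fun i hi => (hg i hi).le)
      (fun i hi => div_nonneg (sq_nonneg _) (hg i hi).le)
      (fun i hi => by have := hg i hi; field_simp; rfl)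
  have h2 : (∑ i ∈ s, a i ^ 2 / g i) ^ 2 ≤ (∑ i ∈ s, g i) * ∑ i ∈ s, a i ^ 4 / g i ^ 3 :=
    sum_sq_le_sum_mul_sum_of_sq_le_mul s (fun i hi => (hg i hi).le)
      (fun i hi => div_nonneg (by positivity) (pow_pos (hg i hi) 3).le)
      (fun i hi => by have := hg i hi; field_simp; rfl)
  calc (∑ i ∈ s, a i) ^ 4 = ((∑ i ∈ s, a i) ^ 2) ^ 2 := by ring
    _ ≤ ((∑ i ∈ s, g i) * ∑ i ∈ s, a i ^ 2 / g i) ^ 2 := by gcongr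
    _ = (∑ i ∈ s, g i) ^ 2 * (∑ i ∈ s, a i ^ 2 / g i) ^ 2 := by ring
    _ ≤ (∑ i ∈ s, g i) ^ 2 * ((∑ i ∈ s, g i) * ∑ i ∈ s, a i ^ 4 / g i ^ 3) := by gcongr
    _ = _ := by ring

/-- Fourth moment of the sum over a dyadic rectangle modulo a cube `n³` with `n ≍ Y`. -/
theorem energy_dyadicRect_cube_le {X Y n M : ℕ} {Δ : ℝ} (hX : 1 ≤ X) (hY : 1 ≤ Y) (hn : Y ≤ n)
    (hnM : n ≤ M) (hΔ : DivisorBound M Δ) (hM : X ^ 2 ≤ M) :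
    (energy (dyadicRect X Y) sqCube (n ^ 3) : ℝ) ≤ 3072 * Δ ^ 4 * (X ^ 2 * Y ^ 4 + X ^ 4 * Y) := by
  have hn0 : n ≠ 0 := by omega
  have hn3 : n ^ 3 ≠ 0 := pow_ne_zero _ hn0
  have hnR : (0 : ℝ) < n := by positivity
  have hYR : (0 : ℝ) < Y := by positivity
  have h1Δ := hΔ.1
  set g : ℤ → ℝ := fun y => (n.gcd y.natAbs : ℝ) with hg
  have hgpos : ∀ y, 0 < g y := fun y => by
    simp only [hg]; exact_mod_cast Nat.gcd_pos_of_pos_left _ (Nat.pos_of_ne_zero hn0)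
  have hg1 : ∀ y, 1 ≤ g y := fun y => by
    simp only [hg]; exact_mod_cast Nat.gcd_pos_of_pos_left _ (Nat.pos_of_ne_zero hn0)
  have hbound : ∀ y, (energy (nonzeroBox X) (fun x => x ^ 2 * y ^ 3) (n ^ 3) : ℝ) / g y ^ 3 ≤
      24 * Δ * (X ^ 2 + X ^ 4 / Y ^ 3) := fun y => by
    rw [energy_mul_right _ (fun x => x ^ 2) n hn0]
    have hq : 1 ≤ (n / n.gcd y.natAbs) ^ 3 :=
      Nat.one_le_pow _ _ (Nat.div_pos (Nat.gcd_le_left _ (by omega))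
        (Nat.gcd_pos_of_pos_left _ (by omega)))
    have := energy_sq_le hX hq hΔ hM
    have hc : (((n / n.gcd y.natAbs) ^ 3 : ℕ) : ℝ) = n ^ 3 / g y ^ 3 := by
      push_cast [Nat.cast_div (Nat.gcd_dvd_left n y.natAbs)
        (by exact_mod_cast (hgpos y).ne')]
      rw [div_pow]
    rw [hc] at this
    calc _ ≤ 24 * Δ * (X ^ 2 + X ^ 4 / (n ^ 3 / g y ^ 3)) / g y ^ 3 := by
          have := hgpos y
          gcongr
      _ = 24 * Δ * (X ^ 2 / g y ^ 3 + X ^ 4 / n ^ 3) := by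
          have := hgpos y
          field_simp
      _ ≤ 24 * Δ * (X ^ 2 + X ^ 4 / Y ^ 3) := by
          gcongr
          exact div_le_self (by positivity) (one_le_pow₀ (hg1 y))
  have hsum : (n ^ 3 : ℕ) * (energy (dyadicRect X Y) sqCube (n ^ 3) : ℝ) ≤
      (n ^ 3 : ℕ) * ((4 * Y * Δ) ^ 3 * (2 * Y * (24 * Δ * (X ^ 2 + X ^ 4 / Y ^ 3)))) := by
    rw [← sum_norm_expSum_pow_four _ _ hn3]
    have hpt : ∀ α : ℝ, ‖expSum (dyadicRect X Y) sqCube α‖ ^ 4 ≤ (4 * Y * Δ) ^ 3 *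
        ∑ y ∈ dyadicShell Y, ‖expSum (nonzeroBox X) (fun x => x ^ 2 * y ^ 3) α‖ ^ 4 / g y ^ 3 := by
      intro α
      rw [expSum_dyadicRect]
      refine (pow_le_pow_left₀ (norm_nonneg _) (norm_sum_le _ _) 4).trans ?_
      refine (sum_pow_four_le _ _ g fun y _ => hgpos y).trans ?_
      gcongr
      · exact sum_gcd_le hn0 hY hnM hΔ
    refine (sum_le_sum fun k _ => hpt _).trans ?_
    rw [← mul_sum, sum_comm, mul_left_comm]
    gcongr
    simp_rw [← sum_div, sum_norm_expSum_pow_four _ _ hn3, mul_div_assoc]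
    rw [← mul_sum]
    gcongr
    refine (sum_le_sum fun y _ => hbound y).trans ?_
    rw [sum_const, nsmul_eq_mul]
    gcongr
    exact_mod_cast card_dyadicShell_le Y
  have h2 := le_of_mul_le_mul_left hsum (by positivity)
  refine h2.trans (le_of_eq ?_)
  field_simp
  ring

theorem energy_eq_energy_zero {ι : Type*} (s : Finset ι) (z : ι → ℤ) {N Z : ℕ}
    (hz : ∀ i ∈ s, |z i| ≤ Z) (hN : 4 * Z < N) : energy s z N = energy s z 0 := by
  refine congrArg card (filter_congr fun p hp => ?_)
  simp only [mem_product] at hp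
  rw [Nat.cast_zero, zero_dvd_iff]
  refine ⟨fun h => Int.eq_zero_of_abs_lt_dvd h ?_, fun h => h ▸ dvd_zero _⟩
  have h1 := abs_le.mp (hz _ hp.1.1)
  have h2 := abs_le.mp (hz _ hp.1.2)
  have h3 := abs_le.mp (hz _ hp.2.1)
  have h4 := abs_le.mp (hz _ hp.2.2)
  rw [abs_lt]; constructor <;> omega

theorem energy_zero_eq_sum {ι : Type*} (s : Finset ι) (z : ι → ℤ) :
    energy s z 0 = ∑ c ∈ (s ×ˢ s) ×ˢ s, #{p ∈ s | z p = (z c.1.1 - z c.1.2) + z c.2} := by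
  simp only [energy, card_filter, sum_product]
  refine sum_congr rfl fun a _ => sum_congr rfl fun b _ => sum_congr rfl fun c _ =>
    sum_congr rfl fun d _ => if_congr ?_ rfl rfl
  rw [Nat.cast_zero, zero_dvd_iff]
  constructor <;> intro h <;> linarith

theorem energy_zero_mul_right {ι : Type*} (s : Finset ι) (z : ι → ℤ) {c : ℤ} (hc : c ≠ 0) :
    energy s (fun i => z i * c) 0 = energy s z 0 := by
  refine congrArg card (filter_congr fun p _ => ?_)
  rw [Nat.cast_zero, zero_dvd_iff, zero_dvd_iff, ← sub_mul, ← sub_mul, ← add_mul,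
    mul_eq_zero_iff_right hc]

section DyadicRect

variable {X Y M : ℕ} {Δ : ℝ}

theorem energy_dyadicRect_le_cube (hY : 1 ≤ Y) (hΔ : DivisorBound M Δ)
    (hM : 8 * X ^ 2 * Y ^ 3 ≤ M) :
    (energy (dyadicRect X Y) sqCube 0 : ℝ) ≤ 64 * Δ ^ 2 * X ^ 3 * Y ^ 3 := by
  rw [energy_zero_eq_sum]
  push_cast
  have h : ∀ m : ℤ, (#{p ∈ dyadicRect X Y | sqCube p = m} : ℝ) ≤ Δ ^ 2 := fun m => by
    rcases ({p ∈ dyadicRect X Y | sqCube p = m} : Finset _).eq_empty_or_nonempty with h | ⟨p, hp⟩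
    · rw [h]; simp [sq_nonneg]
    · rw [mem_filter] at hp
      refine card_sq_mul_cube_le hΔ _ (hp.2 ▸ sqCube_ne_zero hY hp.1) ?_
      have := abs_sqCube_le hp.1
      rw [hp.2, Int.abs_eq_natAbs] at this
      omega
  refine (sum_le_sum fun c _ => h _).trans ?_
  rw [sum_const, nsmul_eq_mul, card_product, card_product]
  have : (#(dyadicRect X Y) : ℝ) ≤ 4 * X * Y := by exact_mod_cast card_dyadicRect_le X Y
  push_cast
  calc _ ≤ (4 * X * Y : ℝ) * (4 * X * Y) * (4 * X * Y) * Δ ^ 2 := by gcongr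
    _ = _ := by ring

theorem sum_pow_four_le_card {ι : Type*} (s : Finset ι) (a : ι → ℝ) :
    (∑ i ∈ s, a i) ^ 4 ≤ (#s : ℝ) ^ 3 * ∑ i ∈ s, a i ^ 4 := by
  have := sum_pow_four_le s a (fun _ => 1) (fun _ _ => one_pos)
  simpa using this

theorem energy_dyadicRect_le_fourth (hX : 1 ≤ X) (hY : 1 ≤ Y) (hΔ : DivisorBound M Δ)
    (hM : 8 * X ^ 2 * Y ^ 3 ≤ M) :
    (energy (dyadicRect X Y) sqCube 0 : ℝ) ≤ 768 * Δ * X ^ 2 * Y ^ 4 := by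
  have hX2 : X ^ 2 ≤ M := by
    have : 1 ≤ Y ^ 3 := Nat.one_le_pow _ _ hY
    nlinarith [Nat.zero_le (X ^ 2)]
  have h1Δ := hΔ.1
  have hXR : (0 : ℝ) < X := by exact_mod_cast hX
  set N : ℕ := 4 * (8 * X ^ 2 * Y ^ 3) + 1 with hN
  have hN0 : N ≠ 0 := by omega
  rw [← energy_eq_energy_zero _ _ (fun p hp => abs_sqCube_le hp) (show _ < N by omega)]
  have hy : ∀ y ∈ dyadicShell Y,
      (energy (nonzeroBox X) (fun x => x ^ 2 * y ^ 3) N : ℝ) ≤ 48 * Δ * X ^ 2 := fun y hy => by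
    have e1 : energy (nonzeroBox X) (fun x => x ^ 2 * y ^ 3) N =
        energy (nonzeroBox X) (fun x => x ^ 2 * y ^ 3) 0 :=
      energy_eq_energy_zero _ _ (Z := 8 * X ^ 2 * Y ^ 3)
        (fun x hx => abs_sqCube_le (p := (x, y)) (mem_product.mpr ⟨hx, hy⟩)) (by omega)
    have hy0 : y ^ 3 ≠ 0 := pow_ne_zero _ (ne_zero_of_mem_dyadicShell hY hy)
    have e2 := energy_zero_mul_right (nonzeroBox X) (fun x => x ^ 2) hy0
    have e3 := energy_zero_le (nonzeroBox X) (fun x => x ^ 2) (X ^ 2)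
    have e4 := energy_sq_le (q := X ^ 2) hX (Nat.one_le_pow _ _ hX) hΔ hX2
    rw [e1, e2]
    calc (energy (nonzeroBox X) (fun x => x ^ 2) 0 : ℝ)
        ≤ energy (nonzeroBox X) (fun x => x ^ 2) (X ^ 2) := by exact_mod_cast e3
      _ ≤ _ := e4
      _ = _ := by push_cast; field_simp; ring
  have hsum : (N : ℝ) * energy (dyadicRect X Y) sqCube N ≤
      N * ((2 * Y) ^ 3 * (2 * Y * (48 * Δ * X ^ 2))) := by
    rw [← sum_norm_expSum_pow_four _ _ hN0]
    have hpt : ∀ α : ℝ, ‖expSum (dyadicRect X Y) sqCube α‖ ^ 4 ≤ (2 * Y : ℝ) ^ 3 *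
        ∑ y ∈ dyadicShell Y, ‖expSum (nonzeroBox X) (fun x => x ^ 2 * y ^ 3) α‖ ^ 4 := by
      intro α
      rw [expSum_dyadicRect]
      refine (pow_le_pow_left₀ (norm_nonneg _) (norm_sum_le _ _) 4).trans ?_
      refine (sum_pow_four_le_card _ _).trans ?_
      gcongr
      exact_mod_cast card_dyadicShell_le Y
    refine (sum_le_sum fun k _ => hpt _).trans ?_
    rw [← mul_sum, sum_comm, mul_left_comm]
    gcongr
    simp_rw [sum_norm_expSum_pow_four _ _ hN0]
    rw [← mul_sum]
    gcongr
    refine (sum_le_sum hy).trans ?_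
    rw [sum_const, nsmul_eq_mul]
    gcongr
    exact_mod_cast card_dyadicShell_le Y
  have h2 := le_of_mul_le_mul_left hsum (by positivity)
  refine h2.trans (le_of_eq ?_)
  ring

theorem mean_cube_pow_four_le (N : ℕ) (hN : N ≠ 0) (a : ℕ → ℝ) {H R : ℝ}
    (ha : ∀ k, 0 ≤ a k)
    (hH : ∑ k ∈ range N, a k ^ 4 ≤ N * H) (hR : N * R ≤ ∑ k ∈ range N, a k ^ 3) (hR0 : 0 ≤ R) :
    R ^ 4 ≤ H ^ 3 := by
  have hNR : (0 : ℝ) < N := by positivity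
  set s2 := ∑ k ∈ range N, a k ^ 2
  set s3 := ∑ k ∈ range N, a k ^ 3
  set s4 := ∑ k ∈ range N, a k ^ 4
  have h4 : 0 ≤ s4 := sum_nonneg fun k _ => by positivity
  have h3 : 0 ≤ s3 := sum_nonneg fun k _ => pow_nonneg (ha k) 3
  have h2 : 0 ≤ s2 := sum_nonneg fun k _ => by positivity
  have h1 : s3 ^ 2 ≤ s4 * s2 := sum_sq_le_sum_mul_sum_of_sq_le_mul _
    (fun k _ => by positivity) (fun k _ => by positivity) (fun k _ => by ring_nf; rfl)
  have h5 : s2 ^ 2 ≤ N * s4 := by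
    have := sum_sq_le_sum_mul_sum_of_sq_le_mul (range N) (r := fun k => a k ^ 2)
      (f := fun _ => (1 : ℝ)) (g := fun k => a k ^ 4)
      (fun k _ => by positivity) (fun k _ => by positivity) (fun k _ => by ring_nf; rfl)
    simpa using this
  have h6 : (N * R) ^ 4 ≤ N ^ 4 * H ^ 3 := by
    calc (N * R) ^ 4 ≤ s3 ^ 4 := by gcongr
      _ = (s3 ^ 2) ^ 2 := by ring
      _ ≤ (s4 * s2) ^ 2 := by gcongr
      _ = s4 ^ 2 * s2 ^ 2 := by ring
      _ ≤ s4 ^ 2 * (N * s4) := by gcongr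
      _ = N * s4 ^ 3 := by ring
      _ ≤ N * (N * H) ^ 3 := by gcongr
      _ = _ := by ring
  rw [mul_pow] at h6
  exact le_of_mul_le_mul_left h6 (by positivity)

theorem energy_dyadicRect_pow_four_le (hY : 1 ≤ Y) {H : ℝ}
    (hH : ∀ n : ℕ, Y ≤ n → n < 2 * Y → (energy (dyadicRect X Y) sqCube (n ^ 3) : ℝ) ≤ H) :
    (energy (dyadicRect X Y) sqCube 0 : ℝ) ^ 4 ≤ 256 * Y ^ 4 * H ^ 3 := by
  set A := dyadicRect X Y with hA
  set R : ℤ → ℕ := fun y =>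
    #{c ∈ (A ×ˢ A) ×ˢ A | ((y.natAbs ^ 3 : ℕ) : ℤ) ∣ (sqCube c.1.1 - sqCube c.1.2) + sqCube c.2}
  have hdvd : ∀ y m : ℤ, (((y.natAbs ^ 3 : ℕ) : ℤ) ∣ m ↔ y ^ 3 ∣ m) := fun y m => by
    rw [Int.natCast_dvd, ← Int.natAbs_pow, Int.natAbs_dvd_natAbs]
  have hE : energy A sqCube 0 ≤ ∑ y ∈ dyadicShell Y, 2 * R y := by
    rw [energy_zero_eq_sum]
    have h1 : ∀ m : ℤ, #{p ∈ A | sqCube p = m} ≤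
        ∑ y ∈ dyadicShell Y, if ((y.natAbs ^ 3 : ℕ) : ℤ) ∣ m then 2 else 0 := fun m => by
      rw [hA, dyadicRect, card_filter, sum_product_right]
      refine sum_le_sum fun y hy => ?_
      rw [← card_filter]
      split_ifs with h
      · by_cases hne : ({x ∈ nonzeroBox X | sqCube (x, y) = m} : Finset ℤ).Nonempty
        · obtain ⟨x₀, hx₀⟩ := hne
          have : ({x ∈ nonzeroBox X | sqCube (x, y) = m} : Finset ℤ) ⊆ {x₀, -x₀} := fun x hx => by
            have h3 := (mem_filter.mp hx).2.trans (mem_filter.mp hx₀).2.symm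
            simp only [sqCube] at h3
            have h4 := mul_right_cancel₀ (pow_ne_zero 3 (ne_zero_of_mem_dyadicShell hY hy)) h3
            simpa using sq_eq_sq_iff_eq_or_eq_neg.mp h4
          exact (card_le_card this).trans card_le_two
        · rw [not_nonempty_iff_eq_empty.mp hne]; simp
      · rw [Nat.le_zero, card_eq_zero, filter_eq_empty_iff]
        intro x _ hx
        exact h ((hdvd y m).mpr ⟨x ^ 2, by rw [← hx, sqCube]; ring⟩)
    refine (sum_le_sum fun c _ => h1 _).trans (le_of_eq ?_)
    rw [sum_comm]
    refine sum_congr rfl fun y _ => ?_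
    rw [← sum_filter, sum_const, smul_eq_mul, mul_comm]
  have hR : ∀ y ∈ dyadicShell Y, (R y : ℝ) ^ 4 ≤ H ^ 3 := fun y hy => by
    have hy0 : y.natAbs ^ 3 ≠ 0 :=
      pow_ne_zero _ (Int.natAbs_ne_zero.mpr (ne_zero_of_mem_dyadicShell hY hy))
    have hy' := mem_dyadicShell.mp hy
    rw [Int.abs_eq_natAbs] at hy'
    refine mean_cube_pow_four_le (y.natAbs ^ 3) hy0
      (fun k => ‖expSum A sqCube (k / (y.natAbs ^ 3 : ℕ))‖) (fun _ => norm_nonneg _) ?_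
      (card_three_le_sum A sqCube hy0) (Nat.cast_nonneg _)
    rw [sum_norm_expSum_pow_four _ _ hy0]
    gcongr
    exact hH _ (by omega) (by omega)
  have hER : (energy A sqCube 0 : ℝ) ≤ ∑ y ∈ dyadicShell Y, 2 * (R y : ℝ) := by exact_mod_cast hE
  calc (energy A sqCube 0 : ℝ) ^ 4 ≤ (∑ y ∈ dyadicShell Y, 2 * (R y : ℝ)) ^ 4 := by gcongr
    _ ≤ (#(dyadicShell Y) : ℝ) ^ 3 * ∑ y ∈ dyadicShell Y, (2 * (R y : ℝ)) ^ 4 :=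
        sum_pow_four_le_card _ _
    _ ≤ (#(dyadicShell Y) : ℝ) ^ 3 * ∑ y ∈ dyadicShell Y, 16 * H ^ 3 := by
        gcongr with y hy
        rw [mul_pow]; norm_num
        exact hR y hy
    _ = (#(dyadicShell Y) : ℝ) ^ 4 * (16 * H ^ 3) := by rw [sum_const, nsmul_eq_mul]; ring
    _ ≤ (2 * Y : ℝ) ^ 4 * (16 * H ^ 3) := by
        have hH3 : 0 ≤ H := (Nat.cast_nonneg _).trans (hH Y le_rfl (by omega))
        gcongr
        exact_mod_cast card_dyadicShell_le Y
    _ = _ := by ring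

theorem sum_four_two_le (hY : 1 ≤ Y) (hΔ : DivisorBound M Δ)
    (hM : X ^ 2 ≤ M) {N : ℕ} (hN : 48 * X ^ 2 * Y ^ 3 < N) {y : ℤ} (hy : y ∈ dyadicShell Y) :
    ∑ k ∈ range N, ‖expSum (dyadicRect X Y) sqCube (k / N)‖ ^ 4 *
        ‖expSum (nonzeroBox X) (fun x => x ^ 2 * y ^ 3) (k / N)‖ ^ 2 ≤
      N * (4 * X * energy (dyadicRect X Y) sqCube 0 +
        Δ * energy (dyadicRect X Y) sqCube (y.natAbs ^ 3)) := by
  rw [sum_norm_expSum_four_two _ _ _ _ (by omega)]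
  gcongr
  set A := dyadicRect X Y with hA
  set B := nonzeroBox X
  set m : (((ℤ × ℤ) × (ℤ × ℤ)) × ((ℤ × ℤ) × (ℤ × ℤ))) → ℤ := fun q =>
    (sqCube q.1.1 - sqCube q.1.2) + (sqCube q.2.1 - sqCube q.2.2) with hm
  have hy0 : y ^ 3 ≠ 0 := pow_ne_zero _ (ne_zero_of_mem_dyadicShell hY hy)
  have hfib : ∀ q ∈ (A ×ˢ A) ×ˢ (A ×ˢ A),
      (#{r ∈ B ×ˢ B | (N : ℤ) ∣ m q + (r.1 ^ 2 * y ^ 3 - r.2 ^ 2 * y ^ 3)} : ℝ) ≤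
      (if m q = 0 then (4 * X : ℝ) else 0) +
        (if ((y.natAbs ^ 3 : ℕ) : ℤ) ∣ m q then Δ else 0) := fun q hq => by
    have heq : ({r ∈ B ×ˢ B | (N : ℤ) ∣ m q + (r.1 ^ 2 * y ^ 3 - r.2 ^ 2 * y ^ 3)} : Finset _) =
        {r ∈ B ×ˢ B | m q + (r.1 ^ 2 - r.2 ^ 2) * y ^ 3 = 0} := by
      refine filter_congr fun r hr => ?_
      rw [sub_mul]
      refine ⟨fun h => Int.eq_zero_of_abs_lt_dvd h ?_, fun h => h ▸ dvd_zero _⟩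
      simp only [mem_product] at hq hr
      have h1 := abs_le.mp (abs_sqCube_le hq.1.1)
      have h2 := abs_le.mp (abs_sqCube_le hq.1.2)
      have h3 := abs_le.mp (abs_sqCube_le hq.2.1)
      have h4 := abs_le.mp (abs_sqCube_le hq.2.2)
      have h5 := abs_le.mp (abs_sqCube_le (X := X) (Y := Y) (p := (r.1, y))
        (mem_product.mpr ⟨hr.1, hy⟩))
      have h6 := abs_le.mp (abs_sqCube_le (X := X) (Y := Y) (p := (r.2, y))
        (mem_product.mpr ⟨hr.2, hy⟩))
      simp only [hm]
      simp only [sqCube] at *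
      rw [abs_lt]
      have h8 : 48 * (X ^ 2 * Y ^ 3) < N := by linarith
      rw [show 8 * X ^ 2 * Y ^ 3 = 8 * (X ^ 2 * Y ^ 3) by ring] at *
      constructor <;> omega
    rw [heq]
    by_cases h0 : m q = 0
    · rw [if_pos h0, if_pos (h0 ▸ dvd_zero _), h0]
      have h1 : ({r ∈ B ×ˢ B | 0 + (r.1 ^ 2 - r.2 ^ 2) * y ^ 3 = 0} : Finset _) =
          {r ∈ B ×ˢ B | r.1 ^ 2 - r.2 ^ 2 = 0} := by
        refine filter_congr fun r _ => ?_
        simp [hy0, -pow_eq_zero_iff]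
      have := card_sq_eq_sq_le X
      rw [h1]
      have h2 : (#{r ∈ B ×ˢ B | r.1 ^ 2 - r.2 ^ 2 = 0} : ℝ) ≤ 4 * X := by exact_mod_cast this
      linarith [hΔ.nonneg]
    · rw [if_neg h0, zero_add]
      rcases ({r ∈ B ×ˢ B | m q + (r.1 ^ 2 - r.2 ^ 2) * y ^ 3 = 0} :
        Finset _).eq_empty_or_nonempty with h | ⟨r₀, hr₀⟩
      · rw [h]; simp only [card_empty, Nat.cast_zero]
        split_ifs
        exacts [hΔ.nonneg, le_rfl]
      · rw [mem_filter] at hr₀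
        have hd : ((y.natAbs ^ 3 : ℕ) : ℤ) ∣ m q := by
          rw [Int.natCast_dvd, ← Int.natAbs_pow, Int.natAbs_dvd_natAbs]
          exact ⟨-(r₀.1 ^ 2 - r₀.2 ^ 2), by linarith [hr₀.2]⟩
        rw [if_pos hd]
        have h2 : ({r ∈ B ×ˢ B | m q + (r.1 ^ 2 - r.2 ^ 2) * y ^ 3 = 0} : Finset _) =
            {r ∈ B ×ˢ B | r.1 ^ 2 - r.2 ^ 2 = r₀.1 ^ 2 - r₀.2 ^ 2} := by
          refine filter_congr fun r _ => ?_
          constructor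
          · intro h
            apply mul_right_cancel₀ hy0
            linarith [hr₀.2]
          · intro h; rw [h]; exact hr₀.2
        rw [h2]
        refine card_sq_sub_sq_le hΔ _ (fun h => h0 ?_) ?_
        · have := hr₀.2
          rw [h] at this; linarith
        · have := natAbs_sq_sub_sq_le hr₀.1
          rw [Int.abs_eq_natAbs] at this
          omega
  have hc : #{p ∈ ((A ×ˢ A) ×ˢ (A ×ˢ A)) ×ˢ (B ×ˢ B) | (N : ℤ) ∣
      ((sqCube p.1.1.1 - sqCube p.1.1.2) + (sqCube p.1.2.1 - sqCube p.1.2.2)) +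
        (p.2.1 ^ 2 * y ^ 3 - p.2.2 ^ 2 * y ^ 3)} = ∑ q ∈ (A ×ˢ A) ×ˢ (A ×ˢ A),
      #{r ∈ B ×ˢ B | (N : ℤ) ∣ m q + (r.1 ^ 2 * y ^ 3 - r.2 ^ 2 * y ^ 3)} := by
    rw [card_filter, sum_product]
    exact sum_congr rfl fun q _ => (card_filter _ _).symm
  rw [hc]
  push_cast
  refine (sum_le_sum hfib).trans (le_of_eq ?_)
  rw [sum_add_distrib, ← sum_filter, ← sum_filter, sum_const, sum_const, nsmul_eq_mul,
    nsmul_eq_mul, mul_comm, mul_comm _ Δ]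
  simp only [energy, Nat.cast_zero, zero_dvd_iff, hm]

end DyadicRect

theorem pow_eight_le_of_sq_le {m E H X Y Δ h c μ π T : ℝ} (hX : 0 ≤ X) (hΔ : 1 ≤ Δ)
    (hE : 0 ≤ E) (hH : 0 ≤ H) (hc : 0 ≤ c) (hπ : 0 ≤ π)
    (hm : m ^ 2 ≤ (2 * Y) ^ 2 * (E * (4 * X * E + Δ * H)))
    (hp : E ^ 4 ≤ c * Δ ^ 12 * π) (hHμ : H ≤ h * Δ ^ 4 * μ)
    (h1 : Y ^ 8 * π * (X ^ 4 * π) ≤ T) (h2 : Y ^ 8 * π * μ ^ 4 ≤ T) :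
    m ^ 8 ≤ 2048 * c * (256 * c + h ^ 4) * (Δ ^ 32 * T) := by
  have hΔ0 : 0 ≤ Δ := by linarith
  have hsum : (4 * X * E + Δ * H) ^ 4 ≤ 8 * ((4 * X * E) ^ 4 + (Δ * H) ^ 4) := by
    have := add_pow_le (show 0 ≤ 4 * X * E by positivity) (show 0 ≤ Δ * H by positivity) 4
    norm_num at this ⊢
    exact this
  have hH4 : (Δ * H) ^ 4 ≤ Δ ^ 20 * (h ^ 4 * μ ^ 4) := by
    calc (Δ * H) ^ 4 ≤ (Δ * (h * Δ ^ 4 * μ)) ^ 4 := by gcongr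
      _ = _ := by ring
  have hXE : (4 * X * E) ^ 4 ≤ Δ ^ 20 * (256 * c * (X ^ 4 * π)) := by
    calc (4 * X * E) ^ 4 = 256 * X ^ 4 * E ^ 4 := by ring
      _ ≤ 256 * X ^ 4 * (c * Δ ^ 12 * π) := by gcongr
      _ = Δ ^ 12 * (256 * c * (X ^ 4 * π)) := by ring
      _ ≤ _ := by gcongr; norm_num
  calc m ^ 8 = (m ^ 2) ^ 4 := by ring
    _ ≤ ((2 * Y) ^ 2 * (E * (4 * X * E + Δ * H))) ^ 4 := by gcongr
    _ = 256 * Y ^ 8 * (E ^ 4 * (4 * X * E + Δ * H) ^ 4) := by ring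
    _ ≤ 256 * Y ^ 8 * ((c * Δ ^ 12 * π) *
        (8 * (Δ ^ 20 * (256 * c * (X ^ 4 * π)) + Δ ^ 20 * (h ^ 4 * μ ^ 4)))) := by
        gcongr
        exact hsum.trans (by gcongr)
    _ = 2048 * c * Δ ^ 32 * (256 * c * (Y ^ 8 * π * (X ^ 4 * π)) + h ^ 4 * (Y ^ 8 * π * μ ^ 4)) := by
        ring
    _ ≤ 2048 * c * Δ ^ 32 * (256 * c * T + h ^ 4 * T) := by gcongr
    _ = _ := by ring

theorem pow_eight_le {m E H X Y Δ : ℝ} (hX : 1 ≤ X) (hY : 1 ≤ Y) (hΔ : 1 ≤ Δ)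
    (hE : 0 ≤ E) (hm0 : 0 ≤ m)
    (hE1 : E ≤ 64 * Δ ^ 2 * X ^ 3 * Y ^ 3) (hE2 : E ≤ 768 * Δ * X ^ 2 * Y ^ 4)
    (hE3 : E ^ 4 ≤ 256 * Y ^ 4 * H ^ 3) (hH : H = 3072 * Δ ^ 4 * (X ^ 2 * Y ^ 4 + X ^ 4 * Y))
    (hm : m ^ 2 ≤ (2 * Y) ^ 2 * (E * (4 * X * E + Δ * H))) (hm1 : m ≤ 4 * X * Y * E) :
    m ^ 8 ≤ 2 ^ 112 * (Δ ^ 32 * (X ^ 24 * Y ^ 35)) := by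
  have hX0 : 0 < X := by linarith
  have hY0 : 0 < Y := by linarith
  have hΔ0 : 0 < Δ := by linarith
  have hH0 : 0 ≤ H := by rw [hH]; positivity
  have main : ∀ μ π : ℝ, 0 ≤ μ → 0 ≤ π → E ^ 4 ≤ 2 ^ 46 * Δ ^ 12 * π → H ≤ 6144 * Δ ^ 4 * μ →
      Y ^ 8 * π * (X ^ 4 * π) ≤ X ^ 24 * Y ^ 35 → Y ^ 8 * π * μ ^ 4 ≤ X ^ 24 * Y ^ 35 →
      m ^ 8 ≤ 2 ^ 112 * (Δ ^ 32 * (X ^ 24 * Y ^ 35)) := by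
    intro μ π hμ hπ hp hHμ h1 h2
    refine (pow_eight_le_of_sq_le hX0.le hΔ hE hH0 (by norm_num) hπ hm
      hp hHμ h1 h2).trans ?_
    gcongr ?_ * _
    norm_num
  rcases le_or_gt (X ^ 4) Y with hA | hA
  · have h8 : X ^ 8 ≤ Y ^ 3 := by
      calc X ^ 8 = (X ^ 4) ^ 2 := by ring
        _ ≤ Y ^ 2 := by gcongr
        _ ≤ Y ^ 3 := by gcongr; norm_num [hY]
    calc m ^ 8 ≤ (4 * X * Y * E) ^ 8 := by gcongr
      _ ≤ (4 * X * Y * (64 * Δ ^ 2 * X ^ 3 * Y ^ 3)) ^ 8 := by gcongr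
      _ = 2 ^ 64 * (Δ ^ 16 * (X ^ 24 * (X ^ 8 * Y ^ 32))) := by ring
      _ ≤ 2 ^ 112 * (Δ ^ 32 * (X ^ 24 * (Y ^ 3 * Y ^ 32))) := by
          gcongr <;> norm_num [hΔ]
      _ = _ := by ring
  rcases le_or_gt (X ^ 4) (Y ^ 3) with hB | hB
  · have h2 : X ^ 2 ≤ Y ^ 3 := by
      calc X ^ 2 ≤ X ^ 4 := by gcongr; norm_num [hX]
        _ ≤ _ := hB
    refine main (X ^ 2 * Y ^ 4) (X ^ 12 * Y ^ 12) (by positivity) (by positivity) ?_ ?_ ?_ ?_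
    · calc E ^ 4 ≤ (64 * Δ ^ 2 * X ^ 3 * Y ^ 3) ^ 4 := by gcongr
        _ = 2 ^ 24 * Δ ^ 8 * (X ^ 12 * Y ^ 12) := by ring
        _ ≤ _ := by gcongr <;> norm_num [hΔ]
    · rw [hH]
      have : X ^ 2 * (X ^ 2 * Y) ≤ X ^ 2 * (Y ^ 3 * Y) := by gcongr
      calc 3072 * Δ ^ 4 * (X ^ 2 * Y ^ 4 + X ^ 4 * Y)
          = 3072 * Δ ^ 4 * (X ^ 2 * Y ^ 4 + X ^ 2 * (X ^ 2 * Y)) := by ring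
        _ ≤ 3072 * Δ ^ 4 * (X ^ 2 * Y ^ 4 + X ^ 2 * (Y ^ 3 * Y)) := by gcongr
        _ = _ := by ring
    · calc _ = X ^ 24 * Y ^ 32 * X ^ 4 := by ring
        _ ≤ X ^ 24 * Y ^ 32 * Y ^ 3 := by gcongr
        _ = _ := by ring
    · calc _ = X ^ 20 * Y ^ 35 * Y := by ring
        _ ≤ X ^ 20 * Y ^ 35 * X ^ 4 := by gcongr
        _ = _ := by ring
  have h8 : Y ^ 5 ≤ X ^ 8 := by
    calc Y ^ 5 ≤ Y ^ 6 := by gcongr; norm_num [hY]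
      _ = (Y ^ 3) ^ 2 := by ring
      _ ≤ (X ^ 4) ^ 2 := by gcongr
      _ = _ := by ring
  rcases le_or_gt (X ^ 2) (Y ^ 3) with hC | hC
  · have hHμ : H ≤ 6144 * Δ ^ 4 * (X ^ 2 * Y ^ 4) := by
      rw [hH]
      have : X ^ 2 * (X ^ 2 * Y) ≤ X ^ 2 * (Y ^ 3 * Y) := by gcongr
      calc 3072 * Δ ^ 4 * (X ^ 2 * Y ^ 4 + X ^ 4 * Y)
          = 3072 * Δ ^ 4 * (X ^ 2 * Y ^ 4 + X ^ 2 * (X ^ 2 * Y)) := by ring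
        _ ≤ 3072 * Δ ^ 4 * (X ^ 2 * Y ^ 4 + X ^ 2 * (Y ^ 3 * Y)) := by gcongr
        _ = _ := by ring
    refine main (X ^ 2 * Y ^ 4) (X ^ 6 * Y ^ 16) (by positivity) (by positivity) ?_ hHμ ?_ ?_
    · calc E ^ 4 ≤ 256 * Y ^ 4 * H ^ 3 := hE3
        _ ≤ 256 * Y ^ 4 * (6144 * Δ ^ 4 * (X ^ 2 * Y ^ 4)) ^ 3 := by gcongr
        _ = 256 * 6144 ^ 3 * Δ ^ 12 * (X ^ 6 * Y ^ 16) := by ring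
        _ ≤ _ := by gcongr; norm_num
    · calc _ = X ^ 16 * Y ^ 35 * Y ^ 5 := by ring
        _ ≤ X ^ 16 * Y ^ 35 * X ^ 8 := by gcongr
        _ = _ := by ring
    · calc _ = X ^ 14 * Y ^ 35 * Y ^ 5 := by ring
        _ ≤ X ^ 14 * Y ^ 35 * X ^ 8 := by gcongr
        _ = X ^ 22 * Y ^ 35 := by ring
        _ ≤ X ^ 24 * Y ^ 35 := by gcongr; norm_num [hX]
  · have h5 : Y ^ 5 ≤ X ^ 4 := by
      calc Y ^ 5 ≤ Y ^ 6 := by gcongr; norm_num [hY]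
        _ = (Y ^ 3) ^ 2 := by ring
        _ ≤ (X ^ 2) ^ 2 := by gcongr
        _ = _ := by ring
    refine main (X ^ 4 * Y) (X ^ 8 * Y ^ 16) (by positivity) (by positivity) ?_ ?_ ?_ ?_
    · calc E ^ 4 ≤ (768 * Δ * X ^ 2 * Y ^ 4) ^ 4 := by gcongr
        _ = 768 ^ 4 * Δ ^ 4 * (X ^ 8 * Y ^ 16) := by ring
        _ ≤ _ := by gcongr <;> norm_num [hΔ]
    · rw [hH]
      have : X ^ 2 * (Y ^ 3 * Y) ≤ X ^ 2 * (X ^ 2 * Y) := by gcongr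
      calc 3072 * Δ ^ 4 * (X ^ 2 * Y ^ 4 + X ^ 4 * Y)
          = 3072 * Δ ^ 4 * (X ^ 2 * (Y ^ 3 * Y) + X ^ 4 * Y) := by ring
        _ ≤ 3072 * Δ ^ 4 * (X ^ 2 * (X ^ 2 * Y) + X ^ 4 * Y) := by gcongr
        _ = _ := by ring
    · calc _ = X ^ 20 * Y ^ 35 * Y ^ 5 := by ring
        _ ≤ X ^ 20 * Y ^ 35 * X ^ 4 := by gcongr
        _ = _ := by ring
    · calc _ = X ^ 24 * Y ^ 28 := by ring
        _ ≤ X ^ 24 * Y ^ 35 := by gcongr; norm_num [hY]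

/-- Fifth moment of the exponential sum over a dyadic rectangle. -/
theorem fifth_moment_dyadicRect_le {X Y M N : ℕ} {Δ : ℝ} (hX : 1 ≤ X) (hY : 1 ≤ Y)
    (hΔ : DivisorBound M Δ) (hM : 8 * X ^ 2 * Y ^ 3 ≤ M) (hN : 48 * X ^ 2 * Y ^ 3 < N) :
    (∑ k ∈ range N, ‖expSum (dyadicRect X Y) sqCube (k / N)‖ ^ 5) ^ 8 ≤
      N ^ 8 * (2 ^ 112 * (Δ ^ 32 * ((X : ℝ) ^ 24 * (Y : ℝ) ^ 35))) := by
  have hX2 : X ^ 2 ≤ M := by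
    have : 1 ≤ Y ^ 3 := Nat.one_le_pow _ _ hY
    nlinarith [Nat.zero_le (X ^ 2)]
  have hYM : 2 * Y ≤ M := by
    have h1 : 1 ≤ X ^ 2 := Nat.one_le_pow _ _ hX
    have h2 : Y ≤ Y ^ 3 := Nat.le_self_pow (by norm_num) Y
    nlinarith
  have h1Δ := hΔ.1
  have hN0 : N ≠ 0 := by omega
  have hNR : (0 : ℝ) < N := by positivity
  set S : ℕ → ℝ := fun k => ‖expSum (dyadicRect X Y) sqCube (k / N)‖ with hS
  set T : ℤ → ℕ → ℝ := fun y k => ‖expSum (nonzeroBox X) (fun x => x ^ 2 * y ^ 3) (k / N)‖ with hT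
  set E := (energy (dyadicRect X Y) sqCube 0 : ℝ) with hE
  set H : ℝ := 3072 * Δ ^ 4 * ((X : ℝ) ^ 2 * (Y : ℝ) ^ 4 + (X : ℝ) ^ 4 * Y) with hH
  have hS4 : ∑ k ∈ range N, S k ^ 4 = N * E := by
    rw [hE, ← energy_eq_energy_zero (N := N) _ _ (fun p hp => abs_sqCube_le hp) (by linarith)]
    exact sum_norm_expSum_pow_four _ _ hN0
  have hHn : ∀ n : ℕ, Y ≤ n → n < 2 * Y →
      (energy (dyadicRect X Y) sqCube (n ^ 3) : ℝ) ≤ H := fun n h1 h2 =>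
    energy_dyadicRect_cube_le hX hY h1 (by omega) hΔ hX2
  have hF : ∀ y ∈ dyadicShell Y, ∑ k ∈ range N, S k ^ 4 * T y k ^ 2 ≤
      N * (4 * X * E + Δ * H) := fun y hy => by
    refine (sum_four_two_le hY hΔ hX2 hN hy).trans ?_
    have hy' := mem_dyadicShell.mp hy
    rw [Int.abs_eq_natAbs] at hy'
    have := hHn y.natAbs (by omega) (by omega)
    gcongr
  have hW : ∀ y ∈ dyadicShell Y, (∑ k ∈ range N, S k ^ 4 * T y k) ^ 2 ≤
      N ^ 2 * (E * (4 * X * E + Δ * H)) := fun y hy => by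
    have h1 : (∑ k ∈ range N, S k ^ 4 * T y k) ^ 2 ≤
        (∑ k ∈ range N, S k ^ 4) * ∑ k ∈ range N, S k ^ 4 * T y k ^ 2 :=
      sum_sq_le_sum_mul_sum_of_sq_le_mul _ (fun k _ => by positivity) (fun k _ => by positivity)
        (fun k _ => by ring_nf; rfl)
    rw [hS4] at h1
    refine h1.trans ?_
    calc N * E * ∑ k ∈ range N, S k ^ 4 * T y k ^ 2 ≤ N * E * (N * (4 * X * E + Δ * H)) := by
          gcongr; exact hF y hy
      _ = _ := by ring
  set m : ℝ := (∑ k ∈ range N, S k ^ 5) / N with hm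
  have hm0 : 0 ≤ m := div_nonneg (sum_nonneg fun k _ => by positivity) hNR.le
  have h5 : ∑ k ∈ range N, S k ^ 5 ≤ ∑ y ∈ dyadicShell Y, ∑ k ∈ range N, S k ^ 4 * T y k := by
    rw [sum_comm]
    refine sum_le_sum fun k _ => ?_
    rw [← mul_sum, pow_succ]
    gcongr
    simp only [hS, hT, expSum_dyadicRect]
    exact norm_sum_le _ _
  have hm2 : m ^ 2 ≤ (2 * Y) ^ 2 * (E * (4 * X * E + Δ * H)) := by
    rw [hm, div_pow, div_le_iff₀ (by positivity)]
    calc (∑ k ∈ range N, S k ^ 5) ^ 2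
        ≤ (∑ y ∈ dyadicShell Y, ∑ k ∈ range N, S k ^ 4 * T y k) ^ 2 := by gcongr
      _ ≤ #(dyadicShell Y) * ∑ y ∈ dyadicShell Y, (∑ k ∈ range N, S k ^ 4 * T y k) ^ 2 :=
          sq_sum_le_card_mul_sum_sq
      _ ≤ #(dyadicShell Y) * ∑ y ∈ dyadicShell Y, N ^ 2 * (E * (4 * X * E + Δ * H)) := by
          gcongr with y hy; exact hW y hy
      _ = (#(dyadicShell Y) : ℝ) ^ 2 * (N ^ 2 * (E * (4 * X * E + Δ * H))) := by
          rw [sum_const, nsmul_eq_mul]; ring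
      _ ≤ (2 * Y : ℝ) ^ 2 * (N ^ 2 * (E * (4 * X * E + Δ * H))) := by
          gcongr; exact_mod_cast card_dyadicShell_le Y
      _ = _ := by ring
  have hm1 : m ≤ 4 * X * Y * E := by
    rw [hm, div_le_iff₀ hNR]
    calc ∑ k ∈ range N, S k ^ 5 ≤ ∑ k ∈ range N, 4 * X * Y * S k ^ 4 := by
          refine sum_le_sum fun k _ => ?_
          rw [pow_succ, mul_comm]
          gcongr
          refine (norm_expSum_le _ _ _).trans ?_
          exact_mod_cast card_dyadicRect_le X Y
      _ = _ := by rw [← mul_sum, hS4]; ring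
  have := pow_eight_le (by exact_mod_cast hX) (by exact_mod_cast hY) h1Δ (Nat.cast_nonneg _) hm0
    (energy_dyadicRect_le_cube hY hΔ hM) (energy_dyadicRect_le_fourth hX hY hΔ hM)
    (energy_dyadicRect_pow_four_le hY hHn) hH hm2 hm1
  rw [hm, div_pow, div_le_iff₀ (by positivity)] at this
  linarith

/-- The largest `X` with `X² 8ʲ ≤ B`. -/
noncomputable def rectWidth (B : ℝ) (j : ℕ) : ℕ := ⌊√(B / 8 ^ j)⌋₊

/-- The number of dyadic ranges of `y` needed to cover `|x² y³| ≤ B`. -/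
noncomputable def rectCount (B : ℝ) : ℕ := Nat.log 8 ⌊B⌋₊ + 1

/-- A union of dyadic rectangles covering the pairs with `|x² y³| ≤ B` and `|y| ≥ 2 ^ J`. -/
noncomputable def rectUnion (B : ℝ) (J : ℕ) : Finset (ℤ × ℤ) :=
  (Ico J (rectCount B)).biUnion fun j => dyadicRect (rectWidth B j) (2 ^ j)

theorem rectWidth_sq_le {B : ℝ} (hB : 0 ≤ B) (j : ℕ) : (rectWidth B j : ℝ) ^ 2 * 8 ^ j ≤ B := by
  have h := Nat.floor_le (Real.sqrt_nonneg (B / 8 ^ j))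
  calc (rectWidth B j : ℝ) ^ 2 * 8 ^ j ≤ √(B / 8 ^ j) ^ 2 * 8 ^ j := by
        gcongr; exact h
    _ = B := by rw [Real.sq_sqrt (by positivity)]; field_simp

theorem eight_pow_le {B : ℝ} (hB : 1 ≤ B) {j : ℕ} (hj : j < rectCount B) : (8 : ℝ) ^ j ≤ B := by
  have h1 : 8 ^ j ≤ ⌊B⌋₊ := Nat.pow_le_of_le_log (by
    have : 0 < ⌊B⌋₊ := Nat.floor_pos.mpr hB
    omega) (by rw [rectCount] at hj; omega)
  calc (8 : ℝ) ^ j ≤ ⌊B⌋₊ := by exact_mod_cast h1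
    _ ≤ B := Nat.floor_le (by linarith)

theorem one_le_rectWidth {B : ℝ} (hB : 1 ≤ B) {j : ℕ} (hj : j < rectCount B) :
    1 ≤ rectWidth B j := by
  rw [rectWidth, Nat.one_le_floor_iff, Real.one_le_sqrt, one_le_div (by positivity)]
  exact eight_pow_le hB hj

theorem rectCount_le {B : ℝ} (hB : 1 ≤ B) {M : ℕ} {Δ : ℝ} (hΔ : DivisorBound M Δ) (hM : 8 * B ≤ M) :
    (rectCount B : ℝ) ≤ Δ := by
  have h := hΔ.2 (2 ^ (rectCount B - 1)) (by positivity) (by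
    rw [Int.natAbs_pow]
    have h1 := eight_pow_le hB (j := rectCount B - 1) (by rw [rectCount]; omega)
    have h2 : (2 : ℝ) ^ (rectCount B - 1) ≤ M := by
      calc (2 : ℝ) ^ (rectCount B - 1) ≤ 8 ^ (rectCount B - 1) := by gcongr; norm_num
        _ ≤ M := by linarith
    exact_mod_cast h2)
  rw [card_int_divisors, Int.natAbs_pow] at h
  simp only [Int.reduceAbs, Nat.divisors_prime_pow Nat.prime_two, card_map, card_range] at h
  refine le_trans ?_ h
  have : rectCount B ≤ 2 * (rectCount B - 1 + 1) := by omega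
  exact_mod_cast this

theorem mem_rectUnion {B : ℝ} {J : ℕ} {x y : ℤ} (hx : x ≠ 0) (hy : y ≠ 0)
    (hxy : |(x : ℝ) ^ 2 * y ^ 3| ≤ B) (hJ : 2 ^ J ≤ y.natAbs) : (x, y) ∈ rectUnion B J := by
  have hy0 : y.natAbs ≠ 0 := Int.natAbs_ne_zero.mpr hy
  set j := Nat.log 2 y.natAbs with hj
  have hlow : 2 ^ j ≤ y.natAbs := Nat.pow_log_le_self 2 hy0
  have hupp : y.natAbs < 2 ^ (j + 1) := Nat.lt_pow_succ_log_self (by norm_num) _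
  have hyR : ((2 : ℝ) ^ j) ≤ |(y : ℝ)| := by
    rw [← Int.cast_abs, Int.abs_eq_natAbs]; exact_mod_cast hlow
  have hxR : (1 : ℝ) ≤ |(x : ℝ)| := by
    rw [← Int.cast_abs]; exact_mod_cast Int.one_le_abs hx
  rw [abs_mul, abs_pow, abs_pow] at hxy
  have h8 : |(x : ℝ)| ^ 2 * 8 ^ j ≤ B := by
    refine le_trans ?_ hxy
    have : (8 : ℝ) ^ j = (2 ^ j) ^ 3 := by rw [← pow_mul, mul_comm, pow_mul]; norm_num
    rw [this]
    gcongr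
  have h8' : (8 : ℝ) ^ j ≤ B := by
    refine le_trans ?_ h8
    exact le_mul_of_one_le_left (by positivity) (one_le_pow₀ hxR)
  rw [rectUnion, mem_biUnion]
  refine ⟨j, mem_Ico.mpr ⟨?_, ?_⟩, ?_⟩
  · exact Nat.le_log_of_pow_le (by norm_num) hJ
  · rw [rectCount, Nat.lt_add_one_iff]
    refine Nat.le_log_of_pow_le (by norm_num) (Nat.le_floor ?_)
    exact_mod_cast h8'
  · rw [dyadicRect, mem_product, mem_nonzeroBox, mem_dyadicShell]
    refine ⟨⟨hx, ?_⟩, ?_, ?_⟩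
    · have : x.natAbs ≤ rectWidth B j := by
        refine Nat.le_floor (Real.le_sqrt_of_sq_le ?_)
        rw [le_div_iff₀ (by positivity), Nat.cast_natAbs, Int.cast_abs]
        exact h8
      rw [Int.abs_eq_natAbs]; exact_mod_cast this
    · rw [Int.abs_eq_natAbs]; exact_mod_cast hlow
    · rw [pow_succ'] at hupp
      rw [Int.abs_eq_natAbs]; exact_mod_cast hupp

theorem expSum_rectUnion (B : ℝ) (J : ℕ) (α : ℝ) :
    expSum (rectUnion B J) sqCube α =
      ∑ j ∈ Ico J (rectCount B), expSum (dyadicRect (rectWidth B j) (2 ^ j)) sqCube α := by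
  rw [expSum, rectUnion, sum_biUnion]
  · rfl
  · intro i _ j _ hij
    refine disjoint_left.mpr fun p hi hj => hij ?_
    simp only [dyadicRect, mem_product, mem_dyadicShell] at hi hj
    have h1 : 2 ^ i < 2 ^ (j + 1) := by
      rw [pow_succ']; exact_mod_cast hi.2.1.trans_lt hj.2.2
    have h2 : 2 ^ j < 2 ^ (i + 1) := by
      rw [pow_succ']; exact_mod_cast hj.2.1.trans_lt hi.2.2
    have h3 := (Nat.pow_lt_pow_iff_right (by norm_num)).mp h1
    have h4 := (Nat.pow_lt_pow_iff_right (by norm_num)).mp h2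
    omega

section Tail

variable {B Δ ρ : ℝ} {M : ℕ}

theorem card_rectUnion_le (hB : 1 ≤ B) (hΔ : DivisorBound M Δ) (hM : 8 * B ≤ M) (J : ℕ) :
    (#(rectUnion B J) : ℝ) ≤ 4 * Δ * √B := by
  have hB0 : 0 ≤ B := by linarith
  have hj : ∀ j ∈ Ico J (rectCount B),
      (#(dyadicRect (rectWidth B j) (2 ^ j)) : ℝ) ≤ 4 * √B := fun j _ => by
    have h1 : (#(dyadicRect (rectWidth B j) (2 ^ j)) : ℝ) ≤ 4 * rectWidth B j * 2 ^ j := by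
      exact_mod_cast card_dyadicRect_le _ _
    have h2 : (rectWidth B j : ℝ) * 2 ^ j ≤ √B := by
      refine Real.le_sqrt_of_sq_le ?_
      refine le_trans ?_ (rectWidth_sq_le hB0 j)
      rw [mul_pow, ← pow_mul, mul_comm j, pow_mul]
      gcongr
      norm_num
    linarith
  calc (#(rectUnion B J) : ℝ) ≤ ∑ j ∈ Ico J (rectCount B),
        (#(dyadicRect (rectWidth B j) (2 ^ j)) : ℝ) := by exact_mod_cast card_biUnion_le
    _ ≤ _ := sum_le_sum hj
    _ = ((rectCount B - J : ℕ) : ℝ) * (4 * √B) := by rw [sum_const, nsmul_eq_mul, Nat.card_Ico]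
    _ ≤ Δ * (4 * √B) := by
        gcongr
        refine le_trans ?_ (rectCount_le hB hΔ hM)
        exact_mod_cast Nat.sub_le _ _
    _ = _ := by ring

theorem fifth_moment_rect_le (hB : 1 ≤ B) (hΔ : DivisorBound M Δ) (hM : 8 * B ≤ M)
    (hρ : 0 < ρ) (hρ40 : ρ ^ 40 = 1 / 2) {j : ℕ} (hj : j < rectCount B) {N : ℕ}
    (hN : 48 * B < N) :
    ∑ k ∈ range N, ‖expSum (dyadicRect (rectWidth B j) (2 ^ j)) sqCube (k / N)‖ ^ 5 ≤
      N * (2 ^ 14 * Δ ^ 4 * √B ^ 3 * ρ ^ (5 * j)) := by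
  have hB0 : 0 ≤ B := by linarith
  have h1Δ := hΔ.1
  have hw := rectWidth_sq_le hB0 j
  have h8 : ((2 ^ j : ℕ) : ℝ) ^ 3 = 8 ^ j := by
    push_cast; rw [← pow_mul, mul_comm, pow_mul]; norm_num
  have key := fifth_moment_dyadicRect_le (N := N) (one_le_rectWidth hB hj) (Nat.one_le_two_pow (n := j))
    hΔ (by
      have : ((8 * rectWidth B j ^ 2 * (2 ^ j) ^ 3 : ℕ) : ℝ) ≤ M := by
        push_cast at h8 ⊢
        rw [h8]; linarith
      exact_mod_cast this) (by
      have : ((48 * rectWidth B j ^ 2 * (2 ^ j) ^ 3 : ℕ) : ℝ) < N := by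
        push_cast at h8 ⊢
        rw [h8]; linarith
      exact_mod_cast this)
  refine le_of_pow_le_pow_left₀ (n := 8) (by norm_num) (by positivity) (key.trans ?_)
  have h12 : (rectWidth B j : ℝ) ^ 24 * ((2 ^ j : ℕ) : ℝ) ^ 35 ≤ √B ^ 24 * ρ ^ (40 * j) := by
    rw [pow_mul, hρ40, one_div, inv_pow, show √B ^ 24 = (√B ^ 2) ^ 12 by ring, Real.sq_sqrt hB0,
      ← div_eq_mul_inv, le_div_iff₀ (by positivity)]
    calc (rectWidth B j : ℝ) ^ 24 * ((2 ^ j : ℕ) : ℝ) ^ 35 * 2 ^ j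
        = ((rectWidth B j : ℝ) ^ 2 * ((2 ^ j : ℕ) : ℝ) ^ 3) ^ 12 := by push_cast; ring
      _ ≤ B ^ 12 := by rw [h8]; gcongr
  calc (N : ℝ) ^ 8 * (2 ^ 112 * (Δ ^ 32 * ((rectWidth B j : ℝ) ^ 24 * ((2 ^ j : ℕ) : ℝ) ^ 35)))
      ≤ (N : ℝ) ^ 8 * (2 ^ 112 * (Δ ^ 32 * (√B ^ 24 * ρ ^ (40 * j)))) := by gcongr
    _ = _ := by ring

theorem fifth_moment_rectUnion_le (hB : 1 ≤ B) (hΔ : DivisorBound M Δ) (hM : 8 * B ≤ M)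
    (hρ : 0 < ρ) (hρ40 : ρ ^ 40 = 1 / 2) (J : ℕ) {N : ℕ} (hN : 48 * B < N) :
    ∑ k ∈ range N, ‖expSum (rectUnion B J) sqCube (k / N)‖ ^ 5 ≤
      N * (2 ^ 14 * Δ ^ 9 * √B ^ 3 * ρ ^ (5 * J)) := by
  have h1Δ := hΔ.1
  have hL := rectCount_le hB hΔ hM
  have hρ1 : ρ ≤ 1 := by
    by_contra! h
    have := one_lt_pow₀ h (n := 40) (by norm_num)
    rw [hρ40] at this; norm_num at this
  set I := Ico J (rectCount B) with hI
  have hcard : (#I : ℝ) ≤ Δ := by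
    refine le_trans ?_ hL
    rw [hI, Nat.card_Ico]; exact_mod_cast Nat.sub_le _ _
  have hpt : ∀ α : ℝ, ‖expSum (rectUnion B J) sqCube α‖ ^ 5 ≤
      Δ ^ 4 * ∑ j ∈ I, ‖expSum (dyadicRect (rectWidth B j) (2 ^ j)) sqCube α‖ ^ 5 := fun α => by
    rw [expSum_rectUnion]
    refine (pow_le_pow_left₀ (norm_nonneg _) (norm_sum_le _ _) 5).trans ?_
    refine (pow_sum_le_card_mul_sum_pow (fun _ _ => norm_nonneg _) 4).trans ?_
    gcongr
  calc _ ≤ ∑ k ∈ range N, Δ ^ 4 * ∑ j ∈ I,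
        ‖expSum (dyadicRect (rectWidth B j) (2 ^ j)) sqCube (k / N)‖ ^ 5 :=
        sum_le_sum fun k _ => hpt _
    _ = Δ ^ 4 * ∑ j ∈ I, ∑ k ∈ range N,
        ‖expSum (dyadicRect (rectWidth B j) (2 ^ j)) sqCube (k / N)‖ ^ 5 := by
        rw [← mul_sum, sum_comm]
    _ ≤ Δ ^ 4 * ∑ j ∈ I, N * (2 ^ 14 * Δ ^ 4 * √B ^ 3 * ρ ^ (5 * J)) := by
        gcongr with j hj
        have hj' := mem_Ico.mp hj
        refine (fifth_moment_rect_le hB hΔ hM hρ hρ40 hj'.2 hN).trans ?_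
        gcongr N * (_ * ?_)
        exact pow_le_pow_of_le_one hρ.le hρ1 (by omega)
    _ = Δ ^ 4 * (#I * (N * (2 ^ 14 * Δ ^ 4 * √B ^ 3 * ρ ^ (5 * J)))) := by
        rw [sum_const, nsmul_eq_mul]
    _ ≤ Δ ^ 4 * (Δ * (N * (2 ^ 14 * Δ ^ 4 * √B ^ 3 * ρ ^ (5 * J)))) := by gcongr
    _ = _ := by ring

theorem mul_pow_four_le {a b θ : ℝ} (ha : 0 ≤ a) (hb : 0 ≤ b) (hθ : 0 < θ) :
    a * b ^ 4 ≤ a ^ 5 / θ ^ 4 + θ * b ^ 5 := by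
  rcases le_or_gt a (θ * b) with h | h
  · have : a * b ^ 4 ≤ θ * b * b ^ 4 := by gcongr
    have h2 : 0 ≤ a ^ 5 / θ ^ 4 := by positivity
    calc a * b ^ 4 ≤ θ * b * b ^ 4 := this
      _ = θ * b ^ 5 := by ring
      _ ≤ _ := by linarith
  · have h1 : a * b ^ 4 ≤ a ^ 5 / θ ^ 4 := by
      rw [le_div_iff₀ (by positivity)]
      calc a * b ^ 4 * θ ^ 4 = a * (θ * b) ^ 4 := by ring
        _ ≤ a * a ^ 4 := by gcongr
        _ = a ^ 5 := by ring
    have h2 : 0 ≤ θ * b ^ 5 := by positivity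
    linarith

/-- Solutions with a large `y`-coordinate are rare. -/
theorem card_tail_le (m : ℕ) (hB : 1 ≤ B) (hΔ : DivisorBound M Δ) (hM : 8 * B ≤ M)
    (hρ : 0 < ρ) (hρ40 : ρ ^ 40 = 1 / 2) (J : ℕ) (i₀ : Fin (m + 5)) :
    (#{p ∈ Fintype.piFinset fun i : Fin (m + 5) => rectUnion B (if i = i₀ then J else 0) |
      ∑ i, sqCube (p i) = 0} : ℝ) ≤ 2 ^ 15 * 4 ^ m * Δ ^ (m + 9) * √B ^ (m + 3) * ρ ^ J := by
  have h1Δ := hΔ.1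
  obtain ⟨N, hN⟩ := exists_nat_gt (48 * B)
  have hNR : (0 : ℝ) < N := by linarith
  have hN0 : N ≠ 0 := by rintro rfl; simp at hNR
  set a : ℕ → ℝ := fun k => ‖expSum (rectUnion B J) sqCube (k / N)‖
  set b : ℕ → ℝ := fun k => ‖expSum (rectUnion B 0) sqCube (k / N)‖
  have h0 := card_piFinset_le_sum (fun i : Fin (m + 5) => rectUnion B (if i = i₀ then J else 0))
    (fun _ => sqCube) hN0
  have hprod : ∀ k : ℕ, ∏ i : Fin (m + 5),
      ‖expSum (rectUnion B (if i = i₀ then J else 0)) sqCube (k / N)‖ = a k * b k ^ (m + 4) := by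
    intro k
    rw [← mul_prod_erase univ _ (mem_univ i₀), if_pos rfl]
    congr 1
    rw [prod_congr rfl fun i hi => by rw [if_neg (ne_of_mem_erase hi)], prod_const,
      card_erase_of_mem (mem_univ _), card_univ, Fintype.card_fin]
    rfl
  have hpt : ∀ k ∈ range N, a k * b k ^ (m + 4) ≤
      (4 * Δ * √B) ^ m * (a k ^ 5 / (ρ ^ J) ^ 4 + ρ ^ J * b k ^ 5) := fun k _ => by
    calc a k * b k ^ (m + 4) = b k ^ m * (a k * b k ^ 4) := by ring
      _ ≤ (4 * Δ * √B) ^ m * (a k ^ 5 / (ρ ^ J) ^ 4 + ρ ^ J * b k ^ 5) := by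
        gcongr
        · exact (norm_expSum_le _ _ _).trans (card_rectUnion_le hB hΔ hM 0)
        · exact mul_pow_four_le (norm_nonneg _) (norm_nonneg _) (by positivity)
  have ha := fifth_moment_rectUnion_le hB hΔ hM hρ hρ40 J hN
  have hb := fifth_moment_rectUnion_le hB hΔ hM hρ hρ40 0 hN
  rw [mul_zero, pow_zero, mul_one] at hb
  refine le_of_mul_le_mul_left (h0.trans ?_) hNR
  simp_rw [hprod]
  refine (sum_le_sum hpt).trans ?_
  rw [← mul_sum, sum_add_distrib, ← sum_div, ← mul_sum]
  calc _ ≤ (4 * Δ * √B) ^ m * (N * (2 ^ 14 * Δ ^ 9 * √B ^ 3 * ρ ^ (5 * J)) / (ρ ^ J) ^ 4 +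
        ρ ^ J * (N * (2 ^ 14 * Δ ^ 9 * √B ^ 3))) := by gcongr
    _ = _ := by
        rw [mul_comm 5 J, pow_mul]
        field_simp
        ring

end Tail

theorem four_mul_abs_sub_round_le (θ : ℝ) : 4 * |θ - round θ| ≤ ‖1 - e θ‖ := by
  have h1 : e θ = e (θ - round θ) := by
    conv_lhs => rw [← sub_add_cancel θ (round θ : ℝ), e_add, e_int, mul_one]
  set φ := θ - round θ
  have hφ : |φ| ≤ 1 / 2 := abs_sub_round θ
  have h2 : ‖1 - e φ‖ = ‖2 * Real.sin (Real.pi * φ)‖ := by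
    rw [norm_sub_rev, e, show (2 * Real.pi * φ * Complex.I : ℂ) =
      Complex.I * ((2 * Real.pi * φ : ℝ) : ℂ) by push_cast; ring,
      Complex.norm_exp_I_mul_ofReal_sub_one]
    congr 3; ring
  have h3 := Real.mul_abs_le_abs_sin (x := Real.pi * φ) (by
    rw [abs_mul, abs_of_pos Real.pi_pos]; nlinarith [Real.pi_pos])
  rw [abs_mul, abs_of_pos Real.pi_pos] at h3
  rw [h1, h2, Real.norm_eq_abs, abs_mul, abs_two]
  have : 2 / Real.pi * (Real.pi * |φ|) = 2 * |φ| := by field_simp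
  linarith

theorem sum_Ico_e_mul_le (p r : ℤ) (c θ : ℝ) :
    ‖∑ y ∈ Ico p r, e (c + θ * y)‖ * ‖1 - e θ‖ ≤ 2 := by
  rcases le_or_gt p r with h | h
  · have key : (∑ y ∈ Ico p r, e (c + θ * y)) * (1 - e θ) = e (c + θ * p) - e (c + θ * r) := by
      induction r, h using Int.leInduction with
      | base => simp
      | succ n hn ih =>
        rw [← insert_Ico_right_eq_Ico_add_one hn, sum_insert (by simp), add_mul, ih]
        have : e (c + θ * ((n + 1 : ℤ) : ℝ)) = e (c + θ * n) * e θ := by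
          rw [← e_add]; push_cast; ring_nf
        rw [this]; ring
    rw [← norm_mul, key]
    refine (norm_sub_le _ _).trans ?_
    rw [norm_e, norm_e]; norm_num
  · rw [Ico_eq_empty (by omega)]; simp

theorem norm_sum_Ico_e_le (p r : ℤ) {H : ℕ} (hH : r - p ≤ H) (c θ : ℝ) {t : ℝ} (ht : 0 < t) :
    ‖∑ y ∈ Ico p r, e (c + θ * y)‖ ≤ (if |θ - round θ| ≤ t then (H : ℝ) else 0) + 1 / (2 * t) := by
  split_ifs with h
  · have : ‖∑ y ∈ Ico p r, e (c + θ * y)‖ ≤ H := by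
      refine (norm_sum_le _ _).trans ?_
      simp only [norm_e, sum_const, Int.card_Ico, nsmul_eq_mul, mul_one]
      exact_mod_cast Int.toNat_le.mpr hH
    have h2 : 0 ≤ 1 / (2 * t) := by positivity
    linarith
  · rw [zero_add, le_div_iff₀ (by positivity)]
    have h1 := sum_Ico_e_mul_le p r c θ
    have h2 := four_mul_abs_sub_round_le θ
    have h3 : 4 * t ≤ ‖1 - e θ‖ := by linarith [not_le.mp h]
    have h4 := mul_le_mul_of_nonneg_left h3 (norm_nonneg (∑ y ∈ Ico p r, e (c + θ * y)))
    linarith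

/-- Weyl differencing for a quadratic exponential sum over an interval. -/
theorem norm_sq_expSum_Ico_le (p : ℤ) (H : ℕ) (a : ℤ) (α : ℝ) {t : ℝ} (ht : 0 < t) :
    ‖expSum (Ico p (p + H)) (fun x => a * x ^ 2) α‖ ^ 2 ≤
      H * #{h ∈ Ioo (-H : ℤ) H | |((2 * a * h : ℤ) : ℝ) * α - round (((2 * a * h : ℤ) : ℝ) * α)| ≤ t}
        + H / t := by
  set I := Ico p (p + H) with hI
  have h0 : ‖expSum I (fun x => a * x ^ 2) α‖ ^ 2 ≤
      ∑ h ∈ Ioo (-H : ℤ) H, ‖∑ q ∈ I ×ˢ I with q.1 - q.2 = h,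
        e (((a * q.1 ^ 2 - a * q.2 ^ 2 : ℤ) : ℝ) * α)‖ := by
    have h1 := norm_expSum_sq I (fun x => a * x ^ 2) α
    have h2 : ‖expSum I (fun x => a * x ^ 2) α‖ ^ 2 =
        ‖expSum (I ×ˢ I) (fun p => a * p.1 ^ 2 - a * p.2 ^ 2) α‖ := by
      rw [← h1, Complex.norm_real, Real.norm_of_nonneg (by positivity)]
    rw [h2, expSum, ← sum_fiberwise_of_maps_to (s := I ×ˢ I) (t := Ioo (-H : ℤ) H)
      (g := fun q => q.1 - q.2)]
    · exact norm_sum_le _ _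
    · intro q hq
      simp only [hI, mem_product, mem_Ico] at hq
      rw [mem_Ioo]; omega
  have hfib : ∀ h ∈ Ioo (-H : ℤ) H, ‖∑ q ∈ I ×ˢ I with q.1 - q.2 = h,
        e (((a * q.1 ^ 2 - a * q.2 ^ 2 : ℤ) : ℝ) * α)‖ ≤
      (if |((2 * a * h : ℤ) : ℝ) * α - round (((2 * a * h : ℤ) : ℝ) * α)| ≤ t then (H : ℝ) else 0)
        + 1 / (2 * t) := by
    intro h _
    have : ∑ q ∈ I ×ˢ I with q.1 - q.2 = h, e (((a * q.1 ^ 2 - a * q.2 ^ 2 : ℤ) : ℝ) * α) =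
        ∑ y ∈ Ico (max p (p - h)) (min (p + H) (p + H - h)),
          e (((a * h ^ 2 : ℤ) : ℝ) * α + ((2 * a * h : ℤ) : ℝ) * α * y) := by
      refine sum_bij' (fun q _ => q.2) (fun y _ => (y + h, y)) ?_ ?_ ?_ ?_ ?_
      · rintro ⟨x, y⟩ hq
        simp only [hI, mem_filter, mem_product, mem_Ico] at hq ⊢
        omega
      · intro y hy
        simp only [hI, mem_filter, mem_product, mem_Ico] at hy ⊢
        omega
      · rintro ⟨x, y⟩ hq
        simp only [mem_filter] at hq
        ext <;> simp; omega
      · intro y _; rfl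
      · rintro ⟨x, y⟩ hq
        simp only [mem_filter] at hq
        obtain rfl : x = y + h := by omega
        push_cast; ring_nf
    rw [this]
    exact norm_sum_Ico_e_le _ _ (by omega) _ _ ht
  refine h0.trans ((sum_le_sum hfib).trans ?_)
  rw [sum_add_distrib, ← sum_filter, sum_const, sum_const, nsmul_eq_mul, nsmul_eq_mul, Int.card_Ioo,
    mul_comm (H : ℝ)]
  gcongr
  have : (((H : ℤ) - -H - 1).toNat : ℝ) ≤ 2 * H := by
    have : ((H : ℤ) - -H - 1).toNat ≤ 2 * H := by omega
    exact_mod_cast this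
  calc (((H : ℤ) - -H - 1).toNat : ℝ) * (1 / (2 * t)) ≤ 2 * H * (1 / (2 * t)) := by gcongr
    _ = H / t := by field_simp

theorem card_int_Icc_le (x y : ℝ) (hxy : x ≤ y) : (#(Icc ⌈x⌉ ⌊y⌋) : ℝ) ≤ y - x + 1 := by
  rw [Int.card_Icc]
  have h1 := Int.floor_le y
  have h2 := Int.le_ceil x
  have h3 : ((⌊y⌋ + 1 - ⌈x⌉).toNat : ℤ) = max (⌊y⌋ + 1 - ⌈x⌉) 0 := Int.toNat_eq_max _
  have h4 : ((⌊y⌋ + 1 - ⌈x⌉).toNat : ℝ) = max ((⌊y⌋ : ℝ) + 1 - ⌈x⌉) 0 := by exact_mod_cast h3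
  rw [h4]
  exact max_le (by linarith) (by linarith)

/-- A block of `q` consecutive multiples of `α` rarely comes close to an integer. -/
theorem card_block_le {r : ℚ} {α t : ℝ} (ht : 0 ≤ t) (hr : |α - r| * r.den ^ 2 ≤ 1) (c : ℝ) :
    (#{k ∈ range r.den | |c + (k : ℕ) * α - round (c + k * α)| ≤ t} : ℝ) ≤ 2 * r.den * t + 3 := by
  set q := r.den with hq
  have hq0 : (0 : ℝ) < q := by exact_mod_cast r.den_pos
  set u : ℕ → ℤ := fun k => k * r.num - q * round (c + k * α) with hu
  set S := {k ∈ range q | |c + (k : ℕ) * α - round (c + k * α)| ≤ t}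
  have hrq : (r : ℝ) * q = r.num := by exact_mod_cast Rat.mul_den_eq_num r
  have hmaps : Set.MapsTo u S (Icc ⌈-(q * c) - (q * t + 1)⌉ ⌊-(q * c) + (q * t + 1)⌋) := by
    intro k hk
    simp only [S, coe_filter, mem_range, Set.mem_ofPred_eq] at hk
    have hkq : (k : ℝ) ≤ q := by exact_mod_cast hk.1.le
    have e1 : (u k : ℝ) = -(q * c) + q * (c + k * α - round (c + k * α)) - k * q * (α - r) := by
      simp only [hu]; push_cast; rw [← hrq]; ring
    have e2 : |(k : ℝ) * q * (α - r)| ≤ 1 := by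
      rw [abs_mul, abs_of_nonneg (by positivity)]
      calc (k : ℝ) * q * |α - r| ≤ q * q * |α - r| := by gcongr
        _ = |α - r| * q ^ 2 := by ring
        _ ≤ 1 := hr
    have e3 : |q * (c + k * α - round (c + k * α))| ≤ q * t := by
      rw [abs_mul, abs_of_pos hq0]; gcongr; exact hk.2
    rw [abs_le] at e2 e3
    rw [coe_Icc, Set.mem_Icc, Int.ceil_le, Int.le_floor, e1]
    constructor <;> linarith [e2.1, e2.2, e3.1, e3.2]
  have hinj : Set.InjOn u S := by
    intro k hk l hl hkl
    simp only [S, coe_filter, mem_range, Set.mem_ofPred_eq] at hk hl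
    simp only [hu] at hkl
    have hdvd : (q : ℤ) ∣ ((k : ℤ) - l) * r.num :=
      ⟨round (c + k * α) - round (c + l * α), by linarith⟩
    have hcop : IsCoprime (q : ℤ) r.num := by
      rw [Int.isCoprime_iff_gcd_eq_one, Int.gcd_comm]
      exact r.reduced
    have h := hcop.dvd_of_dvd_mul_right hdvd
    have := Int.eq_zero_of_abs_lt_dvd h (by rw [abs_lt]; omega)
    omega
  have h1 : (#S : ℝ) ≤ #(Icc ⌈-(q * c) - (q * t + 1)⌉ ⌊-(q * c) + (q * t + 1)⌋) := by
    exact_mod_cast card_le_card_of_injOn u hmaps hinj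
  refine h1.trans ((card_int_Icc_le _ _ ?_).trans ?_)
  · have : 0 ≤ q * t := by positivity
    linarith
  · linarith

theorem card_near_int_le {r : ℚ} {α t : ℝ} (ht : 0 ≤ t) (hr : |α - r| * r.den ^ 2 ≤ 1) (M : ℕ) :
    (#{n ∈ Icc (-M : ℤ) M | |(n : ℤ) * α - round (n * α)| ≤ t} : ℝ) ≤
      ((2 * M + 1) / r.den + 1) * (2 * r.den * t + 3) := by
  set q := r.den with hq
  have hqpos : 0 < q := r.den_pos
  have hq0 : (0 : ℝ) < q := by exact_mod_cast hqpos
  set K := (2 * M) / q + 1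
  set S : ℕ → Finset ℕ := fun j => {k ∈ range q | |((-M + j * q : ℤ) : ℝ) * α + (k : ℕ) * α -
    round (((-M + j * q : ℤ) : ℝ) * α + k * α)| ≤ t}
  have hsub : {n ∈ Icc (-M : ℤ) M | |(n : ℤ) * α - round (n * α)| ≤ t} ⊆
      (range K).biUnion fun j => (S j).image fun k : ℕ => (-M + j * q + k : ℤ) := by
    intro n hn
    rw [mem_filter, mem_Icc] at hn
    obtain ⟨l, hl⟩ : ∃ l : ℕ, n = -M + l := ⟨(n + M).toNat, by omega⟩
    have hl2 : l ≤ 2 * M := by omega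
    have hn2 : n = -M + ((l / q : ℕ) : ℤ) * q + ((l % q : ℕ) : ℤ) := by
      have := Nat.div_add_mod l q
      rw [hl, add_assoc]; congr 1
      rw [mul_comm]; exact_mod_cast this.symm
    rw [mem_biUnion]
    refine ⟨l / q, mem_range.mpr (Nat.lt_succ_of_le (Nat.div_le_div_right hl2)), ?_⟩
    rw [mem_image]
    refine ⟨l % q, ?_, hn2.symm⟩
    rw [mem_filter, mem_range]
    refine ⟨Nat.mod_lt _ hqpos, ?_⟩
    have : ((-M + ((l / q : ℕ) : ℤ) * q : ℤ) : ℝ) * α + ((l % q : ℕ) : ℝ) * α = (n : ℝ) * α := by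
      rw [← add_mul, hn2, Int.cast_add (_ + _), Int.cast_natCast]
    rw [this]
    exact hn.2
  have h1 := (card_le_card hsub).trans card_biUnion_le
  have hK : (K : ℝ) ≤ (2 * M + 1) / q + 1 := by
    have h2 : ((2 * M / q : ℕ) : ℝ) ≤ (2 * M : ℕ) / q := Nat.cast_div_le
    have h3 : ((2 * M : ℕ) : ℝ) / q ≤ (2 * M + 1) / q := by
      push_cast; gcongr; linarith
    simp only [K]; push_cast at *; linarith
  calc (#{n ∈ Icc (-M : ℤ) M | |(n : ℤ) * α - round (n * α)| ≤ t} : ℝ)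
      ≤ ∑ j ∈ range K, (#((S j).image fun k : ℕ => (-M + j * q + k : ℤ)) : ℝ) := by
        exact_mod_cast h1
    _ ≤ ∑ j ∈ range K, (2 * q * t + 3) := by
        gcongr with j _
        exact (Nat.cast_le.mpr card_image_le).trans (card_block_le ht hr _)
    _ = K * (2 * q * t + 3) := by rw [sum_const, card_range, nsmul_eq_mul]
    _ ≤ _ := by gcongr

/-- The largest `X` with `|a| X² ≤ B`. -/
noncomputable def quadWidth (a : ℤ) (B : ℝ) : ℕ := ⌊√(B / |(a : ℝ)|)⌋₊

/-- The exponential sum over nonzero `x` with `|a x²| ≤ B` and phase `a x² α`. -/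
noncomputable def quadSum (a : ℤ) (B α : ℝ) : ℂ :=
  expSum (nonzeroBox (quadWidth a B)) (fun x => a * x ^ 2) α

theorem one_le_abs_cast {a : ℤ} (ha : a ≠ 0) : 1 ≤ |(a : ℝ)| := by
  exact_mod_cast Int.one_le_abs ha

theorem quadWidth_le {a : ℤ} (ha : a ≠ 0) {B : ℝ} (hB : 0 ≤ B) : (quadWidth a B : ℝ) ≤ √B := by
  refine (Nat.floor_le (Real.sqrt_nonneg _)).trans (Real.sqrt_le_sqrt ?_)
  exact div_le_self hB (one_le_abs_cast ha)

theorem mem_nonzeroBox_quadWidth {a : ℤ} (ha : a ≠ 0) {B : ℝ} {x : ℤ} :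
    x ∈ nonzeroBox (quadWidth a B) ↔ x ≠ 0 ∧ |(a : ℝ) * x ^ 2| ≤ B := by
  have h1 := one_le_abs_cast ha
  rw [mem_nonzeroBox, quadWidth, Int.abs_eq_natAbs, Nat.cast_le]
  refine and_congr_right fun hx => ?_
  rw [Nat.le_floor_iff (Real.sqrt_nonneg _), Nat.cast_natAbs, Int.cast_abs,
    Real.le_sqrt' (abs_pos.mpr (by exact_mod_cast hx)), le_div_iff₀ (by linarith), abs_mul, abs_pow,
    mul_comm]

theorem norm_quadSum_le {a : ℤ} (ha : a ≠ 0) {B : ℝ} (hB : 0 ≤ B) (α : ℝ) :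
    ‖quadSum a B α‖ ≤ 2 * √B := by
  refine (norm_expSum_le _ _ _).trans ?_
  rw [card_nonzeroBox]
  push_cast
  linarith [quadWidth_le ha hB]

theorem norm_quadSum_sq_le_of_minor {a : ℤ} (ha : a ≠ 0) {A : ℝ} (hA : |(a : ℝ)| ≤ A) {Q : ℕ}
    (hQ : 1 ≤ Q) {B : ℝ} (hB : (Q : ℝ) ^ 4 ≤ B) {α : ℝ} {r : ℚ}
    (hr : |α - r| * r.den ^ 2 ≤ 1) (hQr : Q < r.den) (hrB : (r.den : ℝ) * Q ^ 2 ≤ B) :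
    ‖quadSum a B α‖ ^ 2 ≤ 308 * A * B / Q := by
  have hA1 : 1 ≤ A := (one_le_abs_cast ha).trans hA
  have hQ1 : (1 : ℝ) ≤ Q := by exact_mod_cast hQ
  have hB0 : 0 ≤ B := le_trans (by positivity) hB
  set b := √B with hb
  have hbB : b ^ 2 = B := Real.sq_sqrt hB0
  have hbQ : (Q : ℝ) ^ 2 ≤ b := Real.le_sqrt_of_sq_le (by linarith [show ((Q : ℝ) ^ 2) ^ 2 = Q ^ 4 by ring])
  have hb1 : 1 ≤ b := le_trans (one_le_pow₀ hQ1) hbQ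
  have hbpos : 0 < b := by linarith
  have hQpos : (0 : ℝ) < Q := by linarith
  set X := quadWidth a B with hX
  have hXb : (X : ℝ) ≤ b := quadWidth_le ha hB0
  set t := (Q : ℝ) / b with ht
  have htpos : 0 < t := by positivity
  set q := r.den with hq
  have hqQ : (Q : ℝ) ≤ q := by exact_mod_cast hQr.le
  have hqpos : (0 : ℝ) < q := by linarith
  have hqt : q * t ≤ b / Q := by
    rw [ht, le_div_iff₀ hQpos, mul_div_assoc', div_mul_eq_mul_div, div_le_iff₀ hbpos]
    nlinarith
  have hbQ' : (Q : ℝ) ≤ b / Q := by rw [le_div_iff₀ hQpos]; nlinarith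
  set S := expSum (Ico (-X : ℤ) (-X + (2 * X + 1 : ℕ))) (fun x => a * x ^ 2) α with hS
  have hTS : ‖quadSum a B α‖ ≤ 1 + ‖S‖ := by
    have : S = quadSum a B α + 1 := by
      have h0 : Ico (-X : ℤ) (-X + (2 * X + 1 : ℕ)) = Icc (-X : ℤ) X := by
        ext x; simp only [mem_Ico, mem_Icc]; omega
      rw [hS, h0, quadSum, expSum, expSum, nonzeroBox, sum_erase_eq_sub (by simp), ← hX]
      simp
    have h1 : quadSum a B α = S - 1 := by rw [this]; ring
    rw [h1]
    refine (norm_sub_le _ _).trans ?_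
    rw [norm_one]; linarith
  have hcount : (#{h ∈ Ioo (-(2 * X + 1 : ℕ) : ℤ) (2 * X + 1 : ℕ) |
      |((2 * a * h : ℤ) : ℝ) * α - round (((2 * a * h : ℤ) : ℝ) * α)| ≤ t} : ℝ) ≤
      50 * A * (b / Q) := by
    have h1 := card_near_int_le htpos.le hr (4 * a.natAbs * X)
    have h2 : #{h ∈ Ioo (-(2 * X + 1 : ℕ) : ℤ) (2 * X + 1 : ℕ) |
        |((2 * a * h : ℤ) : ℝ) * α - round (((2 * a * h : ℤ) : ℝ) * α)| ≤ t} ≤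
        #{n ∈ Icc (-(4 * a.natAbs * X : ℕ) : ℤ) (4 * a.natAbs * X : ℕ) |
          |(n : ℤ) * α - round (n * α)| ≤ t} := by
      refine card_le_card_of_injOn (fun h => 2 * a * h) ?_ ?_
      · intro h hh
        simp only [coe_filter, mem_Ioo, mem_Icc, Set.mem_ofPred_eq] at hh ⊢
        refine ⟨abs_le.mp ?_, hh.2⟩
        have h3 : |h| ≤ 2 * X := abs_le.mpr (by omega)
        push_cast
        rw [abs_mul, abs_mul, abs_two]
        calc 2 * |a| * |h| ≤ 2 * |a| * (2 * X) := by gcongr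
          _ = 4 * |a| * X := by ring
      · intro h _ k _ hhk
        exact mul_left_cancel₀ (mul_ne_zero two_ne_zero ha) hhk
    have h4 : ((4 * a.natAbs * X : ℕ) : ℝ) ≤ 4 * A * b := by
      push_cast
      rw [Nat.cast_natAbs, Int.cast_abs]
      gcongr
    refine (Nat.cast_le.mpr h2).trans (h1.trans ?_)
    have hAb : 1 ≤ A * b := one_le_mul_of_one_le_of_one_le hA1 hb1
    have h5 : (2 * ((4 * a.natAbs * X : ℕ) : ℝ) + 1) / q + 1 ≤ 9 * A * b / q + 1 := by
      gcongr; linarith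
    have h6 : A * b / q ≤ A * (b / Q) := by rw [mul_div_assoc]; gcongr
    calc _ ≤ (9 * A * b / q + 1) * (2 * q * t + 3) := by gcongr
      _ = 18 * A * (b * t) + 27 * (A * b / q) + 2 * (q * t) + 3 := by field_simp; ring
      _ ≤ 18 * A * (b / Q) + 27 * (A * (b / Q)) + 2 * (A * (b / Q)) + 3 * (A * (b / Q)) := by
        have h7 : A * (b * t) ≤ A * (b / Q) := by
          rw [ht, mul_div_cancel₀ _ hbpos.ne']; gcongr
        have h8 : b / Q ≤ A * (b / Q) := le_mul_of_one_le_left (by positivity) hA1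
        have h9 : 1 ≤ A * (b / Q) := by linarith
        linarith
      _ = _ := by ring
  have hSb : ‖S‖ ^ 2 ≤ 153 * A * B / Q := by
    refine (norm_sq_expSum_Ico_le (-X) (2 * X + 1) a α htpos).trans ?_
    have hH : ((2 * X + 1 : ℕ) : ℝ) ≤ 3 * b := by push_cast; linarith
    calc _ ≤ 3 * b * (50 * A * (b / Q)) + 3 * b / t := by gcongr
      _ = 150 * A * (b ^ 2 / Q) + 3 * 1 * (b ^ 2 / Q) := by
        have : 3 * b / t = 3 * (b ^ 2 / Q) := by rw [ht]; field_simp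
        rw [this]; ring
      _ ≤ 150 * A * (b ^ 2 / Q) + 3 * A * (b ^ 2 / Q) := by gcongr
      _ = _ := by rw [hbB]; ring
  have h1 : 1 ≤ A * B / Q := by
    rw [le_div_iff₀ hQpos, one_mul, ← hbB]
    calc (Q : ℝ) ≤ Q ^ 2 := by nlinarith
      _ ≤ b := hbQ
      _ ≤ b ^ 2 := by nlinarith
      _ ≤ A * b ^ 2 := le_mul_of_one_le_left (by positivity) hA1
  have h2 : ‖quadSum a B α‖ ^ 2 ≤ (1 + ‖S‖) ^ 2 := by gcongr
  have h3 : (1 + ‖S‖) ^ 2 ≤ 2 + 2 * ‖S‖ ^ 2 := by nlinarith [sq_nonneg (1 - ‖S‖)]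
  calc ‖quadSum a B α‖ ^ 2 ≤ 2 + 2 * ‖S‖ ^ 2 := h2.trans h3
    _ ≤ 2 * (A * B / Q) + 2 * (153 * A * B / Q) := by linarith
    _ = _ := by ring

theorem norm_e_sub_e_le (s t : ℝ) : ‖e s - e t‖ ≤ 2 * Real.pi * |s - t| := by
  have h1 : e s - e t = e t * (e (s - t) - 1) := by
    rw [mul_sub, ← e_add, mul_one]; ring_nf
  rw [h1, norm_mul, norm_e, one_mul, e, show (2 * Real.pi * ((s - t : ℝ) : ℂ) * Complex.I : ℂ) =
      Complex.I * ((2 * Real.pi * (s - t) : ℝ) : ℂ) by push_cast; ring]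
  refine Real.norm_exp_I_mul_ofReal_sub_one_le.trans ?_
  rw [Real.norm_eq_abs, abs_mul, abs_of_pos Real.two_pi_pos]

theorem norm_sum_range_sub_shift_le {F : ℕ → ℂ} (hF : ∀ x, ‖F x‖ ≤ 1) (X k : ℕ) :
    ‖∑ x ∈ range X, F x - ∑ x ∈ range X, F (x + k)‖ ≤ 2 * k := by
  have h1 := sum_range_add F X k
  have h2 := sum_range_add F k X
  rw [add_comm k X] at h2
  have h3 : ∑ x ∈ range X, F x - ∑ x ∈ range X, F (x + k) =
      ∑ x ∈ range k, F x - ∑ x ∈ range k, F (X + x) := by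
    simp_rw [add_comm _ k]
    linear_combination h2 - h1
  have h4 : ∀ G : ℕ → ℂ, (∀ x, ‖G x‖ ≤ 1) → ‖∑ x ∈ range k, G x‖ ≤ k := fun G hG => by
    refine (norm_sum_le _ _).trans ((sum_le_sum fun x _ => hG x).trans ?_)
    simp
  rw [h3]
  refine (norm_sub_le _ _).trans ?_
  linarith [h4 F hF, h4 (fun x => F (X + x)) fun x => hF _]

theorem sum_range_periodic {c : ℕ → ℂ} {q : ℕ} (hc : ∀ x, c (x + q) = c x) (x : ℕ) :
    ∑ k ∈ range q, c (x + k) = ∑ k ∈ range q, c k := by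
  induction x with
  | zero => simp
  | succ x ih =>
    rw [← ih]
    have h1 := sum_range_succ (fun k => c (x + k)) q
    have h2 := sum_range_succ' (fun k => c (x + k)) q
    rw [h1, hc, add_zero] at h2
    have h3 := add_right_cancel h2
    rw [h3]
    exact sum_congr rfl fun k _ => by congr 1; ring

/-- Comparison of a sum twisted by a periodic weight with the corresponding integral. -/
theorem norm_sum_periodic_mul_sub_le {c : ℕ → ℂ} {q : ℕ} (hq : 0 < q) (hper : ∀ x, c (x + q) = c x)
    (hc : ∀ x, ‖c x‖ ≤ 1) {f : ℝ → ℂ} (hf : Continuous f) (hf1 : ∀ v, ‖f v‖ ≤ 1) {X : ℕ} {E : ℝ}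
    (hE : ∀ x < X, ∀ k < q, ∀ v : ℝ, x ≤ v → v ≤ x + 1 → ‖f ((x + k : ℕ) : ℝ) - f v‖ ≤ E) :
    ‖∑ x ∈ range X, c x * f x - (∑ k ∈ range q, c k) / q * ∫ v in (0 : ℝ)..X, f v‖ ≤
      2 * q + X * E := by
  have hqR : (0 : ℝ) < q := by exact_mod_cast hq
  have hqC : (q : ℂ) ≠ 0 := by exact_mod_cast hq.ne'
  set S := ∑ x ∈ range X, c x * f x with hS
  have hint : ∫ v in (0 : ℝ)..X, f v = ∑ x ∈ range X, ∫ v in (x : ℝ)..((x + 1 : ℕ) : ℝ), f v := by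
    rw [intervalIntegral.sum_integral_adjacent_intervals fun k _ => hf.intervalIntegrable _ _]
    simp
  have h1 : ∀ k ∈ range q, ‖S - ∑ x ∈ range X, c (x + k) * f ((x + k : ℕ) : ℝ)‖ ≤ 2 * q := by
    intro k hk
    refine (norm_sum_range_sub_shift_le (F := fun x => c x * f x) (fun x => ?_) X k).trans ?_
    · rw [norm_mul]; exact mul_le_one₀ (hc x) (norm_nonneg _) (hf1 _)
    · have := (mem_range.mp hk).le
      gcongr
  have h2 : ∀ x ∈ range X, ∀ k ∈ range q,
      ‖c (x + k) * (f ((x + k : ℕ) : ℝ) - ∫ v in (x : ℝ)..((x + 1 : ℕ) : ℝ), f v)‖ ≤ E := by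
    intro x hx k hk
    have h3 : f ((x + k : ℕ) : ℝ) - ∫ v in (x : ℝ)..((x + 1 : ℕ) : ℝ), f v =
        ∫ v in (x : ℝ)..((x + 1 : ℕ) : ℝ), (f ((x + k : ℕ) : ℝ) - f v) := by
      rw [intervalIntegral.integral_sub (by simp) (hf.intervalIntegrable _ _),
        intervalIntegral.integral_const]
      simp
    have h4 : ‖∫ v in (x : ℝ)..((x + 1 : ℕ) : ℝ), (f ((x + k : ℕ) : ℝ) - f v)‖ ≤ E := by
      refine (intervalIntegral.norm_integral_le_of_norm_le_const (C := E) fun v hv => ?_).trans ?_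
      · rw [Set.uIoc_of_le (by push_cast; linarith)] at hv
        refine hE x (mem_range.mp hx) k (mem_range.mp hk) v hv.1.le ?_
        have := hv.2; push_cast at this; exact this
      · push_cast; simp
    rw [norm_mul, h3]
    exact (mul_le_of_le_one_left (norm_nonneg _) (hc _)).trans h4
  have key : q * (S - (∑ k ∈ range q, c k) / q * ∫ v in (0 : ℝ)..X, f v) =
      ∑ k ∈ range q, (S - ∑ x ∈ range X, c (x + k) * f ((x + k : ℕ) : ℝ)) +
      ∑ x ∈ range X, ∑ k ∈ range q,
        c (x + k) * (f ((x + k : ℕ) : ℝ) - ∫ v in (x : ℝ)..((x + 1 : ℕ) : ℝ), f v) := by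
    simp only [mul_sub, sum_sub_distrib, sum_const, card_range, nsmul_eq_mul]
    rw [sum_comm (s := range q)]
    have : ∑ x ∈ range X, ∑ k ∈ range q, c (x + k) * ∫ v in (x : ℝ)..((x + 1 : ℕ) : ℝ), f v =
        (∑ k ∈ range q, c k) * ∫ v in (0 : ℝ)..X, f v := by
      rw [hint, mul_sum]
      refine sum_congr rfl fun x _ => ?_
      rw [← sum_mul, sum_range_periodic hper]
    rw [this]
    field_simp
    ring
  have h5 : q * ‖S - (∑ k ∈ range q, c k) / q * ∫ v in (0 : ℝ)..X, f v‖ ≤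
      q * (2 * q + X * E) := by
    have h6 : (q : ℝ) * ‖S - (∑ k ∈ range q, c k) / q * ∫ v in (0 : ℝ)..X, f v‖ =
        ‖q * (S - (∑ k ∈ range q, c k) / q * ∫ v in (0 : ℝ)..X, f v)‖ := by
      rw [norm_mul, Complex.norm_natCast]
    rw [h6, key]
    refine (norm_add_le _ _).trans ?_
    have h7 := (norm_sum_le _ _).trans (sum_le_sum h1)
    have h8 := (norm_sum_le (range X) fun x => ∑ k ∈ range q,
        c (x + k) * (f ((x + k : ℕ) : ℝ) - ∫ v in (x : ℝ)..((x + 1 : ℕ) : ℝ), f v)).trans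
      (sum_le_sum fun x hx => (norm_sum_le _ _).trans (sum_le_sum (h2 x hx)))
    simp only [sum_const, card_range, nsmul_eq_mul] at h7 h8
    linarith
  exact le_of_mul_le_mul_left h5 hqR

theorem sum_nonzeroBox_even {g : ℤ → ℂ} (hg : ∀ x, g (-x) = g x) (X : ℕ) :
    ∑ x ∈ nonzeroBox X, g x = 2 * ∑ x ∈ range X, g x - 2 * g 0 + 2 * g X := by
  induction X with
  | zero => simp [nonzeroBox]
  | succ X ih =>
    have h : nonzeroBox (X + 1) = insert ((X : ℤ) + 1) (insert (-((X : ℤ) + 1)) (nonzeroBox X)) := by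
      ext x
      simp only [mem_nonzeroBox, mem_insert, abs_le]
      push_cast
      omega
    rw [h, sum_insert, sum_insert, ih, hg, sum_range_succ]
    · push_cast; ring
    · simp [mem_nonzeroBox, abs_le]
    · simp only [mem_insert, mem_nonzeroBox, abs_le]; omega

/-- The mean value of the quadratic phase `a r k²` over a period. -/
noncomputable def gaussMean (a : ℤ) (r : ℚ) : ℂ :=
  (∑ k ∈ range r.den, e (a * r * (k : ℝ) ^ 2)) / r.den

/-- The oscillatory integral of the phase `a γ u²` over `0 ≤ u ≤ |a| ^ (-1/2)`. -/
noncomputable def quadIntegral (a : ℤ) (γ : ℝ) : ℂ :=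
  ∫ u in (0 : ℝ)..1 / √|(a : ℝ)|, e (a * γ * u ^ 2)

/-- The local approximation to `quadSum` near a rational number, normalised by `√B`. -/
noncomputable def quadLocal (a : ℤ) (r : ℚ) (γ : ℝ) : ℂ := 2 * gaussMean a r * quadIntegral a γ

theorem norm_gaussMean_le (a : ℤ) (r : ℚ) : ‖gaussMean a r‖ ≤ 1 := by
  rw [gaussMean, norm_div, Complex.norm_natCast]
  refine div_le_one_of_le₀ ((norm_sum_le _ _).trans ?_) (by positivity)
  simp

theorem norm_quadIntegral_le {a : ℤ} (ha : a ≠ 0) (γ : ℝ) : ‖quadIntegral a γ‖ ≤ 1 := by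
  have h1 : 1 ≤ √|(a : ℝ)| := Real.one_le_sqrt.mpr (one_le_abs_cast ha)
  refine (intervalIntegral.norm_integral_le_of_norm_le_const (C := 1) fun v _ => by simp).trans ?_
  rw [sub_zero, one_mul, abs_of_nonneg (by positivity)]
  exact div_le_one_of_le₀ h1 (by positivity)

theorem norm_quadLocal_le {a : ℤ} (ha : a ≠ 0) (r : ℚ) (γ : ℝ) : ‖quadLocal a r γ‖ ≤ 2 := by
  rw [quadLocal, norm_mul, norm_mul, Complex.norm_ofNat]
  have h1 := norm_gaussMean_le a r
  have h2 := norm_quadIntegral_le ha γ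
  calc 2 * ‖gaussMean a r‖ * ‖quadIntegral a γ‖ ≤ 2 * 1 * 1 := by gcongr
    _ = 2 := by norm_num

theorem continuous_quadIntegral (a : ℤ) : Continuous (quadIntegral a) := by
  refine intervalIntegral.continuous_parametric_intervalIntegral_of_continuous' ?_ _ _
  exact continuous_e.comp (by fun_prop)

theorem norm_quadSum_sub_le {a : ℤ} (ha : a ≠ 0) {A : ℝ} (hA : |(a : ℝ)| ≤ A) {Q : ℕ} {r : ℚ}
    (hr : r.den ≤ Q) {B β : ℝ} (hβ : |β| * B ≤ (Q : ℝ) ^ 2) (hB : A * (Q : ℝ) ^ 2 ≤ B) :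
    ‖quadSum a B (r + β) - √B * quadLocal a r (β * B)‖ ≤ 48 * (Q : ℝ) ^ 3 := by
  have ha1 := one_le_abs_cast ha
  have haA : 0 < |(a : ℝ)| := by linarith
  set q := r.den with hq
  have hqpos : 0 < q := r.den_pos
  have hqR : (1 : ℝ) ≤ q := by exact_mod_cast hqpos
  have hqQ : (q : ℝ) ≤ Q := by exact_mod_cast hr
  have hQ1 : (1 : ℝ) ≤ Q := hqR.trans hqQ
  have hB0 : 0 ≤ B := le_trans (mul_nonneg (haA.le.trans hA) (by positivity)) hB
  set Y := √(B / |(a : ℝ)|) with hY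
  set X := quadWidth a B with hX
  have hXY : (X : ℝ) ≤ Y := Nat.floor_le (Real.sqrt_nonneg _)
  have hYX : Y < X + 1 := Nat.lt_floor_add_one _
  have hY0 : 0 ≤ Y := Real.sqrt_nonneg _
  have hYsq : |(a : ℝ)| * Y ^ 2 = B := by
    rw [hY, Real.sq_sqrt (by positivity)]; field_simp
  have hQY : (Q : ℝ) ≤ Y := by
    refine Real.le_sqrt_of_sq_le ?_
    rw [le_div_iff₀ haA]
    refine le_trans ?_ hB
    rw [mul_comm]; gcongr
  set c : ℕ → ℂ := fun x => e (a * r * (x : ℝ) ^ 2) with hc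
  set f : ℝ → ℂ := fun v => e (a * β * v ^ 2) with hf
  have hrq : (r : ℝ) * q = r.num := by exact_mod_cast Rat.mul_den_eq_num r
  have hper : ∀ x, c (x + q) = c x := by
    intro x
    have : (a : ℝ) * r * ((x + q : ℕ) : ℝ) ^ 2 =
        a * r * (x : ℝ) ^ 2 + ((a * r.num * (2 * x + q) : ℤ) : ℝ) := by
      push_cast; rw [← hrq]; ring
    simp only [hc]
    rw [this, e_add, e_int, mul_one]
  have hfcont : Continuous f := continuous_e.comp (by fun_prop)
  have hE : ∀ x < X, ∀ k < q, ∀ v : ℝ, x ≤ v → v ≤ x + 1 →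
      ‖f ((x + k : ℕ) : ℝ) - f v‖ ≤ 2 * Real.pi * (|(a : ℝ)| * |β| * (q * (3 * Y))) := by
    intro x hx k hk v hv1 hv2
    refine (norm_e_sub_e_le _ _).trans ?_
    gcongr
    have hk' : (k : ℝ) + 1 ≤ q := by exact_mod_cast hk
    have hx' : (x : ℝ) + 1 ≤ X := by exact_mod_cast hx
    have hk0 : (0 : ℝ) ≤ k := by positivity
    have hx0 : (0 : ℝ) ≤ x := by positivity
    have : (a : ℝ) * β * ((x + k : ℕ) : ℝ) ^ 2 - a * β * v ^ 2 =
        a * β * ((x + k - v) * (x + k + v)) := by push_cast; ring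
    rw [this, abs_mul, abs_mul, abs_mul]
    gcongr
    · rw [abs_le]; constructor <;> linarith
    · rw [abs_le]; constructor <;> linarith
  have hmain := norm_sum_periodic_mul_sub_le hqpos hper (fun x => by simp [hc]) hfcont
    (fun v => by simp [hf]) hE
  have hXE : X * (2 * Real.pi * (|(a : ℝ)| * |β| * (q * (3 * Y)))) ≤ 19 * (Q : ℝ) ^ 3 := by
    calc X * (2 * Real.pi * (|(a : ℝ)| * |β| * (q * (3 * Y))))
        ≤ Y * (2 * 3.15 * (|(a : ℝ)| * |β| * (Q * (3 * Y)))) := by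
          gcongr
          exact Real.pi_lt_d2.le
      _ = 18.9 * (|β| * (|(a : ℝ)| * Y ^ 2)) * Q := by ring
      _ ≤ 19 * Q ^ 2 * Q := by rw [hYsq]; gcongr; norm_num
      _ = _ := by ring
  have hT : quadSum a B (r + β) = 2 * ∑ x ∈ range X, c x * f x - 2 +
      2 * e (((a * (X : ℤ) ^ 2 : ℤ) : ℝ) * (r + β)) := by
    have := sum_nonzeroBox_even (g := fun x => e (((a * x ^ 2 : ℤ) : ℝ) * (r + β)))
      (fun x => by rw [neg_sq]) X
    rw [quadSum, expSum, this]
    have h2 : ∀ x : ℕ, e (((a * (x : ℤ) ^ 2 : ℤ) : ℝ) * (r + β)) = c x * f x := fun x => by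
      simp only [hc, hf]
      rw [← e_add]; push_cast; ring_nf
    simp only [h2]
    simp
  have hI : (√B : ℂ) * quadIntegral a (β * B) = ∫ v in (0 : ℝ)..Y, f v := by
    have h1 := intervalIntegral.smul_integral_comp_mul_left (a := 0) (b := 1 / √|(a : ℝ)|) f (√B)
    have h2 : √B * (1 / √|(a : ℝ)|) = Y := by
      rw [hY, Real.sqrt_div hB0]; ring
    rw [mul_zero, h2] at h1
    rw [← h1, quadIntegral, Complex.real_smul]
    congr 1
    refine intervalIntegral.integral_congr fun u _ => ?_
    simp only [hf]
    rw [mul_pow, Real.sq_sqrt hB0]; ring_nf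
  have hdiff : ‖(∫ v in (0 : ℝ)..X, f v) - ∫ v in (0 : ℝ)..Y, f v‖ ≤ 1 := by
    rw [intervalIntegral.integral_interval_sub_left (hfcont.intervalIntegrable _ _)
      (hfcont.intervalIntegrable _ _)]
    refine (intervalIntegral.norm_integral_le_of_norm_le_const (C := 1) fun v _ => by
      simp [hf]).trans ?_
    rw [one_mul, abs_le]; constructor <;> linarith
  have hsplit : quadSum a B (r + β) - √B * quadLocal a r (β * B) =
      2 * (∑ x ∈ range X, c x * f x - (∑ k ∈ range q, c k) / q * ∫ v in (0 : ℝ)..X, f v) +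
      (-2 + 2 * e (((a * (X : ℤ) ^ 2 : ℤ) : ℝ) * (r + β))) +
      2 * gaussMean a r * ((∫ v in (0 : ℝ)..X, f v) - ∫ v in (0 : ℝ)..Y, f v) := by
    have h1 : gaussMean a r = (∑ k ∈ range q, c k) / q := rfl
    rw [hT, quadLocal, ← hI, ← h1]; ring
  have hg := norm_gaussMean_le a r
  rw [hsplit]
  refine (norm_add_le _ _).trans ((add_le_add (norm_add_le _ _) le_rfl).trans ?_)
  have n1 : ‖2 * (∑ x ∈ range X, c x * f x -
      (∑ k ∈ range q, c k) / q * ∫ v in (0 : ℝ)..X, f v)‖ ≤ 2 * (2 * Q + 19 * (Q : ℝ) ^ 3) := by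
    rw [norm_mul, Complex.norm_ofNat]
    gcongr
    linarith
  have n2 : ‖-2 + 2 * e (((a * (X : ℤ) ^ 2 : ℤ) : ℝ) * (r + β))‖ ≤ 4 := by
    refine (norm_add_le _ _).trans ?_
    rw [norm_neg, norm_mul, norm_e, Complex.norm_ofNat]; norm_num
  have n3 : ‖2 * gaussMean a r * ((∫ v in (0 : ℝ)..X, f v) - ∫ v in (0 : ℝ)..Y, f v)‖ ≤ 2 := by
    rw [norm_mul, norm_mul, Complex.norm_ofNat]
    calc _ ≤ 2 * (1 : ℝ) * 1 := by gcongr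
      _ = 2 := by norm_num
  have n4 : (Q : ℝ) ≤ Q ^ 3 := le_self_pow₀ hQ1 (by norm_num)
  have n5 : (1 : ℝ) ≤ Q ^ 3 := one_le_pow₀ hQ1
  linarith

/-- The number of solutions of `∑ aᵢ xᵢ² = 0` in nonzero integers with `|aᵢ xᵢ²| ≤ B`. -/
noncomputable def quadCount {k : ℕ} (a : Fin k → ℤ) (B : ℝ) : ℕ :=
  #{x ∈ Fintype.piFinset fun i => nonzeroBox (quadWidth (a i) B) | ∑ i, a i * x i ^ 2 = 0}

theorem integral_prod_quadSum {k : ℕ} (a : Fin k → ℤ) (B c : ℝ) :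
    ∫ α in c..(c + 1), ∏ i, quadSum (a i) B α = quadCount a B := by
  simp only [quadSum, prod_expSum]
  exact integral_expSum _ _ c

theorem continuous_quadSum (a : ℤ) (B : ℝ) : Continuous (quadSum a B) := continuous_expSum _ _

theorem integral_quadSum_pow_four_le {a : ℤ} (ha : a ≠ 0) {B Δ : ℝ} {M : ℕ}
    (hΔ : DivisorBound M Δ) (hM : quadWidth a B ^ 2 ≤ M) (c : ℝ) :
    ∫ α in c..(c + 1), ‖quadSum a B α‖ ^ 4 ≤ 48 * Δ * (quadWidth a B : ℝ) ^ 2 := by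
  set X := quadWidth a B with hX
  have h0 : ∫ α in c..(c + 1), ‖quadSum a B α‖ ^ 4 = energy (nonzeroBox X) (fun x => x ^ 2) 0 := by
    simp only [quadSum]
    rw [integral_norm_expSum_pow_four, ← energy_zero_mul_right _ (fun x => x ^ 2) ha]
    simp only [mul_comm a]
    rfl
  rw [h0]
  rcases Nat.eq_zero_or_pos X with h | h
  · rw [h]; simp [nonzeroBox, energy]
  · have hX0 : (0 : ℝ) < X := by exact_mod_cast h
    have h1 := energy_sq_le h (q := X ^ 2) (Nat.one_le_pow _ _ h) hΔ hM
    have h2 : (energy (nonzeroBox X) (fun x => x ^ 2) 0 : ℝ) ≤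
        energy (nonzeroBox X) (fun x => x ^ 2) (X ^ 2) := by exact_mod_cast energy_zero_le _ _ _
    refine (h2.trans h1).trans (le_of_eq ?_)
    push_cast
    field_simp
    ring

theorem prod_le_pow_mul_sum_pow_four {k : ℕ} {b : Fin (k + 4) → ℝ} {R : ℝ} (hb0 : ∀ i, 0 ≤ b i)
    (hb : ∀ i, b i ≤ R) : ∏ i, b i ≤ R ^ k * ∑ i, b i ^ 4 := by
  obtain ⟨j, -, hj⟩ := exists_max_image univ b univ_nonempty
  calc ∏ i, b i ≤ ∏ _i : Fin (k + 4), b j := prod_le_prod (fun i _ => hb0 i) hj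
    _ = b j ^ k * b j ^ 4 := by rw [prod_const, card_univ, Fintype.card_fin, pow_add]
    _ ≤ R ^ k * ∑ i, b i ^ 4 := by
      have h1 := single_le_sum (f := fun i => b i ^ 4) (fun i _ => pow_nonneg (hb0 i) 4) (mem_univ j)
      have h2 := hb0 j
      have h3 := hb j
      have h4 := h2.trans h3
      gcongr

theorem integral_prod_norm_quadSum_le {k : ℕ} {a : Fin (k + 4) → ℤ} (ha : ∀ i, a i ≠ 0)
    {B Δ R : ℝ} {M : ℕ} (hΔ : DivisorBound M Δ) (hM : ∀ i, quadWidth (a i) B ^ 2 ≤ M)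
    (hR : ∀ i, (quadWidth (a i) B : ℝ) ≤ R) (c : ℝ) :
    ∫ α in c..(c + 1), ∏ i, ‖quadSum (a i) B α‖ ≤ 48 * (k + 4) * 2 ^ k * Δ * R ^ (k + 2) := by
  have hR0 : 0 ≤ R := (Nat.cast_nonneg _).trans (hR 0)
  have h1Δ := hΔ.1
  have hcont : ∀ i, Continuous fun α => ‖quadSum (a i) B α‖ := fun i =>
    (continuous_quadSum _ _).norm
  have hpt : ∀ α, ∏ i, ‖quadSum (a i) B α‖ ≤ (2 * R) ^ k * ∑ i, ‖quadSum (a i) B α‖ ^ 4 := fun α =>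
    prod_le_pow_mul_sum_pow_four (fun i => norm_nonneg _) fun i => by
      refine (norm_expSum_le _ _ _).trans ?_
      rw [card_nonzeroBox]
      push_cast
      linarith [hR i]
  calc ∫ α in c..(c + 1), ∏ i, ‖quadSum (a i) B α‖
      ≤ ∫ α in c..(c + 1), (2 * R) ^ k * ∑ i, ‖quadSum (a i) B α‖ ^ 4 := by
        refine intervalIntegral.integral_mono (by linarith) ?_ ?_ hpt
        · exact (continuous_finsetProd _ fun i _ => hcont i).intervalIntegrable _ _
        · exact (continuous_const.mul
            (continuous_finsetSum _ fun i _ => (hcont i).pow 4)).intervalIntegrable _ _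
    _ = (2 * R) ^ k * ∑ i, ∫ α in c..(c + 1), ‖quadSum (a i) B α‖ ^ 4 := by
        rw [intervalIntegral.integral_const_mul, intervalIntegral.integral_finsetSum]
        exact fun i _ => ((hcont i).pow 4).intervalIntegrable _ _
    _ ≤ (2 * R) ^ k * ∑ _i : Fin (k + 4), 48 * Δ * R ^ 2 := by
        gcongr with i _
        refine (integral_quadSum_pow_four_le (ha i) hΔ (hM i) c).trans ?_
        have := hR i
        gcongr
    _ = _ := by
        rw [sum_const, card_univ, Fintype.card_fin, nsmul_eq_mul, mul_pow]
        push_cast; ring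

theorem quadCount_le {k : ℕ} {a : Fin (k + 4) → ℤ} (ha : ∀ i, a i ≠ 0)
    {B Δ R : ℝ} {M : ℕ} (hΔ : DivisorBound M Δ) (hM : ∀ i, quadWidth (a i) B ^ 2 ≤ M)
    (hR : ∀ i, (quadWidth (a i) B : ℝ) ≤ R) :
    (quadCount a B : ℝ) ≤ 48 * (k + 4) * 2 ^ k * Δ * R ^ (k + 2) := by
  refine le_trans ?_ (integral_prod_norm_quadSum_le ha hΔ hM hR 0)
  have h := congrArg norm (integral_prod_quadSum a B 0)
  rw [Complex.norm_natCast] at h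
  rw [← h]
  refine (intervalIntegral.norm_integral_le_integral_norm (by norm_num)).trans (le_of_eq ?_)
  simp only [norm_prod]

theorem norm_prod_sub_prod_le {k : ℕ} {u v : Fin k → ℂ} {R E : ℝ} (hu : ∀ i, ‖u i‖ ≤ R)
    (hv : ∀ i, ‖v i‖ ≤ R) (hE : ∀ i, ‖u i - v i‖ ≤ E) :
    R * ‖∏ i, u i - ∏ i, v i‖ ≤ k * R ^ k * E := by
  induction k with
  | zero => simp
  | succ k ih =>
    have hR : 0 ≤ R := (norm_nonneg _).trans (hu 0)
    have h1 := ih (fun i => hu i.succ) (fun i => hv i.succ) (fun i => hE i.succ)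
    rw [Fin.prod_univ_succ, Fin.prod_univ_succ]
    have h2 : u 0 * ∏ i : Fin k, u i.succ - v 0 * ∏ i : Fin k, v i.succ =
        u 0 * (∏ i : Fin k, u i.succ - ∏ i : Fin k, v i.succ) +
          (u 0 - v 0) * ∏ i : Fin k, v i.succ := by ring
    have h3 : ‖∏ i : Fin k, v i.succ‖ ≤ R ^ k := by
      rw [norm_prod]
      refine (prod_le_prod (fun i _ => norm_nonneg _) fun i _ => hv i.succ).trans ?_
      simp
    have h4 := hu 0
    have h5 := hE 0
    rw [h2]
    calc _ ≤ R * (‖u 0‖ * ‖∏ i : Fin k, u i.succ - ∏ i : Fin k, v i.succ‖ +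
          ‖u 0 - v 0‖ * ‖∏ i : Fin k, v i.succ‖) := by
          gcongr
          refine (norm_add_le _ _).trans ?_
          rw [norm_mul, norm_mul]
      _ = ‖u 0‖ * (R * ‖∏ i : Fin k, u i.succ - ∏ i : Fin k, v i.succ‖) +
          R * (‖u 0 - v 0‖ * ‖∏ i : Fin k, v i.succ‖) := by ring
      _ ≤ R * (k * R ^ k * E) + R * (E * R ^ k) := by
          have : 0 ≤ E := (norm_nonneg _).trans h5
          gcongr
      _ = _ := by push_cast; ring

/-- The rational numbers in `[0, 1)` with denominator at most `Q`. -/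
noncomputable def fareySet (Q : ℕ) : Finset ℚ :=
  {r ∈ (range Q ×ˢ Icc 1 Q).image fun p => (p.1 : ℚ) / p.2 | 0 ≤ r ∧ r < 1 ∧ r.den ≤ Q}

theorem mem_fareySet {Q : ℕ} {r : ℚ} : r ∈ fareySet Q ↔ 0 ≤ r ∧ r < 1 ∧ r.den ≤ Q := by
  rw [fareySet, mem_filter, and_iff_right_iff_imp]
  rintro ⟨h0, h1, h2⟩
  rw [mem_image]
  have h3 : 0 ≤ r.num := Rat.num_nonneg.mpr h0
  have h4 : r.num < r.den := Rat.num_lt_denom_iff.mpr h1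
  refine ⟨(r.num.toNat, r.den), ?_, ?_⟩
  · rw [mem_product, mem_range, mem_Icc]
    have := r.den_pos
    dsimp only
    omega
  · dsimp only
    have : ((r.num.toNat : ℕ) : ℚ) = r.num := by exact_mod_cast Int.toNat_of_nonneg h3
    rw [this, Rat.num_div_den]

theorem card_fareySet_le (Q : ℕ) : #(fareySet Q) ≤ Q ^ 2 := by
  refine (card_filter_le _ _).trans (card_image_le.trans ?_)
  rw [card_product, card_range, Nat.card_Icc, sq]
  simp

theorem one_le_mul_abs_sub {Q : ℕ} {r r' : ℚ} (hr : r.den ≤ Q) (hr' : r'.den ≤ Q) (hne : r ≠ r') :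
    1 ≤ (Q : ℝ) ^ 2 * |(r : ℝ) - r'| := by
  have h0 : r - r' ≠ 0 := sub_ne_zero.mpr hne
  have h1 : (1 : ℝ) ≤ (r.den : ℝ) * r'.den * |(r : ℝ) - r'| := by
    have h2 : ((r.num * r'.den - r'.num * r.den : ℤ) : ℚ) = r.den * r'.den * (r - r') := by
      push_cast
      rw [← Rat.mul_den_eq_num r, ← Rat.mul_den_eq_num r']; ring
    have h3 : r.num * r'.den - r'.num * r.den ≠ 0 := by
      intro h
      rw [h, Int.cast_zero, eq_comm, mul_eq_zero, mul_eq_zero] at h2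
      have := r.den_nz
      have := r'.den_nz
      simp_all
    have h4 : (((r.num * r'.den - r'.num * r.den : ℤ) : ℚ) : ℝ) = r.den * r'.den * ((r : ℝ) - r') := by
      rw [h2]; push_cast; ring
    have h5 := one_le_abs_cast h3
    rw [← Rat.cast_intCast, h4, abs_mul, abs_of_nonneg (by positivity)] at h5
    exact h5
  refine h1.trans ?_
  have h6 : (r.den : ℝ) ≤ Q := by exact_mod_cast hr
  have h7 : (r'.den : ℝ) ≤ Q := by exact_mod_cast hr'
  rw [sq]
  gcongr

/-- The truncated product of the singular series and the singular integral. -/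
noncomputable def singularProduct {k : ℕ} (a : Fin k → ℤ) (Q : ℕ) : ℝ :=
  (∑ r ∈ fareySet Q, ∫ γ in -(Q : ℝ) ^ 2..(Q : ℝ) ^ 2, ∏ i, quadLocal (a i) r γ).re

open MeasureTheory in
theorem norm_integral_sub_le_of_arcs {F : ℝ → ℂ} (hF : Continuous F) {Q : ℕ} {κ : ℝ}
    (hκ : 0 ≤ κ) (hQκ : 2 * κ * Q ^ 2 < 1) {G : ℝ → ℝ} (hG : Continuous G)
    (hG0 : ∀ α, 0 ≤ G α)
    (hmin : ∀ α, -κ < α → α ≤ 1 - κ → (∀ r ∈ fareySet Q, κ ≤ |α - r|) → ‖F α‖ ≤ G α) :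
    ‖(∫ α in -κ..(-κ + 1), F α) - ∑ r ∈ fareySet Q, ∫ α in ((r : ℝ) - κ)..(r + κ), F α‖ ≤
      ∫ α in -κ..(-κ + 1), G α := by
  set D := Set.Ioc (-κ) (-κ + 1) with hD
  set U := ⋃ r ∈ fareySet Q, Set.Ioc ((r : ℝ) - κ) (r + κ) with hU
  have hU_meas : MeasurableSet U :=
    Finset.measurableSet_biUnion _ fun _ _ => measurableSet_Ioc
  have hUD : U ⊆ D := by
    intro α hα
    simp only [hU, Set.mem_iUnion, Set.mem_Ioc] at hα
    obtain ⟨r, hr, h1, h2⟩ := hα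
    obtain ⟨hr0, hr1, hrQ⟩ := mem_fareySet.mp hr
    have hr0' : (0 : ℝ) ≤ r := by exact_mod_cast hr0
    have hr1' : (r : ℝ) < 1 := by exact_mod_cast hr1
    have h3 := one_le_mul_abs_sub (r' := 1) hrQ (by rw [Rat.den_one]; exact r.den_pos.trans_le hrQ)
      hr1.ne
    rw [Rat.cast_one, abs_sub_comm, abs_of_pos (by linarith)] at h3
    refine ⟨by linarith, ?_⟩
    by_contra! hcon
    have h4 : 1 - (r : ℝ) < 2 * κ := by linarith
    have h5 : (Q : ℝ) ^ 2 * (1 - r) ≤ Q ^ 2 * (2 * κ) := by gcongr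
    linarith
  have hdisj : (↑(fareySet Q) : Set ℚ).Pairwise
      (Function.onFun Disjoint fun r : ℚ => Set.Ioc ((r : ℝ) - κ) (r + κ)) := by
    intro r hr r' hr' hne
    refine Set.disjoint_left.mpr fun α h h' => ?_
    have h3 := one_le_mul_abs_sub (mem_fareySet.mp hr).2.2 (mem_fareySet.mp hr').2.2 hne
    have h4 : |(r : ℝ) - r'| ≤ 2 * κ := by
      rw [abs_le]; constructor <;> linarith [h.1, h.2, h'.1, h'.2]
    have h5 : (Q : ℝ) ^ 2 * |(r : ℝ) - r'| ≤ Q ^ 2 * (2 * κ) := by gcongr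
    linarith
  have hFint : IntegrableOn F D := (hF.integrableOn_Icc (a := -κ) (b := -κ + 1)).mono_set
    Set.Ioc_subset_Icc_self
  have hGint : IntegrableOn G D := (hG.integrableOn_Icc (a := -κ) (b := -κ + 1)).mono_set
    Set.Ioc_subset_Icc_self
  have hsum : ∑ r ∈ fareySet Q, ∫ α in ((r : ℝ) - κ)..(r + κ), F α = ∫ α in U, F α := by
    rw [hU, integral_biUnion_finset _ (fun _ _ => measurableSet_Ioc) hdisj fun r _ =>
      (hF.integrableOn_Icc (a := (r : ℝ) - κ) (b := r + κ)).mono_set Set.Ioc_subset_Icc_self]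
    exact sum_congr rfl fun r _ => intervalIntegral.integral_of_le (by linarith)
  rw [hsum, intervalIntegral.integral_of_le (by linarith), intervalIntegral.integral_of_le
    (by linarith), ← setIntegral_sdiff hU_meas hFint hUD]
  calc ‖∫ α in D \ U, F α‖ ≤ ∫ α in D \ U, G α := by
        refine norm_integral_le_of_norm_le (hGint.mono_set Set.sdiff_subset) ?_
        refine (ae_restrict_iff' (measurableSet_Ioc.diff hU_meas)).mpr (ae_of_all _ fun α hα => ?_)
        refine hmin α hα.1.1 (by linarith [hα.1.2]) fun r hr => ?_
        by_contra! hlt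
        rw [abs_lt] at hlt
        refine hα.2 (Set.mem_iUnion₂.mpr ⟨r, hr, ?_, ?_⟩) <;> linarith [hlt.1, hlt.2]
    _ ≤ ∫ α in D, G α :=
        setIntegral_mono_set hGint (ae_of_all _ hG0) (ae_of_all _ Set.sdiff_subset)

/-- Dirichlet approximation outside the major arcs. -/
theorem exists_rat_of_minor {Q : ℕ} (hQ : 1 ≤ Q) {B : ℝ} (hB : 2 * (Q : ℝ) ^ 4 < B) {α : ℝ}
    (h0 : -((Q : ℝ) ^ 2 / B) < α) (h1 : α ≤ 1 - (Q : ℝ) ^ 2 / B)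
    (hα : ∀ r ∈ fareySet Q, (Q : ℝ) ^ 2 / B ≤ |α - r|) :
    ∃ r : ℚ, |α - r| * r.den ^ 2 ≤ 1 ∧ Q < r.den ∧ (r.den : ℝ) * Q ^ 2 ≤ B := by
  have hQ1 : (1 : ℝ) ≤ Q := by exact_mod_cast hQ
  have hB0 : 0 < B := lt_of_le_of_lt (by positivity) hB
  have hQ24 : (Q : ℝ) ^ 2 ≤ Q ^ 4 := pow_le_pow_right₀ hQ1 (by norm_num)
  set κ := (Q : ℝ) ^ 2 / B with hκ
  have hκ0 : 0 < κ := by positivity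
  set n := ⌊B / (Q : ℝ) ^ 2⌋₊ with hn
  have hn0 : 0 < n := Nat.floor_pos.mpr (by
    rw [one_le_div (by positivity)]; nlinarith)
  have hn1 : (n : ℝ) * Q ^ 2 ≤ B := by
    rw [← le_div_iff₀ (by positivity)]; exact Nat.floor_le (by positivity)
  have hn2 : B / (Q : ℝ) ^ 2 < n + 1 := Nat.lt_floor_add_one _
  obtain ⟨r, hr, hrn⟩ := Real.exists_rat_abs_sub_le_and_den_le α hn0
  have hrn' : (r.den : ℝ) ≤ n := by exact_mod_cast hrn
  have hd : (1 : ℝ) ≤ r.den := by exact_mod_cast r.den_pos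
  rw [le_div_iff₀ (by positivity)] at hr
  have hκn : 1 < κ * (n + 1) := by
    rw [hκ, div_mul_eq_mul_div, one_lt_div hB0, mul_comm]
    rwa [div_lt_iff₀ (by positivity)] at hn2
  refine ⟨r, ?_, ?_, ?_⟩
  · refine le_trans ?_ hr
    rw [sq]; gcongr; linarith
  · by_contra! hden
    have hlt : |α - r| < κ := by
      by_contra! hge
      have : κ * ((n + 1) * 1) ≤ |α - r| * ((n + 1) * r.den) := by gcongr
      linarith
    have hQκ : (Q : ℝ) ^ 2 * (2 * κ) < 1 := by
      rw [hκ, mul_div_assoc', mul_div_assoc', div_lt_one hB0]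
      nlinarith
    have hone : Rat.den 1 ≤ Q := by rw [Rat.den_one]; exact hQ
    have hzero : Rat.den 0 ≤ Q := by rw [Rat.den_zero]; exact hQ
    rw [abs_lt] at hlt
    have hr1 : (r : ℝ) < 1 := by linarith
    have hr0 : (0 : ℝ) ≤ r := by
      by_contra! hneg
      have h3 := one_le_mul_abs_sub hden hzero (by rintro rfl; simp at hneg)
      rw [Rat.cast_zero, sub_zero, abs_of_neg hneg] at h3
      have : (Q : ℝ) ^ 2 * -r ≤ Q ^ 2 * (2 * κ) := by gcongr; linarith
      linarith
    have hmem : r ∈ fareySet Q :=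
      mem_fareySet.mpr ⟨by exact_mod_cast hr0, by exact_mod_cast hr1, hden⟩
    have := hα r hmem
    rw [← not_lt, abs_lt] at this
    exact this hlt
  · refine le_trans ?_ hn1
    gcongr

theorem quadWidth_sq_le {a : ℤ} (ha : a ≠ 0) {B : ℝ} (hB : 0 ≤ B) {M : ℕ} (hM : B ≤ M) :
    quadWidth a B ^ 2 ≤ M := by
  have h1 : (quadWidth a B : ℝ) ^ 2 ≤ M := by
    refine le_trans ?_ hM
    calc (quadWidth a B : ℝ) ^ 2 ≤ √B ^ 2 := by
          gcongr
          exact quadWidth_le ha hB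
      _ = B := Real.sq_sqrt hB
  exact_mod_cast h1

theorem continuous_quadLocal (a : ℤ) (r : ℚ) : Continuous (quadLocal a r) := by
  unfold quadLocal
  exact continuous_const.mul (continuous_quadIntegral a)

theorem integral_arc_quadLocal {m : ℕ} (a : Fin (m + 5) → ℤ) {B : ℝ} (hB : 0 < B) (T : ℝ) (r : ℚ) :
    ∫ α in ((r : ℝ) - T / B)..(r + T / B),
      ∏ i, ((√B : ℝ) : ℂ) * quadLocal (a i) r ((α - r) * B) =
      ((√B ^ (m + 3) : ℝ) : ℂ) * ∫ γ in -T..T, ∏ i, quadLocal (a i) r γ := by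
  have h0 : ∀ α : ℝ, ∏ i, ((√B : ℝ) : ℂ) * quadLocal (a i) r ((α - r) * B) =
      ((√B ^ (m + 5) : ℝ) : ℂ) * (fun γ => ∏ i, quadLocal (a i) r (γ * B)) (α - r) := by
    intro α
    rw [prod_mul_distrib, prod_const, card_univ, Fintype.card_fin]
    push_cast; rfl
  simp only [h0]
  rw [intervalIntegral.integral_const_mul, intervalIntegral.integral_comp_sub_right
    (fun γ => ∏ i, quadLocal (a i) r (γ * B)), intervalIntegral.integral_comp_mul_right
    (fun γ => ∏ i, quadLocal (a i) r γ) hB.ne']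
  have h1 : ((r : ℝ) - T / B - r) * B = -T := by field_simp; ring
  have h2 : ((r : ℝ) + T / B - r) * B = T := by field_simp; ring
  rw [h1, h2, Complex.real_smul, ← mul_assoc]
  congr 1
  rw [← Complex.ofReal_mul]
  congr 1
  have h3 : √B ^ (m + 5) = √B ^ (m + 3) * B := by
    rw [pow_add, pow_add]
    nth_rewrite 5 [← Real.sq_sqrt hB.le]
    ring
  rw [h3]
  field_simp

theorem norm_integral_arc_sub_le {m : ℕ} {a : Fin (m + 5) → ℤ} (ha : ∀ i, a i ≠ 0) {A B : ℝ}
    (hA : ∀ i, |(a i : ℝ)| ≤ A) {Q : ℕ} {r : ℚ} (hr : r.den ≤ Q) (hB0 : 0 < B)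
    (hB : A * (Q : ℝ) ^ 2 ≤ B) :
    ‖(∫ α in ((r : ℝ) - (Q : ℝ) ^ 2 / B)..(r + (Q : ℝ) ^ 2 / B), ∏ i, quadSum (a i) B α) -
      ((√B ^ (m + 3) : ℝ) : ℂ) * ∫ γ in -(Q : ℝ) ^ 2..(Q : ℝ) ^ 2, ∏ i, quadLocal (a i) r γ‖ ≤
      1536 * (m + 5) * 2 ^ m * (Q : ℝ) ^ 5 * √B ^ (m + 2) := by
  set κ := (Q : ℝ) ^ 2 / B with hκ
  have hκ0 : 0 ≤ κ := by positivity
  have hb : 0 < √B := Real.sqrt_pos.mpr hB0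
  rw [← integral_arc_quadLocal a hB0, ← intervalIntegral.integral_sub]
  rotate_left
  · exact (continuous_finsetProd _ fun i _ => continuous_quadSum _ _).intervalIntegrable _ _
  · refine (continuous_finsetProd _ fun i _ => continuous_const.mul
      ((continuous_quadLocal _ _).comp ?_)).intervalIntegrable _ _
    fun_prop
  have hpt : ∀ α ∈ Set.uIoc ((r : ℝ) - κ) (r + κ),
      ‖∏ i, quadSum (a i) B α - ∏ i, ((√B : ℝ) : ℂ) * quadLocal (a i) r ((α - r) * B)‖ ≤
        48 * (m + 5) * (2 * √B) ^ (m + 4) * (Q : ℝ) ^ 3 := by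
    intro α hα
    rw [Set.uIoc_of_le (by linarith)] at hα
    have hαr : |α - r| * B ≤ (Q : ℝ) ^ 2 := by
      rw [← le_div_iff₀ hB0, abs_le]
      constructor <;> linarith [hα.1, hα.2]
    have h1 := norm_prod_sub_prod_le (u := fun i => quadSum (a i) B α)
      (v := fun i => ((√B : ℝ) : ℂ) * quadLocal (a i) r ((α - r) * B)) (R := 2 * √B)
      (E := 48 * (Q : ℝ) ^ 3) (fun i => norm_quadSum_le (ha i) hB0.le α)
      (fun i => by
        rw [norm_mul, Complex.norm_real, Real.norm_of_nonneg hb.le]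
        nlinarith [norm_quadLocal_le (ha i) r ((α - r) * B)])
      (fun i => by
        have := norm_quadSum_sub_le (ha i) (hA i) hr hαr hB
        rwa [add_sub_cancel] at this)
    have h2 : 0 < 2 * √B := by linarith
    refine le_of_mul_le_mul_left (h1.trans (le_of_eq ?_)) h2
    push_cast
    ring
  refine (intervalIntegral.norm_integral_le_of_norm_le_const hpt).trans (le_of_eq ?_)
  have h3 : (r : ℝ) + κ - (r - κ) = 2 * κ := by ring
  rw [h3, abs_of_nonneg (by linarith), hκ]
  have h4 : (2 * √B) ^ (m + 4) = 2 ^ m * 16 * √B ^ (m + 2) * B := by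
    rw [mul_pow, pow_add, pow_add, pow_add, ← Real.sq_sqrt hB0.le, Real.sqrt_sq hb.le]
    ring
  rw [h4]
  field_simp
  ring

/-- The circle method for diagonal quadratic forms in at least five variables, with explicit
polynomial dependence on the coefficients. -/
theorem abs_quadCount_sub_le {m : ℕ} {a : Fin (m + 5) → ℤ} (ha : ∀ i, a i ≠ 0) {A B Δ : ℝ}
    (hA : ∀ i, |(a i : ℝ)| ≤ A) {M R : ℕ} (hR : 1 ≤ R) (hΔ : DivisorBound M Δ) (hM : B ≤ M)
    (hB : 4 * A * (R : ℝ) ^ 32 ≤ B) :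
    |(quadCount a B : ℝ) - singularProduct a (R ^ 2) * √B ^ (m + 3)| ≤
      2400 * (m + 5) * 2 ^ m * A * Δ * √B ^ (m + 3) / R := by
  have hR1 : (1 : ℝ) ≤ R := by exact_mod_cast hR
  have hA1 : 1 ≤ A := (one_le_abs_cast (ha 0)).trans (hA 0)
  have hΔ1 := hΔ.1
  have hR32 : 4 * (R : ℝ) ^ 32 ≤ B := by
    refine le_trans ?_ hB
    gcongr
    linarith
  have hRpow : ∀ k, (1 : ℝ) ≤ (R : ℝ) ^ k := fun k => one_le_pow₀ hR1
  have hB0 : 0 < B := by linarith [hRpow 32]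
  have hb : 0 < √B := Real.sqrt_pos.mpr hB0
  set Q := R ^ 2 with hQ
  have hQ1 : 1 ≤ Q := Nat.one_le_pow _ _ hR
  have hQR : (Q : ℝ) = (R : ℝ) ^ 2 := by rw [hQ]; push_cast; rfl
  have hR8 : (R : ℝ) ^ 8 ≤ R ^ 32 := pow_le_pow_right₀ hR1 (by norm_num)
  have hR4 : (R : ℝ) ^ 4 ≤ R ^ 32 := pow_le_pow_right₀ hR1 (by norm_num)
  have hQ4 : 2 * (Q : ℝ) ^ 4 < B := by
    rw [hQR]; ring_nf; linarith [hRpow 8]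
  have hAQ : A * (Q : ℝ) ^ 2 ≤ B := by
    rw [hQR, ← pow_mul]
    refine le_trans ?_ hB
    norm_num
    nlinarith [hRpow 4]
  set κ := (Q : ℝ) ^ 2 / B with hκ
  have hκ0 : 0 ≤ κ := by positivity
  set F : ℝ → ℂ := fun α => ∏ i, quadSum (a i) B α with hF
  set g : ℝ → ℝ := fun α => ∏ i : Fin (m + 4), ‖quadSum (a i.succ) B α‖ with hg
  set G : ℝ → ℝ := fun α => 18 * A * √B / R * g α with hG
  have hg_cont : Continuous g := continuous_finsetProd _ fun i _ => (continuous_quadSum _ _).norm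
  have hg0 : ∀ α, 0 ≤ g α := fun α => prod_nonneg fun i _ => norm_nonneg _
  have hQκ : 2 * κ * (Q : ℝ) ^ 2 < 1 := by
    rw [hκ, mul_div_assoc', div_mul_eq_mul_div, div_lt_one hB0]
    linarith
  have hminor : ∀ α, -κ < α → α ≤ 1 - κ → (∀ r ∈ fareySet Q, κ ≤ |α - r|) → ‖F α‖ ≤ G α := by
    intro α h0 h1 h2
    obtain ⟨r, hr1, hr2, hr3⟩ := exists_rat_of_minor hQ1 hQ4 h0 h1 h2
    have hQ4' : (0 : ℝ) ≤ (Q : ℝ) ^ 4 := by positivity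
    have h3 := norm_quadSum_sq_le_of_minor (ha 0) (hA 0) hQ1 (by linarith) hr1 hr2 hr3
    have h4 : ‖quadSum (a 0) B α‖ ≤ 18 * A * √B / R := by
      refine le_of_sq_le_sq ?_ (by positivity)
      refine h3.trans ?_
      rw [div_pow, mul_pow, mul_pow, Real.sq_sqrt hB0.le, hQR]
      gcongr
      · norm_num
      · nlinarith
    rw [hF, hG]
    simp only
    rw [Fin.prod_univ_succ, norm_mul, norm_prod]
    gcongr
  have hmin := norm_integral_sub_le_of_arcs (F := F) (G := G)
    (continuous_finsetProd _ fun i _ => continuous_quadSum _ _) hκ0 hQκ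
    (continuous_const.mul hg_cont) (fun α => mul_nonneg (by positivity) (hg0 α)) hminor
  rw [hG, intervalIntegral.integral_const_mul] at hmin
  have hgint := integral_prod_norm_quadSum_le (a := fun i : Fin (m + 4) => a i.succ)
    (fun i => ha _) hΔ (fun i => quadWidth_sq_le (ha _) hB0.le hM)
    (fun i => quadWidth_le (ha _) hB0.le) (-κ)
  rw [integral_prod_quadSum] at hmin
  have hmaj : ‖∑ r ∈ fareySet Q, (∫ α in ((r : ℝ) - κ)..(r + κ), F α) -
      ((√B ^ (m + 3) : ℝ) : ℂ) * ∑ r ∈ fareySet Q, ∫ γ in -(Q : ℝ) ^ 2..(Q : ℝ) ^ 2,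
        ∏ i, quadLocal (a i) r γ‖ ≤
      (Q : ℝ) ^ 2 * (1536 * (m + 5) * 2 ^ m * (Q : ℝ) ^ 5 * √B ^ (m + 2)) := by
    rw [mul_sum, ← sum_sub_distrib]
    refine (norm_sum_le_of_le _ fun r hr =>
      norm_integral_arc_sub_le ha hA (mem_fareySet.mp hr).2.2 hB0 hAQ).trans ?_
    rw [sum_const, nsmul_eq_mul]
    gcongr
    exact_mod_cast card_fareySet_le Q
  have hbR : (R : ℝ) ^ 16 ≤ √B := by
    refine Real.le_sqrt_of_sq_le ?_
    rw [← pow_mul, show 16 * 2 = 32 from rfl]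
    linarith [hRpow 32]
  set S := ∑ r ∈ fareySet Q, ∫ γ in -(Q : ℝ) ^ 2..(Q : ℝ) ^ 2, ∏ i, quadLocal (a i) r γ with hS
  have hre : (quadCount a B : ℝ) - singularProduct a Q * √B ^ (m + 3) =
      ((quadCount a B : ℂ) - ((√B ^ (m + 3) : ℝ) : ℂ) * S).re := by
    rw [Complex.sub_re, Complex.natCast_re, Complex.re_ofReal_mul, singularProduct, mul_comm]
  rw [hre]
  refine (Complex.abs_re_le_norm _).trans ?_
  have htri := norm_sub_le_norm_sub_add_norm_sub (quadCount a B : ℂ)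
    (∑ r ∈ fareySet Q, ∫ α in ((r : ℝ) - κ)..(r + κ), F α) (((√B ^ (m + 3) : ℝ) : ℂ) * S)
  refine (htri.trans (add_le_add (hmin.trans (mul_le_mul_of_nonneg_left hgint (by positivity)))
    hmaj)).trans ?_
  have hmaj' : (Q : ℝ) ^ 2 * (1536 * (m + 5) * 2 ^ m * (Q : ℝ) ^ 5 * √B ^ (m + 2)) ≤
      1536 * (m + 5) * 2 ^ m * √B ^ (m + 3) / R := by
    rw [le_div_iff₀ (by positivity), hQR]
    have h5 : (R : ℝ) ^ 15 ≤ √B := (pow_le_pow_right₀ hR1 (by norm_num)).trans hbR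
    calc _ = 1536 * (m + 5) * 2 ^ m * (√B ^ (m + 2) * (R : ℝ) ^ 15) := by ring
      _ ≤ 1536 * (m + 5) * 2 ^ m * (√B ^ (m + 2) * √B) := by gcongr
      _ = _ := by ring
  have hAΔ : 1 ≤ A * Δ := one_le_mul_of_one_le_of_one_le hA1 hΔ1
  set Z := 2 ^ m * √B ^ (m + 3) / (R : ℝ) with hZ
  have hZ0 : 0 ≤ Z := by positivity
  have hm0 : (0 : ℝ) ≤ m := Nat.cast_nonneg m
  calc _ ≤ 18 * A * √B / R * (48 * (m + 4) * 2 ^ m * Δ * √B ^ (m + 2)) +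
        1536 * (m + 5) * 2 ^ m * √B ^ (m + 3) / R := by linarith
    _ = 864 * (m + 4) * (A * Δ) * Z + 1536 * (m + 5) * 1 * Z := by rw [hZ]; ring
    _ ≤ 864 * (m + 5) * (A * Δ) * Z + 1536 * (m + 5) * (A * Δ) * Z := by gcongr; norm_num
    _ = _ := by rw [hZ]; ring

theorem sum_moebius_of_forall_dvd {k : ℕ} {f : Fin k → ℤ} {M : ℕ} (i₀ : Fin k) (h0 : f i₀ ≠ 0)
    (hM : |f i₀| ≤ M) :
    ∑ d ∈ Icc 1 M with ∀ i, ((d : ℕ) : ℤ) ∣ f i, ArithmeticFunction.moebius d =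
      if univ.gcd f = 1 then 1 else 0 := by
  set g := (univ.gcd f).natAbs with hg
  have hdvd : ∀ d : ℕ, (∀ i, (d : ℤ) ∣ f i) ↔ d ∣ g := by
    intro d
    rw [hg, ← Int.natCast_dvd, Finset.dvd_gcd_iff]
    simp
  have hg0 : g ≠ 0 := by
    rw [hg, Int.natAbs_ne_zero]
    intro h
    exact h0 (gcd_eq_zero_iff.mp h i₀ (mem_univ _))
  have hgM : ∀ d, d ∣ g → 1 ≤ d ∧ d ≤ M := by
    intro d hd
    refine ⟨Nat.pos_of_dvd_of_pos hd (Nat.pos_of_ne_zero hg0), ?_⟩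
    have h1 := Int.le_of_dvd (abs_pos.mpr h0) ((dvd_abs _ _).mpr ((hdvd d).mpr hd i₀))
    exact_mod_cast h1.trans hM
  have h1 : {d ∈ Icc 1 M | ∀ i, ((d : ℕ) : ℤ) ∣ f i} = g.divisors := by
    ext d
    rw [mem_filter, mem_Icc, hdvd, Nat.mem_divisors]
    exact ⟨fun h => ⟨h.2, hg0⟩, fun h => ⟨hgM d h.1, h.1⟩⟩
  have h2 : univ.gcd f = 1 ↔ g = 1 := by
    have h3 : (g : ℤ) = univ.gcd f := by
      rw [hg, Int.natCast_natAbs, Int.abs_eq_normalize, Finset.normalize_gcd]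
    rw [← h3]
    exact_mod_cast Iff.rfl
  rw [h1, ← ArithmeticFunction.coe_mul_zeta_apply, ArithmeticFunction.moebius_mul_coe_zeta,
    ArithmeticFunction.one_apply]
  simp only [h2]

/-- The integer `c` such that `d ∣ x * y` is equivalent to `c ∣ x`. -/
def dvdCofactor (d : ℕ) (y : ℤ) : ℤ := lcm (d : ℤ) y / y

theorem dvdCofactor_mul {d : ℕ} {y : ℤ} : dvdCofactor d y * y = lcm (d : ℤ) y :=
  Int.ediv_mul_cancel (dvd_lcm_right _ _)

theorem dvd_mul_iff_dvdCofactor_dvd {d : ℕ} {x y : ℤ} (hy : y ≠ 0) :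
    (d : ℤ) ∣ x * y ↔ dvdCofactor d y ∣ x := by
  rw [← mul_dvd_mul_iff_right (a := dvdCofactor d y) hy, dvdCofactor_mul, _root_.lcm_dvd_iff]
  exact ⟨fun h => ⟨h, dvd_mul_left _ _⟩, fun h => h.1⟩

theorem dvdCofactor_dvd {d : ℕ} {y : ℤ} (hy : y ≠ 0) : dvdCofactor d y ∣ d :=
  (dvd_mul_iff_dvdCofactor_dvd hy).mp (dvd_mul_right _ _)

theorem dvdCofactor_ne_zero {d : ℕ} (hd : d ≠ 0) {y : ℤ} (hy : y ≠ 0) : dvdCofactor d y ≠ 0 := by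
  intro h
  have := dvdCofactor_dvd (d := d) hy
  rw [h, zero_dvd_iff] at this
  exact hd (by exact_mod_cast this)

theorem abs_dvdCofactor_le {d : ℕ} (hd : d ≠ 0) {y : ℤ} (hy : y ≠ 0) : |dvdCofactor d y| ≤ d :=
  Int.le_of_dvd (by omega) ((abs_dvd _ _).mpr (dvdCofactor_dvd hy))

theorem le_abs_dvdCofactor_mul {d : ℕ} (hd : d ≠ 0) {y : ℤ} (hy : y ≠ 0) :
    (d : ℤ) ≤ |dvdCofactor d y * y| := by
  refine Int.le_of_dvd (abs_pos.mpr (mul_ne_zero (dvdCofactor_ne_zero hd hy) hy)) ?_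
  rw [dvd_abs, dvdCofactor_mul]
  exact dvd_lcm_left _ _

/-- The coefficient of the quadratic form obtained from `x ^ 2 * y ^ 3` by the substitution
imposed by `d ∣ x * y`. -/
def sieveCoeff (d : ℕ) (y : ℤ) : ℤ := y ^ 3 * dvdCofactor d y ^ 2

theorem sieveCoeff_ne_zero {d : ℕ} (hd : d ≠ 0) {y : ℤ} (hy : y ≠ 0) : sieveCoeff d y ≠ 0 :=
  mul_ne_zero (pow_ne_zero _ hy) (pow_ne_zero _ (dvdCofactor_ne_zero hd hy))

theorem abs_sieveCoeff_le {d W : ℕ} (hd : d ≠ 0) {y : ℤ} (hy : y ≠ 0) (hW : |y| ≤ W) :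
    |(sieveCoeff d y : ℝ)| ≤ (W : ℝ) ^ 3 * (d : ℝ) ^ 2 := by
  have h1 : |sieveCoeff d y| ≤ (W : ℤ) ^ 3 * (d : ℤ) ^ 2 := by
    rw [sieveCoeff, abs_mul, abs_pow, abs_pow]
    have := abs_dvdCofactor_le hd hy
    gcongr
  exact_mod_cast h1

theorem sq_le_abs_sieveCoeff {d : ℕ} (hd : d ≠ 0) {y : ℤ} (hy : y ≠ 0) :
    (d : ℝ) ^ 2 ≤ |(sieveCoeff d y : ℝ)| := by
  have h1 : (d : ℤ) ^ 2 ≤ |sieveCoeff d y| := by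
    have h2 : sieveCoeff d y = y * (dvdCofactor d y * y) ^ 2 := by rw [sieveCoeff]; ring
    rw [h2, abs_mul, abs_pow]
    have h3 := le_abs_dvdCofactor_mul hd hy
    have h4 : 1 ≤ |y| := Int.one_le_abs hy
    calc (d : ℤ) ^ 2 ≤ |dvdCofactor d y * y| ^ 2 := by gcongr
      _ ≤ |y| * |dvdCofactor d y * y| ^ 2 := le_mul_of_one_le_left (by positivity) h4
  exact_mod_cast h1

theorem quadWidth_sieveCoeff_le {d : ℕ} (hd : d ≠ 0) {y : ℤ} (hy : y ≠ 0) {B : ℝ} (hB : 0 ≤ B) :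
    (quadWidth (sieveCoeff d y) B : ℝ) ≤ √B / d := by
  have hd0 : (0 : ℝ) < d := by exact_mod_cast Nat.pos_of_ne_zero hd
  refine (Nat.floor_le (Real.sqrt_nonneg _)).trans ?_
  rw [Real.sqrt_div hB]
  gcongr
  exact Real.le_sqrt_of_sq_le (sq_le_abs_sieveCoeff hd hy)

theorem card_filter_dvd_eq_quadCount {k d : ℕ} (hd : d ≠ 0) {y : Fin k → ℤ} (hy : ∀ i, y i ≠ 0)
    (B : ℝ) :
    #{x ∈ Fintype.piFinset fun i => nonzeroBox (quadWidth (y i ^ 3) B) |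
      ∑ i, x i ^ 2 * y i ^ 3 = 0 ∧ ∀ i, (d : ℤ) ∣ x i * y i} =
      quadCount (fun i => sieveCoeff d (y i)) B := by
  have hc : ∀ i, dvdCofactor d (y i) ≠ 0 := fun i => dvdCofactor_ne_zero hd (hy i)
  have hval : ∀ i (z : ℤ), (dvdCofactor d (y i) * z) ^ 2 * y i ^ 3 = sieveCoeff d (y i) * z ^ 2 :=
    fun i z => by rw [sieveCoeff]; ring
  rw [quadCount, eq_comm]
  refine card_bij (fun z _ i => dvdCofactor d (y i) * z i) ?_ ?_ ?_
  · intro z hz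
    simp only [mem_filter, Fintype.mem_piFinset,
      mem_nonzeroBox_quadWidth (sieveCoeff_ne_zero hd (hy _)),
      mem_nonzeroBox_quadWidth (pow_ne_zero 3 (hy _))] at hz ⊢
    refine ⟨fun i => ⟨mul_ne_zero (hc i) (hz.1 i).1, ?_⟩, ?_, fun i =>
      (dvd_mul_iff_dvdCofactor_dvd (hy i)).mpr (dvd_mul_right _ _)⟩
    · have h1 := hval i (z i)
      have h2 := (hz.1 i).2
      rw [mul_comm] at h1
      exact_mod_cast (by exact_mod_cast h1 : (((y i ^ 3 : ℤ) : ℝ) *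
        ((dvdCofactor d (y i) * z i : ℤ) : ℝ) ^ 2) = (sieveCoeff d (y i) : ℝ) * (z i : ℝ) ^ 2) ▸ h2
    · simp only [hval]
      exact hz.2
  · intro z _ z' _ h
    funext i
    exact mul_left_cancel₀ (hc i) (congrFun h i)
  · intro x hx
    simp only [mem_filter, Fintype.mem_piFinset,
      mem_nonzeroBox_quadWidth (pow_ne_zero 3 (hy _))] at hx
    choose z hz using fun i => (dvd_mul_iff_dvdCofactor_dvd (hy i)).mp (hx.2.2 i)
    refine ⟨z, ?_, funext fun i => (hz i).symm⟩
    simp only [mem_filter, Fintype.mem_piFinset,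
      mem_nonzeroBox_quadWidth (sieveCoeff_ne_zero hd (hy _))]
    refine ⟨fun i => ⟨?_, ?_⟩, ?_⟩
    · rintro h
      exact (hx.1 i).1 (by rw [hz i, h, mul_zero])
    · have h1 := hval i (z i)
      rw [← hz i, mul_comm] at h1
      have h2 := (hx.1 i).2
      exact (by exact_mod_cast h1 : (((y i ^ 3 : ℤ) : ℝ) * (x i : ℝ) ^ 2) =
        (sieveCoeff d (y i) : ℝ) * (z i : ℝ) ^ 2) ▸ h2
    · rw [← hx.2.1]
      exact sum_congr rfl fun i _ => by rw [hz i, hval]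

/-- The number of `x` with fixed `y` in the counting problem. -/
noncomputable def coprimeCount {k : ℕ} (y : Fin k → ℤ) (B : ℝ) : ℕ :=
  #{x ∈ Fintype.piFinset fun i => nonzeroBox (quadWidth (y i ^ 3) B) |
    ∑ i, x i ^ 2 * y i ^ 3 = 0 ∧ univ.gcd (fun i => x i * y i) = 1}

theorem coprimeCount_eq {k : ℕ} {y : Fin (k + 1) → ℤ} (hy : ∀ i, y i ≠ 0) {B : ℝ} {M : ℕ}
    (hM : B ≤ M) :
    (coprimeCount y B : ℝ) = ∑ d ∈ Icc 1 M,
      (ArithmeticFunction.moebius d : ℝ) * quadCount (fun i => sieveCoeff d (y i)) B := by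
  set S := {x ∈ Fintype.piFinset fun i => nonzeroBox (quadWidth (y i ^ 3) B) |
    ∑ i, x i ^ 2 * y i ^ 3 = 0} with hS
  have h1 : ∀ x ∈ S, (∑ d ∈ Icc 1 M with ∀ i, ((d : ℕ) : ℤ) ∣ x i * y i,
      ArithmeticFunction.moebius d) = if univ.gcd (fun i => x i * y i) = 1 then 1 else 0 := by
    intro x hx
    rw [hS, mem_filter, Fintype.mem_piFinset] at hx
    have h2 := hx.1 0
    rw [mem_nonzeroBox_quadWidth (pow_ne_zero 3 (hy 0))] at h2
    refine sum_moebius_of_forall_dvd 0 (mul_ne_zero h2.1 (hy 0)) ?_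
    have h3 : |y 0 ^ 3 * x 0 ^ 2| ≤ (M : ℤ) := by exact_mod_cast h2.2.trans hM
    refine le_trans ?_ h3
    have hx1 : 1 ≤ |x 0| := Int.one_le_abs h2.1
    have hy1 : 1 ≤ |y 0| := Int.one_le_abs (hy 0)
    rw [abs_mul, abs_mul, abs_pow, abs_pow, mul_comm]
    gcongr
    · exact le_self_pow₀ hy1 (by norm_num)
    · exact le_self_pow₀ hx1 (by norm_num)
  have h2 : (coprimeCount y B : ℤ) = ∑ d ∈ Icc 1 M,
      ArithmeticFunction.moebius d * quadCount (fun i => sieveCoeff d (y i)) B := by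
    calc (coprimeCount y B : ℤ) = ∑ x ∈ S, if univ.gcd (fun i => x i * y i) = 1 then 1 else 0 := by
          rw [← sum_filter, sum_const, coprimeCount, hS, filter_filter]; simp
      _ = ∑ x ∈ S, ∑ d ∈ Icc 1 M,
          if ∀ i, ((d : ℕ) : ℤ) ∣ x i * y i then ArithmeticFunction.moebius d else 0 := by
          refine sum_congr rfl fun x hx => ?_
          rw [← h1 x hx, sum_filter]
      _ = _ := by
          rw [sum_comm]
          refine sum_congr rfl fun d hd => ?_
          rw [← sum_filter, sum_const, hS, filter_filter, card_filter_dvd_eq_quadCount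
            (by rw [mem_Icc] at hd; omega) hy, nsmul_eq_mul, mul_comm]
  exact_mod_cast h2

/-- The coefficient of the main term for `coprimeCount y`, with truncation parameters `D`, `R`. -/
noncomputable def sieveMain {k : ℕ} (y : Fin k → ℤ) (D R : ℕ) : ℝ :=
  ∑ d ∈ Icc 1 D, (ArithmeticFunction.moebius d : ℝ) *
    singularProduct (fun i => sieveCoeff d (y i)) (R ^ 2)

theorem abs_moebius_cast_le_one (d : ℕ) : |(ArithmeticFunction.moebius d : ℝ)| ≤ 1 := by
  exact_mod_cast ArithmeticFunction.abs_moebius_le_one (n := d)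

theorem abs_coprimeCount_sub_le {m : ℕ} {y : Fin (m + 5) → ℤ} (hy : ∀ i, y i ≠ 0) {W D R M : ℕ}
    {B Δ : ℝ} (hW : ∀ i, |y i| ≤ W) (hD : 1 ≤ D) (hR : 1 ≤ R) (hΔ : DivisorBound M Δ)
    (hM : B ≤ M) (hB : 4 * ((W : ℝ) ^ 3 * (D : ℝ) ^ 2) * (R : ℝ) ^ 32 ≤ B) :
    |(coprimeCount y B : ℝ) - sieveMain y D R * √B ^ (m + 3)| ≤
      2400 * (m + 5) * 2 ^ m * Δ * √B ^ (m + 3) * ((W : ℝ) ^ 3 * (D : ℝ) ^ 3 / R + 1 / D) := by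
  have hW1 : (1 : ℝ) ≤ W := by exact_mod_cast (Int.one_le_abs (hy 0)).trans (hW 0)
  have hD1 : (1 : ℝ) ≤ D := by exact_mod_cast hD
  have hR1 : (1 : ℝ) ≤ R := by exact_mod_cast hR
  have hΔ1 := hΔ.1
  have hDB : (D : ℝ) ≤ B := by
    refine le_trans ?_ hB
    have h1 : (1 : ℝ) ≤ (W : ℝ) ^ 3 := one_le_pow₀ hW1
    have h2 : (1 : ℝ) ≤ (R : ℝ) ^ 32 := one_le_pow₀ hR1
    have h3 : (D : ℝ) ≤ (D : ℝ) ^ 2 := le_self_pow₀ hD1 (by norm_num)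
    calc (D : ℝ) ≤ 4 * (1 * (D : ℝ) ^ 2) * 1 := by nlinarith
      _ ≤ _ := by gcongr
  have hB0 : 0 ≤ B := by linarith
  have hDM : D ≤ M := by exact_mod_cast hDB.trans hM
  set b := √B with hb
  have hb0 : 0 ≤ b := Real.sqrt_nonneg B
  set N : ℕ → ℝ := fun d => quadCount (fun i => sieveCoeff d (y i)) B with hN
  set P : ℕ → ℝ := fun d => singularProduct (fun i => sieveCoeff d (y i)) (R ^ 2) with hP
  set C : ℝ := 2400 * (m + 5) * 2 ^ m * Δ * b ^ (m + 3) with hC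
  have hC0 : 0 ≤ C := by positivity
  have hsmall : ∀ d ∈ Icc 1 D, |N d - P d * b ^ (m + 3)| ≤ C * ((W : ℝ) ^ 3 * (D : ℝ) ^ 2 / R) := by
    intro d hd
    rw [mem_Icc] at hd
    have hd0 : d ≠ 0 := by omega
    have hdD : (d : ℝ) ≤ D := by exact_mod_cast hd.2
    refine (abs_quadCount_sub_le (fun i => sieveCoeff_ne_zero hd0 (hy i))
      (A := (W : ℝ) ^ 3 * (D : ℝ) ^ 2) (fun i => (abs_sieveCoeff_le hd0 (hy i) (hW i)).trans ?_)
      hR hΔ hM hB).trans (le_of_eq ?_)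
    · gcongr
    · rw [hC]; ring
  have hlarge : ∀ d ∈ Ioc D M, N d ≤ C * ((d : ℝ) ^ 2)⁻¹ := by
    intro d hd
    rw [mem_Ioc] at hd
    have hd0 : d ≠ 0 := by omega
    have hd1 : (1 : ℝ) ≤ d := by exact_mod_cast Nat.one_le_iff_ne_zero.mpr hd0
    have h1 := quadCount_le (k := m + 1) (a := fun i => sieveCoeff d (y i))
      (fun i => sieveCoeff_ne_zero hd0 (hy i)) hΔ
      (fun i => quadWidth_sq_le (sieveCoeff_ne_zero hd0 (hy i)) hB0 hM)
      (fun i => quadWidth_sieveCoeff_le hd0 (hy i) hB0)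
    refine h1.trans ?_
    have h2 : (b / d) ^ (m + 1 + 2) ≤ b ^ (m + 3) * ((d : ℝ) ^ 2)⁻¹ := by
      rw [div_pow, div_eq_mul_inv]
      gcongr
      omega
    calc _ ≤ 48 * (((m + 1 : ℕ) : ℝ) + 4) * 2 ^ (m + 1) * Δ * (b ^ (m + 3) * ((d : ℝ) ^ 2)⁻¹) := by
          gcongr
      _ = 96 * ((m + 5) * 2 ^ m * Δ * b ^ (m + 3) * ((d : ℝ) ^ 2)⁻¹) := by push_cast; ring
      _ ≤ 2400 * ((m + 5) * 2 ^ m * Δ * b ^ (m + 3) * ((d : ℝ) ^ 2)⁻¹) := by gcongr; norm_num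
      _ = _ := by rw [hC]; ring
  have hIcc : ∀ n, Icc 1 n = Ioc 0 n := fun n => by ext; simp [Nat.lt_iff_add_one_le]
  have hsplit : (coprimeCount y B : ℝ) - sieveMain y D R * b ^ (m + 3) =
      ∑ d ∈ Icc 1 D, (ArithmeticFunction.moebius d : ℝ) * (N d - P d * b ^ (m + 3)) +
        ∑ d ∈ Ioc D M, (ArithmeticFunction.moebius d : ℝ) * N d := by
    rw [coprimeCount_eq hy hM, sieveMain, hIcc, hIcc,
      ← sum_Ioc_consecutive _ (Nat.zero_le D) hDM, sum_mul]
    simp only [mul_sub, sum_sub_distrib, mul_assoc, hN, hP]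
    ring
  have hbd1 : |∑ d ∈ Icc 1 D, (ArithmeticFunction.moebius d : ℝ) * (N d - P d * b ^ (m + 3))| ≤
      C * ((W : ℝ) ^ 3 * (D : ℝ) ^ 3 / R) := by
    refine (abs_sum_le_sum_abs _ _).trans ((sum_le_sum (g := fun _ =>
      C * ((W : ℝ) ^ 3 * (D : ℝ) ^ 2 / R)) fun d hd => ?_).trans (le_of_eq ?_))
    · rw [abs_mul, ← one_mul (C * _)]
      exact mul_le_mul (abs_moebius_cast_le_one d) (hsmall d hd) (abs_nonneg _) zero_le_one
    · rw [sum_const, Nat.card_Icc, nsmul_eq_mul, Nat.add_sub_cancel]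
      ring
  have hbd2 : |∑ d ∈ Ioc D M, (ArithmeticFunction.moebius d : ℝ) * N d| ≤ C * (1 / D) := by
    refine (abs_sum_le_sum_abs _ _).trans ((sum_le_sum (g := fun d : ℕ =>
      C * ((d : ℝ) ^ 2)⁻¹) fun d hd => ?_).trans ?_)
    · have h0 : 0 ≤ N d := Nat.cast_nonneg _
      rw [abs_mul, abs_of_nonneg h0, ← one_mul (C * _)]
      exact mul_le_mul (abs_moebius_cast_le_one d) (hlarge d hd) h0 zero_le_one
    · rw [← mul_sum, one_div]
      have h1 := sum_Ioc_inv_sq_le_sub (α := ℝ) (k := D) (by omega) hDM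
      have h2 : (0 : ℝ) ≤ (M : ℝ)⁻¹ := by positivity
      gcongr
      linarith
  rw [hsplit, mul_add]
  exact (abs_add_le _ _).trans (add_le_add hbd1 hbd2)

open Classical in
/-- The vectors of nonzero squarefree integers bounded by `W`. -/
noncomputable def squarefreeBox (k W : ℕ) : Finset (Fin k → ℤ) :=
  {y ∈ Fintype.piFinset fun _ => nonzeroBox W | ∀ i, Squarefree (y i)}

theorem mem_squarefreeBox {k W : ℕ} {y : Fin k → ℤ} :
    y ∈ squarefreeBox k W ↔ (∀ i, y i ≠ 0 ∧ |y i| ≤ W) ∧ ∀ i, Squarefree (y i) := by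
  simp only [squarefreeBox, mem_filter, Fintype.mem_piFinset, mem_nonzeroBox]

theorem card_squarefreeBox_le (k W : ℕ) : #(squarefreeBox k W) ≤ (2 * W) ^ k := by
  classical
  refine (card_filter_le _ _).trans ?_
  rw [Fintype.card_piFinset, prod_const, card_nonzeroBox, card_univ, Fintype.card_fin]

theorem exists_abs_sum_coprimeCount_sub_le (m W : ℕ) (hW : 1 ≤ W) :
    ∃ c : ℝ, ∀ (B Δ : ℝ) (M : ℕ), DivisorBound M Δ → B ≤ M →
      4 * (W : ℝ) ^ (130 * m + 879) ≤ B →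
      |((∑ y ∈ squarefreeBox (m + 5) W, coprimeCount y B : ℕ) : ℝ) - c * √B ^ (m + 3)| ≤
        4800 * (m + 5) * 2 ^ (2 * m + 5) * Δ * √B ^ (m + 3) / W := by
  have hW1 : (1 : ℝ) ≤ W := by exact_mod_cast hW
  set D := W ^ (m + 6) with hD
  set R := W ^ (4 * m + 27) with hR
  refine ⟨∑ y ∈ squarefreeBox (m + 5) W, sieveMain y D R, fun B Δ M hΔ hM hB => ?_⟩
  have hΔ1 := hΔ.1
  have hbound : ∀ y ∈ squarefreeBox (m + 5) W,
      |(coprimeCount y B : ℝ) - sieveMain y D R * √B ^ (m + 3)| ≤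
        2400 * (m + 5) * 2 ^ m * Δ * √B ^ (m + 3) * (2 / (W : ℝ) ^ (m + 6)) := by
    intro y hy
    rw [mem_squarefreeBox] at hy
    refine (abs_coprimeCount_sub_le (W := W) (D := D) (R := R)
      (fun i => (hy.1 i).1) (fun i => (hy.1 i).2) (Nat.one_le_pow _ _ hW) (Nat.one_le_pow _ _ hW)
      hΔ hM (le_trans (le_of_eq ?_) hB)).trans (le_of_eq ?_)
    · rw [hD, hR]; push_cast; ring
    · rw [hD, hR]
      push_cast
      have : (W : ℝ) ^ 3 * ((W : ℝ) ^ (m + 6)) ^ 3 / (W : ℝ) ^ (4 * m + 27) =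
          1 / (W : ℝ) ^ (m + 6) := by
        field_simp
        ring
      rw [this]
      ring
  rw [Nat.cast_sum, sum_mul, ← sum_sub_distrib]
  refine (abs_sum_le_sum_abs _ _).trans ((sum_le_sum hbound).trans ?_)
  rw [sum_const, nsmul_eq_mul]
  have hcard : (#(squarefreeBox (m + 5) W) : ℝ) ≤ (2 * W) ^ (m + 5) := by
    exact_mod_cast card_squarefreeBox_le (m + 5) W
  calc _ ≤ (2 * (W : ℝ)) ^ (m + 5) *
        (2400 * (m + 5) * 2 ^ m * Δ * √B ^ (m + 3) * (2 / (W : ℝ) ^ (m + 6))) := by gcongr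
    _ = _ := by
      field_simp
      ring

/-- The set whose cardinality is estimated. -/
def solutionSet (k : ℕ) (B : ℝ) : Set ((Fin k → ℤ) × (Fin k → ℤ)) :=
  {xy | (∀ i, xy.1 i ≠ 0) ∧ (∀ i, xy.2 i ≠ 0) ∧ (∀ i, Squarefree (xy.2 i)) ∧
    (∑ i, (xy.1 i)^2 * (xy.2 i)^3) = 0 ∧ Finset.univ.gcd (fun i => xy.1 i * xy.2 i) = 1 ∧
    (∀ i, (|(xy.1 i)^2 * (xy.2 i)^3| : ℝ) ≤ B)}

theorem mem_rectUnion_of_mem_solutionSet {k : ℕ} {B : ℝ} {p : (Fin k → ℤ) × (Fin k → ℤ)}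
    (hp : p ∈ solutionSet k B) {i : Fin k} {J : ℕ} (hJ : 2 ^ J ≤ (p.2 i).natAbs) :
    (p.1 i, p.2 i) ∈ rectUnion B J :=
  mem_rectUnion (hp.1 i) (hp.2.1 i) (hp.2.2.2.2.2 i) hJ

theorem finite_solutionSet (k : ℕ) (B : ℝ) : (solutionSet k B).Finite := by
  refine ((Fintype.piFinset fun _ : Fin k => rectUnion B 0).finite_toSet.image fun p =>
    ((fun i => (p i).1, fun i => (p i).2) : (Fin k → ℤ) × (Fin k → ℤ))).subset fun p hp => ?_
  refine ⟨fun i => (p.1 i, p.2 i), ?_, rfl⟩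
  rw [mem_coe, Fintype.mem_piFinset]
  intro i
  refine mem_rectUnion_of_mem_solutionSet hp ?_
  have := hp.2.1 i
  omega

theorem ncard_small_solutionSet (k W : ℕ) (B : ℝ) :
    {p ∈ solutionSet k B | ∀ i, |p.2 i| ≤ W}.ncard =
      ∑ y ∈ squarefreeBox k W, coprimeCount y B := by
  classical
  have hfin := (finite_solutionSet k B).subset
    (Set.sep_subset (solutionSet k B) fun p => ∀ i, |p.2 i| ≤ W)
  rw [Set.ncard_eq_toFinset_card _ hfin, card_eq_sum_card_fiberwise (f := Prod.snd)
    (t := squarefreeBox k W)]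
  · refine sum_congr rfl fun y hy => ?_
    rw [mem_squarefreeBox] at hy
    have hy0 : ∀ i, y i ^ 3 ≠ 0 := fun i => pow_ne_zero 3 (hy.1 i).1
    refine card_bij (fun p _ => p.1) ?_ ?_ ?_
    · rintro ⟨x, y'⟩ hp
      rw [mem_filter, hfin.mem_toFinset] at hp
      obtain ⟨⟨⟨h1, h2, h3, h4, h5, h6⟩, -⟩, rfl⟩ := hp
      rw [mem_filter, Fintype.mem_piFinset]
      refine ⟨fun i => (mem_nonzeroBox_quadWidth (hy0 i)).mpr ⟨h1 i, ?_⟩, h4, h5⟩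
      have := h6 i
      rw [mul_comm] at this
      exact_mod_cast this
    · rintro ⟨x, y'⟩ hp ⟨x', y''⟩ hp' h
      rw [mem_filter] at hp hp'
      exact Prod.ext h (hp.2.trans hp'.2.symm)
    · intro x hx
      rw [mem_filter, Fintype.mem_piFinset] at hx
      refine ⟨(x, y), ?_, rfl⟩
      rw [mem_filter, hfin.mem_toFinset]
      have hx0 := fun i => (mem_nonzeroBox_quadWidth (hy0 i)).mp (hx.1 i)
      refine ⟨⟨⟨fun i => (hx0 i).1, fun i => (hy.1 i).1, hy.2, hx.2.1, hx.2.2, fun i => ?_⟩,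
        fun i => (hy.1 i).2⟩, rfl⟩
      have := (hx0 i).2
      rw [mul_comm] at this
      exact_mod_cast this
  · intro p hp
    rw [mem_coe, hfin.mem_toFinset] at hp
    rw [mem_coe, mem_squarefreeBox]
    exact ⟨fun i => ⟨hp.1.2.1 i, hp.2 i⟩, hp.1.2.2.1⟩

theorem ncard_large_solutionSet_le (k J : ℕ) (B : ℝ) :
    {p ∈ solutionSet k B | ¬ ∀ i, |p.2 i| ≤ ((2 ^ J : ℕ) : ℤ)}.ncard ≤
      ∑ i₀ : Fin k, #{p ∈ Fintype.piFinset (fun i : Fin k => rectUnion B (if i = i₀ then J else 0)) |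
        ∑ i, sqCube (p i) = 0} := by
  classical
  set T : Fin k → Finset (Fin k → ℤ × ℤ) := fun i₀ =>
    {p ∈ Fintype.piFinset (fun i : Fin k => rectUnion B (if i = i₀ then J else 0)) |
        ∑ i, sqCube (p i) = 0} with hT
  set f : (Fin k → ℤ × ℤ) → (Fin k → ℤ) × (Fin k → ℤ) :=
    fun p => (fun i => (p i).1, fun i => (p i).2) with hf
  have hsub : {p ∈ solutionSet k B | ¬ ∀ i, |p.2 i| ≤ ((2 ^ J : ℕ) : ℤ)} ⊆
      ((univ.biUnion T).image f : Finset _) := by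
    rintro p ⟨hp, hJ⟩
    push Not at hJ
    obtain ⟨i₀, hi₀⟩ := hJ
    rw [mem_coe, mem_image]
    refine ⟨fun i => (p.1 i, p.2 i), ?_, rfl⟩
    rw [mem_biUnion]
    refine ⟨i₀, mem_univ _, ?_⟩
    rw [hT, mem_filter, Fintype.mem_piFinset]
    refine ⟨fun i => mem_rectUnion_of_mem_solutionSet hp ?_, hp.2.2.2.1⟩
    split_ifs with h
    · rw [h, ← Int.ofNat_le, Int.natCast_natAbs]
      exact hi₀.le
    · have := hp.2.1 i
      rw [pow_zero]
      omega
  calc _ ≤ (((univ.biUnion T).image f : Finset _) : Set ((Fin k → ℤ) × (Fin k → ℤ))).ncard :=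
        Set.ncard_le_ncard hsub (finite_toSet _)
    _ = #((univ.biUnion T).image f) := Set.ncard_coe_finset _
    _ ≤ #(univ.biUnion T) := card_image_le
    _ ≤ _ := card_biUnion_le

theorem abs_ncard_solutionSet_sub_le (k J : ℕ) (B : ℝ) :
    |((solutionSet k B).ncard : ℝ) -
      ((∑ y ∈ squarefreeBox k (2 ^ J), coprimeCount y B : ℕ) : ℝ)| ≤
      ∑ i₀ : Fin k, (#{p ∈ Fintype.piFinset
        (fun i : Fin k => rectUnion B (if i = i₀ then J else 0)) | ∑ i, sqCube (p i) = 0} : ℝ) := by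
  have hsplit : {p ∈ solutionSet k B | ∀ i, |p.2 i| ≤ ((2 ^ J : ℕ) : ℤ)}.ncard +
      {p ∈ solutionSet k B | ¬ ∀ i, |p.2 i| ≤ ((2 ^ J : ℕ) : ℤ)}.ncard =
      (solutionSet k B).ncard := by
    rw [← Set.ncard_union_eq _ ((finite_solutionSet k B).subset (Set.sep_subset _ _))
      ((finite_solutionSet k B).subset (Set.sep_subset _ _))]
    · congr 1
      ext p
      simp only [Set.mem_union, Set.mem_ofPred_eq]
      tauto
    · exact Set.disjoint_left.mpr fun p h h' => h'.2 h.2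
  have hlarge := ncard_large_solutionSet_le k J B
  rw [← ncard_small_solutionSet, ← hsplit, Nat.cast_add, add_sub_cancel_left, Nat.abs_cast]
  exact_mod_cast hlarge

theorem ncard_solutionSet_mono (k : ℕ) {B B' : ℝ} (h : B ≤ B') :
    (solutionSet k B).ncard ≤ (solutionSet k B').ncard :=
  Set.ncard_le_ncard (fun _ hp => ⟨hp.1, hp.2.1, hp.2.2.1, hp.2.2.2.1, hp.2.2.2.2.1,
    fun i => (hp.2.2.2.2.2 i).trans h⟩) (finite_solutionSet k B')

/-- Approximations on overlapping geometric ranges, with geometrically decaying relative errors,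
combine to an asymptotic formula with a power saving. -/
theorem exists_asymptotic_of_geometric_ranges {N : ℝ → ℝ} {s : ℕ} {y θ K : ℝ} (hy : 1 < y)
    (hθ0 : 0 < θ) (hθ1 : θ < 1) (hK : 0 ≤ K) (hN0 : ∀ B, 0 ≤ N B)
    (hNy : ∀ B, B ≤ y → N B ≤ N y)
    (h : ∀ J : ℕ, ∃ c : ℝ, ∀ B, y ^ (J + 1) ≤ B → B ≤ y ^ (J + 2) →
      |N B - c * √B ^ s| ≤ K * √B ^ s * θ ^ J) :
    ∃ D : ℝ, 0 ≤ D ∧ ∃ δ > (0 : ℝ), ∃ K' > (0 : ℝ), ∀ B : ℝ, 1 ≤ B →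
      |N B - D * B ^ ((s : ℝ) / 2)| ≤ K' * B ^ ((s : ℝ) / 2 - δ) := by
  choose c hc using h
  have hy0 : 0 < y := by linarith
  have hpow : ∀ n : ℕ, y ^ n ≤ y ^ (n + 1) := fun n =>
    pow_le_pow_right₀ hy.le (Nat.le_succ n)
  have hsqrt : ∀ n : ℕ, 0 < √(y ^ n) ^ s := fun n => by positivity
  have hdist : ∀ J, dist (c J) (c (J + 1)) ≤ 2 * K * θ ^ J := by
    intro J
    set X := √(y ^ (J + 2)) ^ s with hX
    have hX0 : 0 < X := hsqrt _
    have h1 := hc J (y ^ (J + 2)) (hpow _) le_rfl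
    have h2 := hc (J + 1) (y ^ (J + 2)) le_rfl (hpow _)
    rw [← hX] at h1 h2
    have h3 : K * X * θ ^ (J + 1) ≤ K * X * θ ^ J := by
      have := pow_le_pow_of_le_one hθ0.le hθ1.le (Nat.le_succ J)
      gcongr
    rw [Real.dist_eq]
    refine le_of_mul_le_mul_right ?_ hX0
    rw [← abs_of_pos hX0, ← abs_mul, abs_of_pos hX0]
    calc |(c J - c (J + 1)) * X| =
          |(N (y ^ (J + 2)) - c (J + 1) * X) - (N (y ^ (J + 2)) - c J * X)| := by
            congr 1; ring
      _ ≤ _ := abs_sub _ _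
      _ ≤ 2 * K * θ ^ J * X := by linarith
  obtain ⟨D, hD⟩ := cauchySeq_tendsto_of_complete (cauchySeq_of_le_geometric θ (2 * K) hθ1 hdist)
  have hcD : ∀ J, |c J - D| ≤ 2 * K * θ ^ J / (1 - θ) := fun J =>
    dist_le_of_le_geometric_of_tendsto θ (2 * K) hθ1 hdist hD J
  have hD0 : 0 ≤ D := by
    have hlim : Filter.Tendsto (fun J : ℕ => -(K * θ ^ J)) Filter.atTop (nhds 0) := by
      have := ((tendsto_pow_atTop_nhds_zero_of_lt_one hθ0.le hθ1).const_mul K).neg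
      simpa using this
    refine le_of_tendsto_of_tendsto' hlim hD fun J => ?_
    have h1 := (abs_le.mp (hc J (y ^ (J + 1)) le_rfl (hpow _))).2
    have h2 := hN0 (y ^ (J + 1))
    refine le_of_mul_le_mul_right ?_ (hsqrt (J + 1))
    linarith
  have h1θ : 0 < 1 - θ := by linarith
  set δ := -Real.logb y θ with hδ
  have hδ0 : 0 < δ := by
    rw [hδ, neg_pos]
    exact Real.logb_neg hy hθ0 hθ1
  have hyδ : y ^ (-δ) = θ := by
    rw [hδ, neg_neg]
    exact Real.rpow_logb hy0 hy.ne' hθ0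
  have hsq : ∀ B : ℝ, 0 ≤ B → B ^ ((s : ℝ) / 2) = √B ^ s := by
    intro B hB
    rw [Real.sqrt_eq_rpow, ← Real.rpow_natCast, ← Real.rpow_mul hB]
    congr 1
    ring
  set K₁ := K + 2 * K / (1 - θ) with hK₁
  have hK₁0 : 0 ≤ K₁ := by positivity
  set K₂ := N y + D * √y ^ s with hK₂
  have hK₂0 : 0 ≤ K₂ := add_nonneg (hN0 y) (by positivity)
  refine ⟨D, hD0, δ, hδ0, K₁ / θ ^ 2 + K₂ / θ + 1, by positivity, fun B hB => ?_⟩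
  have hB0 : 0 < B := by linarith
  have hBs : 1 ≤ √B ^ s := one_le_pow₀ (Real.one_le_sqrt.mpr hB)
  have hBδ : 0 < B ^ (-δ) := Real.rpow_pos_of_pos hB0 _
  rw [sub_eq_add_neg _ δ, Real.rpow_add hB0, hsq B hB0.le]
  rcases lt_or_ge B y with hlt | hge
  · have h1 : θ ≤ B ^ (-δ) := by
      rw [← hyδ]
      exact Real.rpow_le_rpow_of_nonpos hB0 hlt.le (by linarith)
    have h2 : |N B - D * √B ^ s| ≤ K₂ := by
      have h3 := hNy B hlt.le
      have h4 : D * √B ^ s ≤ D * √y ^ s := by gcongr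
      have h5 := hN0 B
      have h6 : 0 ≤ D * √B ^ s := by positivity
      rw [abs_le]
      constructor <;> linarith [hN0 y]
    calc _ ≤ K₂ := h2
      _ = K₂ / θ * (1 * θ) := by field_simp
      _ ≤ (K₁ / θ ^ 2 + K₂ / θ + 1) * (√B ^ s * B ^ (-δ)) := by
          have : 0 ≤ K₁ / θ ^ 2 := by positivity
          gcongr
          linarith
  · obtain ⟨n, hn1, hn2⟩ := exists_nat_pow_near hB hy
    obtain ⟨J, rfl⟩ : ∃ J, n = J + 1 := by
      refine Nat.exists_eq_succ_of_ne_zero ?_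
      rintro rfl
      rw [zero_add, pow_one] at hn2
      linarith
    have h1 : θ ^ (J + 2) ≤ B ^ (-δ) := by
      rw [← hyδ, ← Real.rpow_natCast, ← Real.rpow_mul hy0.le, mul_comm, Real.rpow_mul hy0.le,
        Real.rpow_natCast]
      exact Real.rpow_le_rpow_of_nonpos hB0 hn2.le (by linarith)
    have h2 := hc J B hn1 hn2.le
    have h3 : |N B - D * √B ^ s| ≤ K₁ * √B ^ s * θ ^ J := by
      calc |N B - D * √B ^ s| = |(N B - c J * √B ^ s) + (c J - D) * √B ^ s| := by
            congr 1; ring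
        _ ≤ |N B - c J * √B ^ s| + |c J - D| * √B ^ s := by
            refine (abs_add_le _ _).trans_eq ?_
            rw [abs_mul (c J - D), abs_of_pos (by linarith : 0 < √B ^ s)]
        _ ≤ K * √B ^ s * θ ^ J + 2 * K * θ ^ J / (1 - θ) * √B ^ s := by
            gcongr
            exact hcD J
        _ = K₁ * √B ^ s * θ ^ J := by rw [hK₁]; ring
    calc _ ≤ K₁ * √B ^ s * θ ^ J := h3
      _ = K₁ / θ ^ 2 * (√B ^ s * θ ^ (J + 2)) := by rw [pow_add]; field_simp
      _ ≤ (K₁ / θ ^ 2 + K₂ / θ + 1) * (√B ^ s * B ^ (-δ)) := by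
          have : 0 ≤ K₂ / θ := by positivity
          gcongr
          linarith

theorem exists_abs_ncard_solutionSet_sub_le (m J : ℕ) {ρ : ℝ} (hρ : 0 < ρ)
    (hρ40 : ρ ^ 40 = 1 / 2) :
    ∃ c : ℝ, ∀ (B Δ : ℝ) (M : ℕ), DivisorBound M Δ → 8 * B ≤ M →
      4 * ((2 : ℝ) ^ J) ^ (130 * m + 879) ≤ B →
      |((solutionSet (m + 5) B).ncard : ℝ) - c * √B ^ (m + 3)| ≤
        2 ^ 19 * (m + 5) * 4 ^ m * Δ ^ (m + 9) * √B ^ (m + 3) * ρ ^ J := by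
  obtain ⟨c, hc⟩ := exists_abs_sum_coprimeCount_sub_le m (2 ^ J) Nat.one_le_two_pow
  refine ⟨c, fun B Δ M hΔ hM hB => ?_⟩
  have hΔ1 := hΔ.1
  have hB1 : 1 ≤ B := by
    have : (1 : ℝ) ≤ ((2 : ℝ) ^ J) ^ (130 * m + 879) := one_le_pow₀ (one_le_pow₀ (by norm_num))
    linarith
  have h1 := hc B Δ M hΔ (by linarith) (by push_cast; exact hB)
  have h2 := abs_ncard_solutionSet_sub_le (m + 5) J B
  have h3 := (h2.trans (sum_le_sum fun i₀ _ => card_tail_le m hB1 hΔ hM hρ hρ40 J i₀))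
  rw [sum_const, card_univ, Fintype.card_fin, nsmul_eq_mul] at h3
  have hρ1 : ρ ≤ 1 := by
    by_contra! hlt
    have := one_le_pow₀ (n := 40) hlt.le
    linarith
  have hhalf : 1 / (2 : ℝ) ^ J ≤ ρ ^ J := by
    rw [← one_div_pow, ← hρ40]
    gcongr
    exact pow_le_of_le_one hρ.le hρ1 (by norm_num)
  have hΔpow : Δ ≤ Δ ^ (m + 9) := le_self_pow₀ hΔ1 (by omega)
  set X := (m + 5) * 4 ^ m * Δ ^ (m + 9) * √B ^ (m + 3) * ρ ^ J with hX
  have hX0 : 0 ≤ X := by positivity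
  have h4 : 4800 * (m + 5) * 2 ^ (2 * m + 5) * Δ * √B ^ (m + 3) / ((2 ^ J : ℕ) : ℝ) ≤
      153600 * X := by
    have h5 : (2 : ℝ) ^ (2 * m + 5) = 4 ^ m * 32 := by
      rw [pow_add, pow_mul]; norm_num
    rw [h5, div_eq_mul_one_div]
    push_cast
    calc _ ≤ 4800 * ((m : ℝ) + 5) * (4 ^ m * 32) * Δ ^ (m + 9) * √B ^ (m + 3) * ρ ^ J := by gcongr
      _ = 153600 * X := by rw [hX]; ring
  calc _ ≤ _ := abs_sub_le _ _ _
    _ ≤ _ := add_le_add h3 (h1.trans h4)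
    _ = (2 ^ 15 + 153600) * X := by rw [hX]; push_cast; ring
    _ ≤ 2 ^ 19 * X := by gcongr; norm_num
    _ = _ := by rw [hX]; ring

theorem exists_approximations (m : ℕ) :
    ∃ y θ K : ℝ, 1 < y ∧ 0 < θ ∧ θ < 1 ∧ 0 ≤ K ∧
      ∀ J : ℕ, ∃ c : ℝ, ∀ B, y ^ (J + 1) ≤ B → B ≤ y ^ (J + 2) →
        |((solutionSet (m + 5) B).ncard : ℝ) - c * √B ^ (m + 3)| ≤
          K * √B ^ (m + 3) * θ ^ J := by
  obtain ⟨L, hL⟩ : ∃ L, L = 130 * m + 879 := ⟨_, rfl⟩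
  set θ : ℝ := 2 ^ (-(1 / 80) : ℝ) with hθ
  have hθ0 : 0 < θ := by positivity
  have hθ80 : θ ^ 80 = 1 / 2 := by
    rw [hθ, ← Real.rpow_natCast, ← Real.rpow_mul (by norm_num)]
    norm_num
  have hθ1 : θ < 1 := by
    by_contra! hlt
    have := one_le_pow₀ (n := 80) hlt
    linarith
  have hL0 : (0 : ℝ) < L := by rw [hL]; positivity
  set ε : ℝ := 1 / (80 * (m + 9) * L) with hε
  obtain ⟨C, hC1, hC⟩ := exists_divisorBound (ε := ε) (by positivity)
  refine ⟨2 ^ L, θ, 2 ^ 19 * (m + 5) * 4 ^ m * (C ^ (m + 9) / θ ^ 3),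
    one_lt_pow₀ (by norm_num) (by omega), hθ0, hθ1, by positivity, fun J => ?_⟩
  obtain ⟨c, hc⟩ := exists_abs_ncard_solutionSet_sub_le m J (ρ := θ ^ 2) (by positivity)
    (by rw [← pow_mul, ← hθ80])
  refine ⟨c, fun B hB1 hB2 => ?_⟩
  have h16 : (16 : ℝ) ≤ 2 ^ L := by
    calc (16 : ℝ) = 2 ^ 4 := by norm_num
      _ ≤ 2 ^ L := pow_le_pow_right₀ (by norm_num) (by omega)
  have hB : 1 ≤ B := (one_le_pow₀ (by linarith)).trans hB1
  have hM : 8 * B ≤ (⌈8 * B⌉₊ : ℝ) := Nat.le_ceil _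
  have hM0 : ⌈8 * B⌉₊ ≠ 0 := by
    intro h
    rw [h, Nat.cast_zero] at hM
    linarith
  have hM1 : (⌈8 * B⌉₊ : ℝ) ≤ (2 ^ L) ^ (J + 3) := by
    have := Nat.ceil_lt_add_one (a := 8 * B) (by linarith)
    calc (⌈8 * B⌉₊ : ℝ) ≤ 16 * B := by linarith
      _ ≤ 2 ^ L * (2 ^ L) ^ (J + 2) := by gcongr
      _ = (2 ^ L) ^ (J + 3) := by ring
  have h1 := hc B _ _ (hC _ hM0) hM (by
    refine le_trans ?_ hB1
    rw [← hL, ← pow_mul, mul_comm J, pow_mul, pow_succ, mul_comm]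
    gcongr
    linarith)
  refine h1.trans ?_
  have hpow : ((⌈8 * B⌉₊ : ℝ) ^ ε) ^ (m + 9) ≤ 1 / θ ^ (J + 3) := by
    calc ((⌈8 * B⌉₊ : ℝ) ^ ε) ^ (m + 9) ≤ (((2 ^ L) ^ (J + 3) : ℝ) ^ ε) ^ (m + 9) := by gcongr
      _ = (2 : ℝ) ^ ((1 / 80 : ℝ) * ((J + 3 : ℕ) : ℝ)) := by
          rw [← pow_mul, ← Real.rpow_natCast (2 : ℝ), ← Real.rpow_mul (by norm_num),
            ← Real.rpow_natCast _ (m + 9), ← Real.rpow_mul (by norm_num)]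
          congr 1
          rw [hε]
          push_cast
          field_simp
      _ = 1 / θ ^ (J + 3) := by
          rw [Real.rpow_mul (by norm_num), Real.rpow_natCast, hθ, Real.rpow_neg (by norm_num),
            inv_pow, div_inv_eq_mul, one_mul]
  rw [mul_pow]
  calc _ ≤ 2 ^ 19 * (m + 5) * 4 ^ m * (C ^ (m + 9) * (1 / θ ^ (J + 3))) * √B ^ (m + 3) *
        (θ ^ 2) ^ J := by gcongr
    _ = _ := by
      field_simp
      ring

end SquarefulHyperplane

open SquarefulHyperplane

theorem count_M_asymptotic (n : ℕ) (hn : 4 ≤ n) :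
    ∃ D : ℝ, 0 ≤ D ∧ ∃ δ > (0:ℝ), ∃ K > (0:ℝ), ∀ B : ℝ, 1 ≤ B →
      |(Set.ncard {xy : (Fin (n+1) → ℤ) × (Fin (n+1) → ℤ) |
          (∀ i, xy.1 i ≠ 0) ∧ (∀ i, xy.2 i ≠ 0) ∧ (∀ i, Squarefree (xy.2 i)) ∧
          (∑ i, (xy.1 i)^2 * (xy.2 i)^3) = 0 ∧
          Finset.univ.gcd (fun i => xy.1 i * xy.2 i) = 1 ∧
          (∀ i, (|(xy.1 i)^2 * (xy.2 i)^3| : ℝ) ≤ B)} : ℝ)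
        - D * B ^ (((n:ℝ) - 1)/2)| ≤ K * B ^ (((n:ℝ) - 1)/2 - δ) := by
  obtain ⟨m, rfl⟩ := Nat.exists_eq_add_of_le' hn
  obtain ⟨y, θ, K, hy, hθ0, hθ1, hK, h⟩ := exists_approximations m
  have hexp : (((m + 4 : ℕ) : ℝ) - 1) / 2 = ((m + 3 : ℕ) : ℝ) / 2 := by push_cast; ring
  rw [hexp]
  exact exists_asymptotic_of_geometric_ranges hy hθ0 hθ1 hK (fun B => Nat.cast_nonneg _)
    (fun B hB => Nat.cast_le.mpr (ncard_solutionSet_mono (m + 5) hB)) h
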